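/- arXiv:1306.2582 — 2 statements merged into one kernel-verified Lean document; each statement's English description precedes it below -/
import Mathlib

section
/- Let M be a V(a_2)-supermodule with no projective submodules satisfying conditions (1), (2), and (3). Then Ω^n(M) satisfies conditions (1), (2), and (3) for all n ≥ 0. -/
/-!
A concrete model of the supermodule categories of the paper "On Endotrivial
Modules for Lie Superalgebras" attached to the detecting subalgebras
`e_r = q(1)^{×r}`, `f_n = sl(1|1)^{×n}`, to rank-one subalgebras `⟨z⟩` of
`sl(1|1)`, and to the exterior superalgebras `V(a_r) = Λ((a_r)₁)`.

A `GSupMod k ι` is a finite-dimensional `ℤ₂`-graded `k`-vector space together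
with a family of odd operators `θ i` (the actions of the distinguished odd
basis elements of the superalgebra: the `e_i` for `e_r`, the `x_i, y_i` for
`f_n`, the `a_i` for `V(a_r)`).  The even parts of all these superalgebras are
generated by the brackets of the odd generators, so the relations defining
each particular category, as well as complete reducibility over the even part,
are imposed by a predicate `𝒞 : GSupMod k ι → Prop`, defined separately for
each case.  All categorical notions (homomorphisms, isomorphisms, direct sums,
tensor products, duals, internal Hom, trivial modules, projectivity,
projective covers and injective hulls, syzygies `Ωⁿ` for `n : ℤ`, endotrivial
modules, and the group `T` of stable classes of endotrivial modules) are
defined relative to such a predicate.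
-/

noncomputable section

namespace SupCat

open Submodule

/-- A finite-dimensional `ℤ₂`-graded `k`-vector space with a family of odd
operators `θ i`, indexed by `ι` (the underlying data of a supermodule over a
superalgebra whose odd part has a distinguished basis indexed by `ι`). -/
structure GSupMod (k : Type) [Field k] (ι : Type) : Type 1 where
  carrier : Type
  [isAddCommGroup : AddCommGroup carrier]
  [isModule : Module k carrier]
  [isFinite : FiniteDimensional k carrier]
  /-- the even component -/
  ev : Submodule k carrier
  /-- the odd component -/
  od : Submodule k carrier
  isCompl : IsCompl ev od
  /-- the (odd) actions of the distinguished odd basis elements -/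
  θ : ι → (carrier →ₗ[k] carrier)
  θ_ev : ∀ i, ∀ m ∈ ev, θ i m ∈ od
  θ_od : ∀ i, ∀ m ∈ od, θ i m ∈ ev

attribute [instance] GSupMod.isAddCommGroup GSupMod.isModule GSupMod.isFinite

namespace GSupMod

variable {k : Type} [Field k] {ι : Type}

/-- The action of a general odd element `v = ∑ v i • (basis element i)`. -/
def actOf [Fintype ι] (M : GSupMod k ι) (v : ι → k) : M.carrier →ₗ[k] M.carrier :=
  ∑ i, v i • M.θ i

/-- The grading involution `σ` of a supermodule: `+1` on the even part and
`-1` on the odd part. -/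
def sigma (M : GSupMod k ι) : M.carrier →ₗ[k] M.carrier :=
  M.ev.subtype ∘ₗ Submodule.linearProjOfIsCompl M.ev M.od M.isCompl
    - M.od.subtype ∘ₗ Submodule.linearProjOfIsCompl M.od M.ev M.isCompl.symm

/-- `f` is a homomorphism of supermodules (an equivariant linear map of
degree `0̄`). -/
def IsHom (M N : GSupMod k ι) (f : M.carrier →ₗ[k] N.carrier) : Prop :=
  (∀ i, f ∘ₗ M.θ i = N.θ i ∘ₗ f) ∧
  (∀ m ∈ M.ev, f m ∈ N.ev) ∧ (∀ m ∈ M.od, f m ∈ N.od)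

/-- `M ≅ N` as supermodules. -/
def Iso (M N : GSupMod k ι) : Prop :=
  ∃ e : M.carrier ≃ₗ[k] N.carrier, IsHom M N (e : M.carrier →ₗ[k] N.carrier)

/-- `S` is (isomorphic to) the direct sum `A ⊕ B`. -/
def IsDsum (A B S : GSupMod k ι) : Prop :=
  ∃ φ : S.carrier ≃ₗ[k] A.carrier × B.carrier,
    (∀ s, s ∈ S.ev ↔ (φ s).1 ∈ A.ev ∧ (φ s).2 ∈ B.ev) ∧
    (∀ s, s ∈ S.od ↔ (φ s).1 ∈ A.od ∧ (φ s).2 ∈ B.od) ∧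
    ∀ (i : ι) (s : S.carrier),
      φ (S.θ i s) = LinearMap.prodMap (A.θ i) (B.θ i) (φ s)

/-- `M` is (isomorphic to) the trivial supermodule of parity `p`: `k_ev`
for `p = false`, and `k_od = Π(k_ev)` for `p = true`. -/
def IsTrivial (p : Bool) (M : GSupMod k ι) : Prop :=
  Module.finrank k M.carrier = 1 ∧ (∀ i, M.θ i = 0) ∧
    (if p then M.od = ⊤ else M.ev = ⊤)

/-- `M` is indecomposable. -/
def Indecomposable (M : GSupMod k ι) : Prop :=
  (∃ m : M.carrier, m ≠ 0) ∧
  ∀ A B : GSupMod k ι, IsDsum A B M →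
    (∀ a : A.carrier, a = 0) ∨ (∀ b : B.carrier, b = 0)

/-- `M` is a simple supermodule: nonzero, with no proper nonzero graded
invariant submodule. -/
def IsSimple (M : GSupMod k ι) : Prop :=
  (∃ m : M.carrier, m ≠ 0) ∧
  ∀ N : Submodule k M.carrier,
    (∀ i, ∀ m ∈ N, M.θ i m ∈ N) →
    N = (N ⊓ M.ev) ⊔ (N ⊓ M.od) →
    N = ⊥ ∨ N = ⊤

variable (𝒞 : GSupMod k ι → Prop)

/-- `P` is a projective object of the category cut out by `𝒞` (defined by the
lifting property). -/
def IsProjective (P : GSupMod k ι) : Prop :=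
  𝒞 P ∧
  ∀ (M N : GSupMod k ι) (π : M.carrier →ₗ[k] N.carrier)
    (f : P.carrier →ₗ[k] N.carrier),
    𝒞 M → 𝒞 N → IsHom M N π → Function.Surjective π → IsHom P N f →
    ∃ h : P.carrier →ₗ[k] M.carrier, IsHom P M h ∧ π ∘ₗ h = f

/-- `I` is an injective object of the category cut out by `𝒞`. -/
def IsInjective (I : GSupMod k ι) : Prop :=
  𝒞 I ∧
  ∀ (M N : GSupMod k ι) (j : M.carrier →ₗ[k] N.carrier)
    (f : M.carrier →ₗ[k] I.carrier),
    𝒞 M → 𝒞 N → IsHom M N j → Function.Injective j → IsHom M I f →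
    ∃ h : N.carrier →ₗ[k] I.carrier, IsHom N I h ∧ h ∘ₗ j = f

/-- `π : P ↠ M` is a projective cover. -/
def IsProjCover (P M : GSupMod k ι) (π : P.carrier →ₗ[k] M.carrier) : Prop :=
  IsProjective 𝒞 P ∧ IsHom P M π ∧ Function.Surjective π ∧
  ∀ (Q : GSupMod k ι) (f : Q.carrier →ₗ[k] P.carrier),
    𝒞 Q → IsHom Q P f → Function.Surjective (π ∘ₗ f) → Function.Surjective f

/-- `j : M ↪ I` is an injective hull. -/
def IsInjHull (M I : GSupMod k ι) (j : M.carrier →ₗ[k] I.carrier) : Prop :=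
  IsInjective 𝒞 I ∧ IsHom M I j ∧ Function.Injective j ∧
  ∀ (Q : GSupMod k ι) (f : I.carrier →ₗ[k] Q.carrier),
    𝒞 Q → IsHom I Q f → Function.Injective (f ∘ₗ j) → Function.Injective f

/-- `N` is (isomorphic to) the first syzygy `Ω¹(M)`, the kernel of a
projective cover of `M`. -/
def IsSyzygy (M N : GSupMod k ι) : Prop :=
  𝒞 N ∧
  ∃ (P : GSupMod k ι) (π : P.carrier →ₗ[k] M.carrier)
    (i : N.carrier →ₗ[k] P.carrier),
    IsProjCover 𝒞 P M π ∧ IsHom N P i ∧ Function.Injective i ∧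
    LinearMap.range i = LinearMap.ker π

/-- `N` is (isomorphic to) the first cosyzygy `Ω⁻¹(M)`, the cokernel of the
inclusion of `M` into its injective hull. -/
def IsCosyzygy (M N : GSupMod k ι) : Prop :=
  𝒞 N ∧
  ∃ (I : GSupMod k ι) (j : M.carrier →ₗ[k] I.carrier)
    (p : I.carrier →ₗ[k] N.carrier),
    IsInjHull 𝒞 M I j ∧ IsHom I N p ∧ Function.Surjective p ∧
    LinearMap.ker p = LinearMap.range j

/-- `M` has no nonzero projective direct summand (equivalently, since the
category is self-injective, no nonzero projective submodule). -/
def NoProjSummands (M : GSupMod k ι) : Prop :=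
  ∀ A B : GSupMod k ι, IsProjective 𝒞 A → IsDsum A B M → ∀ a : A.carrier, a = 0

/-- `N` is (isomorphic to) `Ω⁰(M)`, the complement of the largest projective
direct summand of `M`. -/
def IsOmegaZero (M N : GSupMod k ι) : Prop :=
  ∃ Q : GSupMod k ι, IsProjective 𝒞 Q ∧ NoProjSummands 𝒞 N ∧ IsDsum N Q M

/-- `N` is (isomorphic to) `Ωⁿ(M)` for `n ∈ ℕ`. -/
def IsOmegaPow : ℕ → GSupMod k ι → GSupMod k ι → Prop
  | 0, M, N => IsOmegaZero 𝒞 M N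
  | n+1, M, N => ∃ L, IsOmegaPow n M L ∧ IsSyzygy 𝒞 L N

/-- `N` is (isomorphic to) `Ω⁻ⁿ(M)` for `n ∈ ℕ`. -/
def IsOmegaNegPow : ℕ → GSupMod k ι → GSupMod k ι → Prop
  | 0, M, N => IsOmegaZero 𝒞 M N
  | n+1, M, N => ∃ L, IsOmegaNegPow n M L ∧ IsCosyzygy 𝒞 L N

/-- `N` is (isomorphic to) the syzygy `Ωⁿ(M)`, for any `n : ℤ`. -/
def IsOmega (n : ℤ) (M N : GSupMod k ι) : Prop :=
  if 0 ≤ n then IsOmegaPow 𝒞 n.toNat M N else IsOmegaNegPow 𝒞 (-n).toNat M N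

/-- `H` is (isomorphic to) the internal Hom supermodule `Hom_k(M,N)` with its
usual grading and the super action of the odd generators
`(θ i · f)(m) = θ i (f m) - (-1)^{|f|} f (θ i m)` (the sign `(-1)^{|f|}` is
expressed via the grading involutions `σ`). -/
def IsHomObj (M N H : GSupMod k ι) : Prop :=
  ∃ φ : H.carrier ≃ₗ[k] (M.carrier →ₗ[k] N.carrier),
    (∀ h, h ∈ H.ev ↔ ((∀ m ∈ M.ev, φ h m ∈ N.ev) ∧ (∀ m ∈ M.od, φ h m ∈ N.od))) ∧
    (∀ h, h ∈ H.od ↔ ((∀ m ∈ M.ev, φ h m ∈ N.od) ∧ (∀ m ∈ M.od, φ h m ∈ N.ev))) ∧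
    ∀ (i : ι) (h : H.carrier),
      φ (H.θ i h) = N.θ i ∘ₗ φ h - (N.sigma ∘ₗ φ h ∘ₗ M.sigma) ∘ₗ M.θ i

/-- `T` is (isomorphic to) the tensor product supermodule `M ⊗_k N` with its
usual grading and the action of the odd generators
`θ i · (m ⊗ n) = (θ i m) ⊗ n + (-1)^{|m|} m ⊗ (θ i n)`. -/
def IsTensorObj (M N T : GSupMod k ι) : Prop :=
  ∃ φ : T.carrier ≃ₗ[k] TensorProduct k M.carrier N.carrier,
    Submodule.map (φ : T.carrier →ₗ[k] TensorProduct k M.carrier N.carrier) T.ev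
      = Submodule.span k
          ({z | ∃ m ∈ M.ev, ∃ n ∈ N.ev, z = m ⊗ₜ[k] n}
            ∪ {z | ∃ m ∈ M.od, ∃ n ∈ N.od, z = m ⊗ₜ[k] n}) ∧
    Submodule.map (φ : T.carrier →ₗ[k] TensorProduct k M.carrier N.carrier) T.od
      = Submodule.span k
          ({z | ∃ m ∈ M.ev, ∃ n ∈ N.od, z = m ⊗ₜ[k] n}
            ∪ {z | ∃ m ∈ M.od, ∃ n ∈ N.ev, z = m ⊗ₜ[k] n}) ∧
    ∀ (i : ι) (t : T.carrier),
      φ (T.θ i t)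
        = TensorProduct.map (M.θ i) (LinearMap.id : N.carrier →ₗ[k] N.carrier) (φ t)
            + TensorProduct.map M.sigma (N.θ i) (φ t)

/-- `D` is (isomorphic to) the dual supermodule `M* = Hom_k(M, k_ev)`, with
the action `(θ i · ψ)(m) = -(-1)^{|ψ|} ψ (θ i m)`. -/
def IsDualObj (M D : GSupMod k ι) : Prop :=
  ∃ φ : D.carrier ≃ₗ[k] Module.Dual k M.carrier,
    (∀ d, d ∈ D.ev ↔ ∀ m ∈ M.od, φ d m = 0) ∧
    (∀ d, d ∈ D.od ↔ ∀ m ∈ M.ev, φ d m = 0) ∧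
    ∀ (i : ι) (d : D.carrier),
      φ (D.θ i d) = - (φ d) ∘ₗ (M.sigma ∘ₗ M.θ i)

/-- `M` is an endotrivial supermodule of the category cut out by `𝒞`:
`Hom_k(M,M) ≅ k_ev ⊕ P` with `P` projective. -/
def IsEndotrivial (M : GSupMod k ι) : Prop :=
  𝒞 M ∧
  ∃ H K P S : GSupMod k ι, IsHomObj M M H ∧ 𝒞 H ∧ IsTrivial false K ∧
    IsProjective 𝒞 P ∧ IsDsum K P S ∧ Iso H S

/-- `M` and `N` are isomorphic in the stable module category: they become
isomorphic after adding projective direct summands. -/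
def StIso (M N : GSupMod k ι) : Prop :=
  ∃ P Q S T : GSupMod k ι, IsProjective 𝒞 P ∧ IsProjective 𝒞 Q ∧
    IsDsum M P S ∧ IsDsum N Q T ∧ Iso S T

/-- `R` is (isomorphic to) the restriction of `M` along the subalgebra of the
odd space spanned by the vectors `ε j`: the same underlying graded vector
space, where the `j`-th odd generator acts as the element `ε j` did on `M`. -/
def IsRestriction {ι' : Type} [Fintype ι] (ε : ι' → ι → k)
    (M : GSupMod k ι) (R : GSupMod k ι') : Prop :=
  ∃ φ : R.carrier ≃ₗ[k] M.carrier,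
    (∀ m, m ∈ R.ev ↔ φ m ∈ M.ev) ∧
    (∀ m, m ∈ R.od ↔ φ m ∈ M.od) ∧
    ∀ (j : ι') (m : R.carrier), φ (R.θ j m) = actOf M (ε j) (φ m)

/-- The radical `Rad(M)` of a supermodule over one of the detecting
superalgebras on the principal block: the span of the images of the odd
generators. -/
def radical (M : GSupMod k ι) : Submodule k M.carrier :=
  ⨆ i, LinearMap.range (M.θ i)

/-- The rank `Rk(M) = dim_k (M / Rad M)`. -/
def rk (M : GSupMod k ι) : ℕ :=
  Module.finrank k (M.carrier ⧸ radical M)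

end GSupMod

open GSupMod

variable {k : Type} [Field k]

/-- The category of supermodules (in the principal block) over the exterior
superalgebra `V(a_r) = Λ((a_r)₁)` on the purely odd abelian `r`-dimensional
space `(a_r)₁`: the odd generators pairwise super-anticommute (in particular
they square to zero).  Complete reducibility over the even part is automatic
since the even part acts by zero. -/
def VCat (k : Type) [Field k] (r : ℕ) : GSupMod k (Fin r) → Prop :=
  fun M => ∀ i j, M.θ i ∘ₗ M.θ j + M.θ j ∘ₗ M.θ i = 0

/-- The relation on endotrivial supermodules inducing the group `T`: stable
isomorphism. -/
def TRel {ι : Type} (𝒞 : GSupMod k ι → Prop) :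
    {M : GSupMod k ι // IsEndotrivial 𝒞 M} →
    {M : GSupMod k ι // IsEndotrivial 𝒞 M} → Prop :=
  fun M N => StIso 𝒞 M.1 N.1

/-- The underlying set of the group `T`: stable isomorphism classes of
endotrivial supermodules. -/
def TGrp {ι : Type} (𝒞 : GSupMod k ι → Prop) : Type 1 := Quot (TRel 𝒞)

/-- The stable class of an endotrivial supermodule. -/
def tmk {ι : Type} (𝒞 : GSupMod k ι → Prop)
    (M : {M : GSupMod k ι // IsEndotrivial 𝒞 M}) : TGrp 𝒞 :=
  Quot.mk (TRel 𝒞) M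

/-- An abelian group structure on `T` whose multiplication, identity and
inverse are induced by tensor product, the trivial module `k_ev` and duality
respectively. -/
structure TGroupData {ι : Type} (𝒞 : GSupMod k ι → Prop) : Type 1 where
  mul : TGrp 𝒞 → TGrp 𝒞 → TGrp 𝒞
  one : TGrp 𝒞
  inv : TGrp 𝒞 → TGrp 𝒞
  mul_assoc : ∀ a b c, mul (mul a b) c = mul a (mul b c)
  mul_comm : ∀ a b, mul a b = mul b a
  one_mul : ∀ a, mul one a = a
  inv_mul : ∀ a, mul (inv a) a = one
  mul_spec : ∀ (M N : {M : GSupMod k ι // IsEndotrivial 𝒞 M}) (T : GSupMod k ι)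
      (_ : IsTensorObj M.1 N.1 T) (hT : IsEndotrivial 𝒞 T),
      mul (tmk 𝒞 M) (tmk 𝒞 N) = tmk 𝒞 ⟨T, hT⟩
  one_spec : ∀ (K : GSupMod k ι) (_ : IsTrivial false K) (hK : IsEndotrivial 𝒞 K),
      one = tmk 𝒞 ⟨K, hK⟩
  inv_spec : ∀ (M : {M : GSupMod k ι // IsEndotrivial 𝒞 M}) (D : GSupMod k ι)
      (_ : IsDualObj M.1 D) (hD : IsEndotrivial 𝒞 D),
      inv (tmk 𝒞 M) = tmk 𝒞 ⟨D, hD⟩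

end SupCat

namespace SupCat

open GSupMod Submodule

variable {k : Type} [Field k]

/-- `v` is a generator of the `Ω^t(k|⟨a⟩)` component of some decomposition
`M|⟨a⟩ ≅ Ω^t(k|⟨a⟩) ⊕ P` (`t ∈ {0,1}`) of the restriction of `M` to the rank
one subalgebra `⟨a⟩` generated by the nonzero odd element `a`, where `P` is a
projective `⟨a⟩`-supermodule.  Over `⟨a⟩` (an exterior algebra on one odd
generator) the component `Ω^t(k|⟨a⟩)` is one-dimensional and trivial, so a
generator of it is a spanning vector `v` killed by `a`; and a finite
dimensional `⟨a⟩`-module is projective (= free) precisely when the kernel of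
`a` on it coincides with the image of `a`. -/
def IsOmegaComponentGen (M : GSupMod k (Fin 2)) (a : Fin 2 → k)
    (v : M.carrier) : Prop :=
  v ≠ 0 ∧
  ∃ L P : Submodule k M.carrier,
    IsCompl L P ∧
    L = Submodule.span k {v} ∧
    L = (L ⊓ M.ev) ⊔ (L ⊓ M.od) ∧
    P = (P ⊓ M.ev) ⊔ (P ⊓ M.od) ∧
    actOf M a v = 0 ∧
    P ⊓ LinearMap.ker (actOf M a) = Submodule.map (actOf M a) P

/-- Condition (1): `Rk(M) > Rk(Ω⁻¹(M))`, where `Rk(M) = dim_k M/Rad(M)`. -/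
def Cond1 (M : GSupMod k (Fin 2)) : Prop :=
  ∀ N : GSupMod k (Fin 2), IsCosyzygy (VCat k 2) M N → rk N < rk M

/-- Condition (2): for every nonzero `a = c₁a₁ + c₂a₂ ∈ (a₂)₁`,
`M|⟨a⟩ ≅ Ω^t(k|⟨a⟩) ⊕ P` where `t ∈ {0,1}`, `P` is a projective
`⟨a⟩`-supermodule, and `k` is the trivial module (of either parity). -/
def Cond2 (M : GSupMod k (Fin 2)) : Prop :=
  ∀ a : Fin 2 → k, a ≠ 0 →
    ∃ (p : Bool) (t : Fin 2) (K T P R : GSupMod k (Fin 1)),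
      IsTrivial p K ∧
      ((t = 0 ∧ Iso K T) ∨ (t = 1 ∧ IsSyzygy (VCat k 1) K T)) ∧
      IsProjective (VCat k 1) P ∧
      IsRestriction ![a] M R ∧
      IsDsum T P R

/-- Condition (3): `M` satisfies (2); every generator `v` of the
`Ω^t(k|⟨a⟩)` component of `M|⟨a⟩` is a generator of `M` (i.e. `v ∉ Rad M`);
and for any generator `m` of `M`, either `a.m ≠ 0` or `b.m ≠ 0`, where `b` is
a nonzero element of `(a₂)₁` not in the span of `a`. -/
def Cond3 (M : GSupMod k (Fin 2)) : Prop :=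
  Cond2 M ∧
  ∀ a : Fin 2 → k, a ≠ 0 →
    (∀ v : M.carrier, IsOmegaComponentGen M a v → v ∉ radical M) ∧
    (∀ b : Fin 2 → k, b ∉ Submodule.span k {a} →
      ∀ m : M.carrier, m ∉ radical M →
        actOf M a m ≠ 0 ∨ actOf M b m ≠ 0)

end SupCat

namespace SupCat.Aux

open SupCat SupCat.GSupMod

variable {k : Type} [Field k] {ι ι' : Type}

/-- projection to the even part -/
def pe (M : GSupMod k ι) : M.carrier →ₗ[k] M.carrier :=
  M.ev.subtype ∘ₗ Submodule.projectionOnto M.ev M.od M.isCompl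

lemma pe_mem (M : GSupMod k ι) (x : M.carrier) : pe M x ∈ M.ev := by
  simp [pe]

lemma pe_ev (M : GSupMod k ι) {x : M.carrier} (h : x ∈ M.ev) : pe M x = x :=
  congrArg Subtype.val (Submodule.projectionOnto_apply_left M.isCompl ⟨x, h⟩)

lemma pe_od (M : GSupMod k ι) {x : M.carrier} (h : x ∈ M.od) : pe M x = 0 :=
  congrArg Subtype.val (Submodule.projectionOnto_apply_right M.isCompl ⟨x, h⟩)

lemma pe_sub_mem (M : GSupMod k ι) (x : M.carrier) : x - pe M x ∈ M.od := by
  obtain ⟨a, ha, b, hb, rfl⟩ := Submodule.mem_sup.1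
    (show x ∈ M.ev ⊔ M.od by rw [M.isCompl.sup_eq_top]; trivial)
  simpa [pe_ev M ha, pe_od M hb] using hb

lemma mem_ev_iff (M : GSupMod k ι) {x : M.carrier} : x ∈ M.ev ↔ pe M x = x :=
  ⟨pe_ev M, fun h => h ▸ pe_mem M x⟩

lemma mem_od_iff (M : GSupMod k ι) {x : M.carrier} : x ∈ M.od ↔ pe M x = 0 :=
  ⟨pe_od M, fun h => by simpa [h] using pe_sub_mem M x⟩

/-- even linear maps -/
def IsEv (A : GSupMod k ι) (B : GSupMod k ι') (f : A.carrier →ₗ[k] B.carrier) : Prop :=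
  (∀ m ∈ A.ev, f m ∈ B.ev) ∧ (∀ m ∈ A.od, f m ∈ B.od)

lemma IsEv.pe {A : GSupMod k ι} {B : GSupMod k ι'} {f : A.carrier →ₗ[k] B.carrier}
    (h : IsEv A B f) (x : A.carrier) : f (pe A x) = Aux.pe B (f x) := by
  have h1 := pe_ev B (h.1 _ (pe_mem A x))
  have h2 := pe_od B (h.2 _ (pe_sub_mem A x))
  rw [map_sub, map_sub, sub_eq_zero] at h2
  rw [h2, h1]

lemma odd_pe {A : GSupMod k ι} {B : GSupMod k ι'} {f : A.carrier →ₗ[k] B.carrier}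
    (h : ∀ m ∈ A.ev, f m ∈ B.od) (h' : ∀ m ∈ A.od, f m ∈ B.ev)
    (x : A.carrier) : f (pe A x) = f x - pe B (f x) := by
  have h1 := pe_od B (h _ (pe_mem A x))
  have h2 := pe_ev B (h' _ (pe_sub_mem A x))
  rw [map_sub, map_sub, h1] at h2
  rw [sub_zero] at h2
  rw [h2]; abel

/-- make a linear map even -/
def evz (A : GSupMod k ι) (B : GSupMod k ι') (f : A.carrier →ₗ[k] B.carrier) :
    A.carrier →ₗ[k] B.carrier :=
  pe B ∘ₗ f ∘ₗ pe A + (LinearMap.id - pe B) ∘ₗ f ∘ₗ (LinearMap.id - pe A)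

lemma evz_apply (A : GSupMod k ι) (B : GSupMod k ι') (f : A.carrier →ₗ[k] B.carrier) (x) :
    evz A B f x = pe B (f (pe A x)) + (f (x - pe A x) - pe B (f (x - pe A x))) := rfl

lemma evz_isEv (A : GSupMod k ι) (B : GSupMod k ι') (f : A.carrier →ₗ[k] B.carrier) :
    IsEv A B (evz A B f) := by
  constructor
  · intro m hm
    rw [evz_apply, pe_ev A hm]; simpa using pe_mem B _
  · intro m hm
    rw [evz_apply, pe_od A hm]; simpa using pe_sub_mem B _

lemma IsEv.comp {ι'' : Type} {A : GSupMod k ι} {B : GSupMod k ι'} {C : GSupMod k ι''}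
    {f : A.carrier →ₗ[k] B.carrier} {g : B.carrier →ₗ[k] C.carrier}
    (hg : IsEv B C g) (hf : IsEv A B f) : IsEv A C (g ∘ₗ f) :=
  ⟨fun m hm => hg.1 _ (hf.1 m hm), fun m hm => hg.2 _ (hf.2 m hm)⟩

lemma pe_pe (M : GSupMod k ι) (x : M.carrier) : pe M (pe M x) = pe M x :=
  pe_ev M (pe_mem M x)

lemma exists_even_retraction {A : GSupMod k ι} {B : GSupMod k ι'} {j : A.carrier →ₗ[k] B.carrier}
    (hj : IsEv A B j) (inj : Function.Injective j) :
    ∃ r : B.carrier →ₗ[k] A.carrier, IsEv B A r ∧ ∀ x, r (j x) = x := by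
  obtain ⟨r, hr⟩ := LinearMap.exists_leftInverse_of_injective j (LinearMap.ker_eq_bot.2 inj)
  have hr' : ∀ x, r (j x) = x := fun x => LinearMap.congr_fun hr x
  refine ⟨evz B A r, evz_isEv _ _ _, fun x => ?_⟩
  rw [evz_apply, ← hj.pe, ← map_sub j, hr', hr', map_sub, pe_pe]; abel

lemma exists_even_section {A : GSupMod k ι} {B : GSupMod k ι'} {p : A.carrier →ₗ[k] B.carrier}
    (hp : IsEv A B p) (surj : Function.Surjective p) :
    ∃ s : B.carrier →ₗ[k] A.carrier, IsEv B A s ∧ ∀ x, p (s x) = x := by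
  obtain ⟨r, hr⟩ := LinearMap.exists_rightInverse_of_surjective p (LinearMap.range_eq_top.2 surj)
  have hr' : ∀ x, p (r x) = x := fun x => LinearMap.congr_fun hr x
  refine ⟨evz B A r, evz_isEv _ _ _, fun x => ?_⟩
  rw [evz_apply, map_add, map_sub, hp.pe, hp.pe, hr', hr', map_sub, pe_pe]; abel

/-- graded submodules -/
def Gr (A : GSupMod k ι) (S : Submodule k A.carrier) : Prop := ∀ x ∈ S, pe A x ∈ S

lemma Gr.eq {A : GSupMod k ι} {S : Submodule k A.carrier} (h : Gr A S) :
    S = (S ⊓ A.ev) ⊔ (S ⊓ A.od) := by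
  apply le_antisymm
  · intro x hx
    rw [← add_sub_cancel (pe A x) x]
    exact Submodule.add_mem_sup ⟨h x hx, pe_mem A x⟩ ⟨S.sub_mem hx (h x hx), pe_sub_mem A x⟩
  · exact sup_le inf_le_left inf_le_left

lemma Gr.sup {A : GSupMod k ι} {S T : Submodule k A.carrier} (hS : Gr A S) (hT : Gr A T) :
    Gr A (S ⊔ T) := by
  intro x hx
  obtain ⟨a, ha, b, hb, rfl⟩ := Submodule.mem_sup.1 hx
  rw [map_add]
  exact Submodule.add_mem_sup (hS a ha) (hT b hb)

lemma gr_ker_ev {A : GSupMod k ι} {B : GSupMod k ι'} {f : A.carrier →ₗ[k] B.carrier}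
    (h : IsEv A B f) : Gr A (LinearMap.ker f) := by
  intro x hx
  rw [LinearMap.mem_ker] at *
  rw [h.pe, hx, map_zero]

lemma gr_ker_od {A : GSupMod k ι} {B : GSupMod k ι'} {f : A.carrier →ₗ[k] B.carrier}
    (h : ∀ m ∈ A.ev, f m ∈ B.od) (h' : ∀ m ∈ A.od, f m ∈ B.ev) : Gr A (LinearMap.ker f) := by
  intro x hx
  rw [LinearMap.mem_ker] at *
  rw [odd_pe h h', hx, map_zero, sub_zero]

lemma gr_range_od {A : GSupMod k ι} {B : GSupMod k ι'} {f : A.carrier →ₗ[k] B.carrier}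
    (h : ∀ m ∈ A.ev, f m ∈ B.od) (h' : ∀ m ∈ A.od, f m ∈ B.ev) : Gr B (LinearMap.range f) := by
  rintro _ ⟨x, rfl⟩
  refine ⟨x - pe A x, ?_⟩
  rw [map_sub, odd_pe h h']; abel

lemma gr_iSup {J : Type} {A : GSupMod k ι} {S : J → Submodule k A.carrier} (h : ∀ j, Gr A (S j)) :
    Gr A (⨆ j, S j) := by
  have : (⨆ j, S j) ≤ (⨆ j, S j).comap (pe A) :=
    iSup_le fun j x hx => Submodule.mem_iSup_of_mem j (h j x hx)
  exact this

lemma gr_radical (A : GSupMod k ι) : Gr A (radical A) :=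
  gr_iSup fun i => gr_range_od (A.θ_ev i) (A.θ_od i)

lemma isCompl_of_gr (A : GSupMod k ι) (S : Submodule k A.carrier) (h : Gr A S) :
    IsCompl (A.ev.comap S.subtype) (A.od.comap S.subtype) := by
  constructor
  · rw [Submodule.disjoint_def]
    intro x hx hy
    exact Subtype.ext ((Submodule.disjoint_def.1 A.isCompl.disjoint) x.1 hx hy)
  · rw [codisjoint_iff, eq_top_iff]
    intro x _
    have : x = ⟨pe A x.1, h _ x.2⟩ + ⟨x.1 - pe A x.1, S.sub_mem x.2 (h _ x.2)⟩ :=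
      Subtype.ext (by simp)
    rw [this]
    exact Submodule.add_mem_sup (pe_mem A x.1) (pe_sub_mem A x.1)

/-- subobject -/
def sub (A : GSupMod k ι) (S : Submodule k A.carrier) (h : Gr A S)
    (hθ : ∀ i, ∀ x ∈ S, A.θ i x ∈ S) : GSupMod k ι where
  carrier := S
  ev := A.ev.comap S.subtype
  od := A.od.comap S.subtype
  isCompl := isCompl_of_gr A S h
  θ i := (A.θ i).restrict (hθ i)
  θ_ev i _ hm := A.θ_ev i _ hm
  θ_od i _ hm := A.θ_od i _ hm

/-- graded subspace -/
def gsp (A : GSupMod k ι) (S : Submodule k A.carrier) (h : Gr A S) : GSupMod k Empty where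
  carrier := S
  ev := A.ev.comap S.subtype
  od := A.od.comap S.subtype
  isCompl := isCompl_of_gr A S h
  θ i := i.elim
  θ_ev i := i.elim
  θ_od i := i.elim

def gspι (A : GSupMod k ι) (S : Submodule k A.carrier) (h : Gr A S) :
    (gsp A S h).carrier →ₗ[k] A.carrier := S.subtype

lemma gspι_ev (A : GSupMod k ι) (S : Submodule k A.carrier) (h : Gr A S) :
    IsEv (gsp A S h) A (gspι A S h) := ⟨fun _ h => h, fun _ h => h⟩

lemma gspι_inj (A : GSupMod k ι) (S : Submodule k A.carrier) (h : Gr A S) :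
    Function.Injective (gspι A S h) := S.injective_subtype

lemma gspι_mem (A : GSupMod k ι) (S : Submodule k A.carrier) (h : Gr A S) (x) :
    gspι A S h x ∈ S := Subtype.mem x

lemma finrank_gsp (A : GSupMod k ι) (S : Submodule k A.carrier) (h : Gr A S) :
    Module.finrank k (gsp A S h).carrier = Module.finrank k S := rfl

lemma exists_gr_compl {A : GSupMod k ι} {S : Submodule k A.carrier} (h : Gr A S) :
    ∃ C, Gr A C ∧ IsCompl S C := by
  obtain ⟨r, hr, hr'⟩ := exists_even_retraction (gspι_ev A S h) (gspι_inj A S h)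
  refine ⟨LinearMap.ker r, gr_ker_ev hr, ?_⟩
  constructor
  · rw [Submodule.disjoint_def]
    intro x hx hy
    have := hr' ⟨x, hx⟩
    have h2 : r x = ⟨x, hx⟩ := this
    rw [LinearMap.mem_ker.1 hy] at h2
    exact (congrArg Subtype.val h2).symm
  · rw [codisjoint_iff, eq_top_iff]
    intro x _
    rw [← add_sub_cancel (gspι A S h (r x)) x]
    refine Submodule.add_mem_sup (gspι_mem A S h _) ?_
    rw [LinearMap.mem_ker, map_sub, hr', sub_self]

lemma isHom_iff {A B : GSupMod k ι} {f : A.carrier →ₗ[k] B.carrier} :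
    IsHom A B f ↔ (∀ i x, f (A.θ i x) = B.θ i (f x)) ∧ IsEv A B f := by
  unfold IsHom IsEv
  simp [LinearMap.ext_iff]

lemma IsHom.comp' {A B C : GSupMod k ι}
    {f : A.carrier →ₗ[k] B.carrier} {g : B.carrier →ₗ[k] C.carrier}
    (hg : IsHom B C g) (hf : IsHom A B f) : IsHom A C (g ∘ₗ f) := by
  rw [isHom_iff] at *
  exact ⟨fun i x => by simp [hf.1, hg.1], hg.2.comp hf.2⟩

lemma isHom_id (A : GSupMod k ι) : IsHom A A LinearMap.id :=
  isHom_iff.2 ⟨fun _ _ => rfl, fun _ h => h, fun _ h => h⟩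

lemma IsEv.ev_iff {A : GSupMod k ι} {B : GSupMod k ι'} {f : A.carrier →ₗ[k] B.carrier}
    (h : IsEv A B f) (inj : Function.Injective f) (x) : f x ∈ B.ev ↔ x ∈ A.ev := by
  rw [mem_ev_iff, mem_ev_iff, ← h.pe, inj.eq_iff]

lemma IsEv.od_iff {A : GSupMod k ι} {B : GSupMod k ι'} {f : A.carrier →ₗ[k] B.carrier}
    (h : IsEv A B f) (inj : Function.Injective f) (x) : f x ∈ B.od ↔ x ∈ A.od := by
  rw [mem_od_iff, mem_od_iff, ← h.pe, map_eq_zero_iff f inj]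

lemma dsum_of {A B S : GSupMod k ι} {f : A.carrier →ₗ[k] S.carrier} {g : B.carrier →ₗ[k] S.carrier}
    (hf : IsHom A S f) (hg : IsHom B S g)
    (inj : ∀ a b, f a + g b = 0 → a = 0 ∧ b = 0) (surj : ∀ s, ∃ a b, f a + g b = s) :
    IsDsum A B S := by
  rw [isHom_iff] at hf hg
  have hb : Function.Bijective (f.coprod g) := by
    constructor
    · rw [injective_iff_map_eq_zero]
      rintro ⟨a, b⟩ h
      obtain ⟨rfl, rfl⟩ := inj a b h
      rfl
    · intro s
      obtain ⟨a, b, h⟩ := surj s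
      exact ⟨(a, b), h⟩
  let e : (A.carrier × B.carrier) ≃ₗ[k] S.carrier := LinearEquiv.ofBijective (f.coprod g) hb
  have he : ∀ a b, e (a, b) = f a + g b := fun a b => rfl
  have hpe : ∀ a b, pe S (e (a, b)) = e (pe A a, pe B b) := by
    intro a b
    rw [he, he, map_add, ← hf.2.pe, ← hg.2.pe]
  refine ⟨e.symm, fun s => ?_, fun s => ?_, fun i s => ?_⟩
  · obtain ⟨⟨a, b⟩, rfl⟩ := e.surjective s
    rw [e.symm_apply_apply, mem_ev_iff, hpe, e.injective.eq_iff, Prod.ext_iff, mem_ev_iff,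
      mem_ev_iff]
  · obtain ⟨⟨a, b⟩, rfl⟩ := e.surjective s
    rw [e.symm_apply_apply, mem_od_iff, hpe, e.map_eq_zero_iff, Prod.ext_iff, mem_od_iff,
      mem_od_iff]
    rfl
  · obtain ⟨⟨a, b⟩, rfl⟩ := e.surjective s
    rw [e.symm_apply_apply, e.symm_apply_eq, LinearMap.prodMap_apply, he, he, map_add, hf.1, hg.1]

/-- inclusion of a subobject -/
def subι (A : GSupMod k ι) (S : Submodule k A.carrier) (h : Gr A S)
    (hθ : ∀ i, ∀ x ∈ S, A.θ i x ∈ S) : (sub A S h hθ).carrier →ₗ[k] A.carrier := S.subtype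

lemma subι_hom (A : GSupMod k ι) (S : Submodule k A.carrier) (h : Gr A S)
    (hθ : ∀ i, ∀ x ∈ S, A.θ i x ∈ S) : IsHom (sub A S h hθ) A (subι A S h hθ) :=
  isHom_iff.2 ⟨fun _ _ => rfl, fun _ h => h, fun _ h => h⟩

lemma subι_inj (A : GSupMod k ι) (S : Submodule k A.carrier) (h : Gr A S)
    (hθ : ∀ i, ∀ x ∈ S, A.θ i x ∈ S) : Function.Injective (subι A S h hθ) := S.injective_subtype

lemma subι_mem (A : GSupMod k ι) (S : Submodule k A.carrier) (h : Gr A S)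
    (hθ : ∀ i, ∀ x ∈ S, A.θ i x ∈ S) (x) : subι A S h hθ x ∈ S := Subtype.mem x

lemma subι_surj (A : GSupMod k ι) (S : Submodule k A.carrier) (h : Gr A S)
    (hθ : ∀ i, ∀ x ∈ S, A.θ i x ∈ S) {x} (hx : x ∈ S) : ∃ y, subι A S h hθ y = x := ⟨⟨x, hx⟩, rfl⟩

lemma gspι_surj (A : GSupMod k ι) (S : Submodule k A.carrier) (h : Gr A S)
    {x} (hx : x ∈ S) : ∃ y, gspι A S h y = x := ⟨⟨x, hx⟩, rfl⟩

lemma dsum_of_retract {A M : GSupMod k ι} {j : A.carrier →ₗ[k] M.carrier}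
    {r : M.carrier →ₗ[k] A.carrier} (hj : IsHom A M j) (hr : IsHom M A r)
    (h : ∀ x, r (j x) = x) : ∃ B, IsDsum A B M := by
  have hr1 := isHom_iff.1 hr
  have hs : ∀ i, ∀ x ∈ LinearMap.ker r, M.θ i x ∈ LinearMap.ker r := fun i x hx => by
    rw [LinearMap.mem_ker] at *; rw [hr1.1, hx, map_zero]
  refine ⟨_, dsum_of hj (subι_hom M (LinearMap.ker r) (gr_ker_ev hr1.2) hs) ?_ ?_⟩
  · intro a b hab
    have := congrArg r hab
    rw [map_add, h, LinearMap.mem_ker.1 (subι_mem _ _ _ hs b), map_zero, add_zero] at this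
    subst this
    rw [map_zero, zero_add] at hab
    exact ⟨rfl, (map_eq_zero_iff _ (subι_inj _ _ _ hs)).1 hab⟩
  · intro m
    have hm : m - j (r m) ∈ LinearMap.ker r := by rw [LinearMap.mem_ker, map_sub, h, sub_self]
    obtain ⟨y, hy⟩ := subι_surj _ _ (gr_ker_ev hr1.2) hs hm
    exact ⟨r m, y, by rw [hy]; abel⟩

end SupCat.Aux
namespace SupCat.Aux

open SupCat SupCat.GSupMod

variable {k : Type} [Field k] {ι ι' : Type}

/-- relations for `VCat k 2`, elementwise -/
structure Rel (M : GSupMod k (Fin 2)) : Prop where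
  h00 : ∀ x, M.θ 0 (M.θ 0 x) = 0
  h11 : ∀ x, M.θ 1 (M.θ 1 x) = 0
  h10 : ∀ x, M.θ 1 (M.θ 0 x) = - M.θ 0 (M.θ 1 x)

lemma rel_iff [CharZero k] (M : GSupMod k (Fin 2)) : VCat k 2 M ↔ Rel M := by
  constructor
  · intro h
    have h' : ∀ i j x, M.θ i (M.θ j x) + M.θ j (M.θ i x) = 0 :=
      fun i j x => LinearMap.congr_fun (h i j) x
    have h2 : ∀ x : M.carrier, x + x = 0 → x = 0 := fun x hx => by
      rw [← two_smul k] at hx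
      exact (smul_eq_zero.1 hx).resolve_left two_ne_zero
    exact ⟨fun x => h2 _ (h' 0 0 x), fun x => h2 _ (h' 1 1 x),
      fun x => eq_neg_of_add_eq_zero_left (h' 1 0 x)⟩
  · intro h i j
    ext x
    change M.θ i (M.θ j x) + M.θ j (M.θ i x) = 0
    fin_cases i <;> fin_cases j <;> simp [h.h00, h.h11, h.h10]

/-- the free module -/
def FM (W : GSupMod k ι) : GSupMod k (Fin 2) where
  carrier := W.carrier × W.carrier × W.carrier × W.carrier
  ev := W.ev.prod (W.od.prod (W.od.prod W.ev))
  od := W.od.prod (W.ev.prod (W.ev.prod W.od))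
  isCompl := by
    have hd := Submodule.disjoint_def.1 W.isCompl.disjoint
    have hd' := Submodule.disjoint_def.1 W.isCompl.symm.disjoint
    constructor
    · rw [Submodule.disjoint_def]
      rintro ⟨x, y, z, w⟩ ⟨h1, h2, h3, h4⟩ ⟨g1, g2, g3, g4⟩
      simp only at h1 h2 h3 h4 g1 g2 g3 g4
      rw [hd x h1 g1, hd' y h2 g2, hd' z h3 g3, hd w h4 g4]; rfl
    · rw [codisjoint_iff, eq_top_iff]
      rintro ⟨x, y, z, w⟩ _
      rw [← add_sub_cancel (pe W x, y - pe W y, z - pe W z, pe W w) (x, y, z, w)]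
      refine Submodule.add_mem_sup ⟨pe_mem W x, pe_sub_mem W y, pe_sub_mem W z, pe_mem W w⟩
        ⟨pe_sub_mem W x, ?_, ?_, pe_sub_mem W w⟩
      · simpa using pe_mem W y
      · simpa using pe_mem W z
  θ i := if i = 0 then
      { toFun := fun p => (0, p.1, 0, p.2.2.1)
        map_add' := fun p q => by simp
        map_smul' := fun c p => by simp }
    else
      { toFun := fun p => (0, 0, p.1, - p.2.1)
        map_add' := fun p q => by simp [add_comm]
        map_smul' := fun c p => by simp }
  θ_ev i m hm := by
    obtain ⟨h1, h2, h3, h4⟩ := hm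
    split_ifs
    · exact ⟨zero_mem _, h1, zero_mem _, h3⟩
    · exact ⟨zero_mem _, zero_mem _, h1, neg_mem h2⟩
  θ_od i m hm := by
    obtain ⟨h1, h2, h3, h4⟩ := hm
    split_ifs
    · exact ⟨zero_mem _, h1, zero_mem _, h3⟩
    · exact ⟨zero_mem _, zero_mem _, h1, neg_mem h2⟩

/-- constructor for elements of the free module -/
def mk4 (W : GSupMod k ι) (x y z w : W.carrier) : (FM W).carrier := (x, y, z, w)

lemma mk4_surj (W : GSupMod k ι) (p : (FM W).carrier) : ∃ x y z w, p = mk4 W x y z w :=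
  ⟨p.1, p.2.1, p.2.2.1, p.2.2.2, rfl⟩

lemma mk4_eq (W : GSupMod k ι) {x y z w x' y' z' w' : W.carrier} :
    mk4 W x y z w = mk4 W x' y' z' w' ↔ x = x' ∧ y = y' ∧ z = z' ∧ w = w' := by
  unfold mk4
  exact ⟨fun h => by injection h with h1 h; injection h with h2 h; injection h with h3 h4;
                     exact ⟨h1, h2, h3, h4⟩, by rintro ⟨rfl, rfl, rfl, rfl⟩; rfl⟩

lemma mk4_zero (W : GSupMod k ι) : mk4 W 0 0 0 0 = 0 := rfl

lemma mk4_add (W : GSupMod k ι) (x y z w x' y' z' w' : W.carrier) :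
    mk4 W x y z w + mk4 W x' y' z' w' = mk4 W (x + x') (y + y') (z + z') (w + w') := rfl

lemma mk4_smul (W : GSupMod k ι) (c : k) (x y z w : W.carrier) :
    c • mk4 W x y z w = mk4 W (c • x) (c • y) (c • z) (c • w) := rfl

lemma FM_θ0 (W : GSupMod k ι) (x y z w : W.carrier) :
    (FM W).θ 0 (mk4 W x y z w) = mk4 W 0 x 0 z := rfl

lemma FM_θ1 (W : GSupMod k ι) (x y z w : W.carrier) :
    (FM W).θ 1 (mk4 W x y z w) = mk4 W 0 0 x (-y) := rfl

lemma FM_ev (W : GSupMod k ι) {x y z w : W.carrier} :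
    mk4 W x y z w ∈ (FM W).ev ↔ x ∈ W.ev ∧ y ∈ W.od ∧ z ∈ W.od ∧ w ∈ W.ev := Iff.rfl

lemma FM_od (W : GSupMod k ι) {x y z w : W.carrier} :
    mk4 W x y z w ∈ (FM W).od ↔ x ∈ W.od ∧ y ∈ W.ev ∧ z ∈ W.ev ∧ w ∈ W.od := Iff.rfl

lemma FM_rel (W : GSupMod k ι) : Rel (FM W) := by
  refine ⟨fun p => ?_, fun p => ?_, fun p => ?_⟩ <;>
    obtain ⟨x, y, z, w, rfl⟩ := mk4_surj W p
  · rw [FM_θ0, FM_θ0, ← mk4_zero]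
  · rw [FM_θ1, FM_θ1, neg_zero, ← mk4_zero]
  · rw [FM_θ0, FM_θ1, FM_θ1, FM_θ0, eq_neg_iff_add_eq_zero, mk4_add, ← mk4_zero]
    simp

/-- map out of the free module -/
def indHom (W : GSupMod k ι) (M : GSupMod k (Fin 2)) (f : W.carrier →ₗ[k] M.carrier) :
    (FM W).carrier →ₗ[k] M.carrier where
  toFun p := f p.1 + M.θ 0 (f p.2.1) + M.θ 1 (f p.2.2.1) + M.θ 0 (M.θ 1 (f p.2.2.2))
  map_add' p q := by
    rw [show (p + q).1 = p.1 + q.1 from rfl, show (p + q).2.1 = p.2.1 + q.2.1 from rfl,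
      show (p + q).2.2.1 = p.2.2.1 + q.2.2.1 from rfl,
      show (p + q).2.2.2 = p.2.2.2 + q.2.2.2 from rfl]
    simp only [map_add]; abel
  map_smul' c p := by
    rw [show (c • p).1 = c • p.1 from rfl, show (c • p).2.1 = c • p.2.1 from rfl,
      show (c • p).2.2.1 = c • p.2.2.1 from rfl,
      show (c • p).2.2.2 = c • p.2.2.2 from rfl]
    simp only [map_smul, smul_add, RingHom.id_apply]

lemma indHom_apply (W : GSupMod k ι) (M : GSupMod k (Fin 2)) (f : W.carrier →ₗ[k] M.carrier)
    (x y z w) : indHom W M f (mk4 W x y z w)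
      = f x + M.θ 0 (f y) + M.θ 1 (f z) + M.θ 0 (M.θ 1 (f w)) := rfl

lemma indHom_hom {W : GSupMod k ι} {M : GSupMod k (Fin 2)} {f : W.carrier →ₗ[k] M.carrier}
    (hM : Rel M) (hf : IsEv W M f) : IsHom (FM W) M (indHom W M f) := by
  rw [isHom_iff]
  refine ⟨fun i p => ?_, fun p hp => ?_, fun p hp => ?_⟩ <;>
    obtain ⟨x, y, z, w, rfl⟩ := mk4_surj W p
  · fin_cases i
    · change indHom W M f ((FM W).θ 0 _) = M.θ 0 _
      rw [FM_θ0, indHom_apply, indHom_apply]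
      simp [hM.h00]
    · change indHom W M f ((FM W).θ 1 _) = M.θ 1 _
      rw [FM_θ1, indHom_apply, indHom_apply]
      simp [hM.h11, hM.h10]
  · obtain ⟨h1, h2, h3, h4⟩ := (FM_ev W).1 hp
    rw [indHom_apply]
    exact add_mem (add_mem (add_mem (hf.1 _ h1) (M.θ_od 0 _ (hf.2 _ h2)))
      (M.θ_od 1 _ (hf.2 _ h3))) (M.θ_od 0 _ (M.θ_ev 1 _ (hf.1 _ h4)))
  · obtain ⟨h1, h2, h3, h4⟩ := (FM_od W).1 hp
    rw [indHom_apply]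
    exact add_mem (add_mem (add_mem (hf.2 _ h1) (M.θ_ev 0 _ (hf.1 _ h2)))
      (M.θ_ev 1 _ (hf.1 _ h3))) (M.θ_ev 0 _ (M.θ_od 1 _ (hf.2 _ h4)))

/-- map into the free module -/
def coHom (W : GSupMod k ι) (M : GSupMod k (Fin 2)) (f : M.carrier →ₗ[k] W.carrier) :
    M.carrier →ₗ[k] (FM W).carrier where
  toFun m := mk4 W (f (M.θ 0 (M.θ 1 m))) (- f (M.θ 1 m)) (f (M.θ 0 m)) (f m)
  map_add' p q := by
    rw [mk4_add, mk4_eq]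
    simp only [map_add, neg_add, and_self]
  map_smul' c p := by
    rw [RingHom.id_apply, mk4_smul, mk4_eq]
    simp

lemma coHom_apply (W : GSupMod k ι) (M : GSupMod k (Fin 2)) (f : M.carrier →ₗ[k] W.carrier) (m) :
    coHom W M f m = mk4 W (f (M.θ 0 (M.θ 1 m))) (- f (M.θ 1 m)) (f (M.θ 0 m)) (f m) := rfl

lemma coHom_hom {W : GSupMod k ι} {M : GSupMod k (Fin 2)} {f : M.carrier →ₗ[k] W.carrier}
    (hM : Rel M) (hf : IsEv M W f) : IsHom M (FM W) (coHom W M f) := by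
  rw [isHom_iff]
  refine ⟨fun i p => ?_, fun p hp => ?_, fun p hp => ?_⟩
  · fin_cases i
    · change coHom W M f (M.θ 0 p) = (FM W).θ 0 _
      rw [coHom_apply, coHom_apply, FM_θ0, mk4_eq]
      simp [hM.h00, hM.h10]
    · change coHom W M f (M.θ 1 p) = (FM W).θ 1 _
      rw [coHom_apply, coHom_apply, FM_θ1, mk4_eq]
      simp [hM.h11]
  · rw [coHom_apply, FM_ev]
    exact ⟨hf.1 _ (M.θ_od 0 _ (M.θ_ev 1 _ hp)), neg_mem (hf.2 _ (M.θ_ev 1 _ hp)),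
      hf.2 _ (M.θ_ev 0 _ hp), hf.1 _ hp⟩
  · rw [coHom_apply, FM_od]
    exact ⟨hf.2 _ (M.θ_ev 0 _ (M.θ_od 1 _ hp)), neg_mem (hf.1 _ (M.θ_od 1 _ hp)),
      hf.1 _ (M.θ_od 0 _ hp), hf.2 _ hp⟩

def inc1 (W : GSupMod k ι) : W.carrier →ₗ[k] (FM W).carrier where
  toFun x := mk4 W x 0 0 0
  map_add' x y := by rw [mk4_add, mk4_eq]; simp
  map_smul' c x := by rw [RingHom.id_apply, mk4_smul, mk4_eq]; simp

lemma inc1_apply (W : GSupMod k ι) (x) : inc1 W x = mk4 W x 0 0 0 := rfl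

lemma inc1_ev (W : GSupMod k ι) : IsEv W (FM W) (inc1 W) :=
  ⟨fun x hx => by rw [inc1_apply, FM_ev]; exact ⟨hx, zero_mem _, zero_mem _, zero_mem _⟩,
   fun x hx => by rw [inc1_apply, FM_od]; exact ⟨hx, zero_mem _, zero_mem _, zero_mem _⟩⟩

def prj4 (W : GSupMod k ι) : (FM W).carrier →ₗ[k] W.carrier where
  toFun p := p.2.2.2
  map_add' _ _ := rfl
  map_smul' _ _ := rfl

lemma prj4_apply (W : GSupMod k ι) (x y z w) : prj4 W (mk4 W x y z w) = w := rfl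

lemma prj4_ev (W : GSupMod k ι) : IsEv (FM W) W (prj4 W) :=
  ⟨fun _ hx => hx.2.2.2, fun _ hx => hx.2.2.2⟩

lemma FM_gen (W : GSupMod k ι) (x y z w) : mk4 W x y z w = inc1 W x + (FM W).θ 0 (inc1 W y)
    + (FM W).θ 1 (inc1 W z) + (FM W).θ 0 ((FM W).θ 1 (inc1 W w)) := by
  simp only [inc1_apply, FM_θ0, FM_θ1, mk4_add, mk4_eq]
  simp

lemma FM_proj [CharZero k] (W : GSupMod k ι) : IsProjective (VCat k 2) (FM W) := by
  refine ⟨(rel_iff _).2 (FM_rel W), ?_⟩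
  intro M N π f hM hN hπ surj hf
  have hπ' := isHom_iff.1 hπ
  have hf' := isHom_iff.1 hf
  obtain ⟨s, hs, hs'⟩ := exists_even_section hπ'.2 surj
  refine ⟨indHom W M (s ∘ₗ f ∘ₗ inc1 W),
    indHom_hom ((rel_iff _).1 hM) (hs.comp (hf'.2.comp (inc1_ev W))), ?_⟩
  ext p
  obtain ⟨x, y, z, w, rfl⟩ := mk4_surj W p
  rw [LinearMap.comp_apply, indHom_apply, FM_gen]
  simp only [map_add, hπ'.1, hf'.1, LinearMap.comp_apply, hs']

lemma FM_inj [CharZero k] (W : GSupMod k ι) : IsInjective (VCat k 2) (FM W) := by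
  refine ⟨(rel_iff _).2 (FM_rel W), ?_⟩
  intro M N j f hM hN hj inj hf
  have hj' := isHom_iff.1 hj
  have hf' := isHom_iff.1 hf
  obtain ⟨s, hs, hs'⟩ := exists_even_retraction hj'.2 inj
  refine ⟨coHom W N (prj4 W ∘ₗ f ∘ₗ s),
    coHom_hom ((rel_iff _).1 hN) ((prj4_ev W).comp (hf'.2.comp hs)), ?_⟩
  ext p
  rw [LinearMap.comp_apply, coHom_apply]
  simp only [LinearMap.comp_apply, ← hj'.1, hs', hf'.1]
  obtain ⟨x, y, z, w, h⟩ := mk4_surj W (f p)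
  rw [h]
  simp [FM_θ0, FM_θ1, prj4_apply]

lemma act2 (M : GSupMod k (Fin 2)) (a : Fin 2 → k) (x) :
    actOf M a x = a 0 • M.θ 0 x + a 1 • M.θ 1 x := by
  simp [actOf, Fin.sum_univ_two]

/-- the exactness properties -/
structure Exact (P : GSupMod k (Fin 2)) : Prop where
  top : ∀ x, P.θ 0 (P.θ 1 x) = 0 → ∃ y z, x = P.θ 0 y + P.θ 1 z
  ker : ∀ a : Fin 2 → k, a ≠ 0 → ∀ x, actOf P a x = 0 → ∃ y, actOf P a y = x
  soc : ∀ x, P.θ 0 x = 0 → P.θ 1 x = 0 → ∃ y, x = P.θ 0 (P.θ 1 y)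

lemma FM_exact (W : GSupMod k ι) : Exact (FM W) := by
  refine ⟨fun p h => ?_, fun a ha p h => ?_, fun p h h' => ?_⟩ <;>
    obtain ⟨x, y, z, w, rfl⟩ := mk4_surj W p
  · rw [FM_θ1, FM_θ0, ← mk4_zero, mk4_eq] at h
    refine ⟨mk4 W y 0 w 0, mk4 W z 0 0 0, ?_⟩
    rw [FM_θ0, FM_θ1, mk4_add, mk4_eq]
    simp [h.2.2.2]
  · rw [act2, FM_θ0, FM_θ1, mk4_smul, mk4_smul, mk4_add, ← mk4_zero, mk4_eq] at h
    obtain ⟨-, h1, h2, h3⟩ := h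
    simp only [smul_zero, add_zero, zero_add, smul_neg] at h1 h2 h3
    rw [← sub_eq_add_neg, sub_eq_zero] at h3
    have hx : x = 0 := by
      by_contra hx
      apply ha
      ext i
      fin_cases i
      · exact (smul_eq_zero.1 h1).resolve_right hx
      · exact (smul_eq_zero.1 h2).resolve_right hx
    subst hx
    by_cases h0 : a 0 = 0
    · have h1' : a 1 ≠ 0 := fun h1' => ha (by ext i; fin_cases i; exacts [h0, h1'])
      refine ⟨mk4 W ((a 1)⁻¹ • z) (-(a 1)⁻¹ • w) 0 0, ?_⟩
      rw [act2, FM_θ0, FM_θ1, mk4_smul, mk4_smul, mk4_add, mk4_eq]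
      have hy : y = 0 := by
        rw [h0, zero_smul] at h3
        exact (smul_eq_zero.1 h3.symm).resolve_left h1'
      simp [h0, hy, smul_smul, h1']
    · refine ⟨mk4 W ((a 0)⁻¹ • y) 0 ((a 0)⁻¹ • w) 0, ?_⟩
      rw [act2, FM_θ0, FM_θ1, mk4_smul, mk4_smul, mk4_add, mk4_eq]
      refine ⟨by simp, by simp [smul_smul, h0], ?_, by simp [smul_smul, h0]⟩
      rw [smul_comm, ← h3]
      simp [smul_smul, h0]
  · rw [FM_θ0, ← mk4_zero, mk4_eq] at h
    rw [FM_θ1, ← mk4_zero, mk4_eq] at h'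
    refine ⟨mk4 W w 0 0 0, ?_⟩
    rw [FM_θ1, FM_θ0, mk4_eq]
    simp [h.2.1, h.2.2.2, neg_eq_zero.1 h'.2.2.2]

lemma hom_act {A B : GSupMod k (Fin 2)} {f : A.carrier →ₗ[k] B.carrier} (hf : IsHom A B f)
    (a x) : f (actOf A a x) = actOf B a (f x) := by
  rw [act2, act2, map_add, map_smul, map_smul, (isHom_iff.1 hf).1, (isHom_iff.1 hf).1]

lemma Exact.retract {F P : GSupMod k (Fin 2)} (h : Exact F) {s : P.carrier →ₗ[k] F.carrier}
    {r : F.carrier →ₗ[k] P.carrier} (hs : IsHom P F s) (hr : IsHom F P r) (hrs : ∀ x, r (s x) = x) :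
    Exact P := by
  have hs' := (isHom_iff.1 hs).1
  have hr' := (isHom_iff.1 hr).1
  refine ⟨fun x hx => ?_, fun a ha x hx => ?_, fun x hx hx' => ?_⟩
  · obtain ⟨y, z, h1⟩ := h.top (s x) (by rw [← hs', ← hs', hx, map_zero])
    exact ⟨r y, r z, by rw [← hr', ← hr', ← map_add, ← h1, hrs]⟩
  · obtain ⟨y, h1⟩ := h.ker a ha (s x) (by rw [← hom_act hs, hx, map_zero])
    exact ⟨r y, by rw [← hom_act hr, h1, hrs]⟩
  · obtain ⟨y, h1⟩ := h.soc (s x) (by rw [← hs', hx, map_zero]) (by rw [← hs', hx', map_zero])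
    exact ⟨r y, by rw [← hr', ← hr', ← h1, hrs]⟩

lemma exact_of_proj [CharZero k] {P : GSupMod k (Fin 2)} (hP : IsProjective (VCat k 2) P) :
    Exact P := by
  have hid : IsEv P P LinearMap.id := ⟨fun _ h => h, fun _ h => h⟩
  have hr := indHom_hom ((rel_iff _).1 hP.1) hid
  obtain ⟨s, hs, h⟩ := hP.2 (FM P) P _ LinearMap.id (FM_proj P).1 hP.1 hr
    (fun x => ⟨mk4 P x 0 0 0, by rw [indHom_apply]; simp⟩) (isHom_id P)
  exact (FM_exact P).retract hs hr (fun x => LinearMap.congr_fun h x)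

end SupCat.Aux
namespace SupCat.Aux

open SupCat SupCat.GSupMod

variable {k : Type} [Field k] {ι ι' : Type}

lemma rel1_iff [CharZero k] (M : GSupMod k (Fin 1)) :
    VCat k 1 M ↔ ∀ x, M.θ 0 (M.θ 0 x) = 0 := by
  constructor
  · intro h x
    have hx : M.θ 0 (M.θ 0 x) + M.θ 0 (M.θ 0 x) = 0 := LinearMap.congr_fun (h 0 0) x
    rw [← two_smul k] at hx
    exact (smul_eq_zero.1 hx).resolve_left two_ne_zero
  · intro h i j
    ext x
    change M.θ i (M.θ j x) + M.θ j (M.θ i x) = 0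
    fin_cases i; fin_cases j; simp [h]

/-- the free module of rank one type -/
def F1 (W : GSupMod k ι) : GSupMod k (Fin 1) where
  carrier := W.carrier × W.carrier
  ev := W.ev.prod W.od
  od := W.od.prod W.ev
  isCompl := by
    have hd := Submodule.disjoint_def.1 W.isCompl.disjoint
    have hd' := Submodule.disjoint_def.1 W.isCompl.symm.disjoint
    constructor
    · rw [Submodule.disjoint_def]
      rintro ⟨x, y⟩ ⟨h1, h2⟩ ⟨g1, g2⟩
      simp only at h1 h2 g1 g2
      rw [hd x h1 g1, hd' y h2 g2]; rfl
    · rw [codisjoint_iff, eq_top_iff]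
      rintro ⟨x, y⟩ _
      rw [← add_sub_cancel (pe W x, y - pe W y) (x, y)]
      refine Submodule.add_mem_sup ⟨pe_mem W x, pe_sub_mem W y⟩ ⟨pe_sub_mem W x, ?_⟩
      simpa using pe_mem W y
  θ _ :=
      { toFun := fun p => (0, p.1)
        map_add' := fun p q => by simp
        map_smul' := fun c p => by simp }
  θ_ev _ m hm := ⟨zero_mem _, hm.1⟩
  θ_od _ m hm := ⟨zero_mem _, hm.1⟩

def mk2 (W : GSupMod k ι) (x y : W.carrier) : (F1 W).carrier := (x, y)

lemma mk2_surj (W : GSupMod k ι) (p : (F1 W).carrier) : ∃ x y, p = mk2 W x y :=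
  ⟨p.1, p.2, rfl⟩

lemma mk2_eq (W : GSupMod k ι) {x y x' y' : W.carrier} :
    mk2 W x y = mk2 W x' y' ↔ x = x' ∧ y = y' := by
  unfold mk2
  exact ⟨fun h => by injection h with h1 h; exact ⟨h1, h⟩, by rintro ⟨rfl, rfl⟩; rfl⟩

lemma mk2_zero (W : GSupMod k ι) : mk2 W 0 0 = 0 := rfl

lemma mk2_add (W : GSupMod k ι) (x y x' y' : W.carrier) :
    mk2 W x y + mk2 W x' y' = mk2 W (x + x') (y + y') := rfl

lemma mk2_smul (W : GSupMod k ι) (c : k) (x y : W.carrier) :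
    c • mk2 W x y = mk2 W (c • x) (c • y) := rfl

lemma F1_θ (W : GSupMod k ι) (i : Fin 1) (x y : W.carrier) :
    (F1 W).θ i (mk2 W x y) = mk2 W 0 x := rfl

lemma F1_ev (W : GSupMod k ι) {x y : W.carrier} :
    mk2 W x y ∈ (F1 W).ev ↔ x ∈ W.ev ∧ y ∈ W.od := Iff.rfl

lemma F1_od (W : GSupMod k ι) {x y : W.carrier} :
    mk2 W x y ∈ (F1 W).od ↔ x ∈ W.od ∧ y ∈ W.ev := Iff.rfl

lemma F1_finrank (W : GSupMod k ι) :
    Module.finrank k (F1 W).carrier = 2 * Module.finrank k W.carrier := by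
  have : Module.finrank k (W.carrier × W.carrier) = 2 * Module.finrank k W.carrier := by
    rw [Module.finrank_prod]; ring
  exact this

lemma F1_cat [CharZero k] (W : GSupMod k ι) : VCat k 1 (F1 W) := by
  rw [rel1_iff]
  intro p
  obtain ⟨x, y, rfl⟩ := mk2_surj W p
  rw [F1_θ, F1_θ, mk2_zero]

def ind1 (W : GSupMod k ι) (M : GSupMod k (Fin 1)) (f : W.carrier →ₗ[k] M.carrier) :
    (F1 W).carrier →ₗ[k] M.carrier where
  toFun p := f p.1 + M.θ 0 (f p.2)
  map_add' p q := by
    rw [show (p + q).1 = p.1 + q.1 from rfl, show (p + q).2 = p.2 + q.2 from rfl]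
    simp only [map_add]; abel
  map_smul' c p := by
    rw [show (c • p).1 = c • p.1 from rfl, show (c • p).2 = c • p.2 from rfl]
    simp only [map_smul, smul_add, RingHom.id_apply]

lemma ind1_apply (W : GSupMod k ι) (M : GSupMod k (Fin 1)) (f : W.carrier →ₗ[k] M.carrier)
    (x y) : ind1 W M f (mk2 W x y) = f x + M.θ 0 (f y) := rfl

lemma ind1_hom [CharZero k] {W : GSupMod k ι} {M : GSupMod k (Fin 1)}
    {f : W.carrier →ₗ[k] M.carrier}
    (hM : VCat k 1 M) (hf : IsEv W M f) : IsHom (F1 W) M (ind1 W M f) := by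
  rw [rel1_iff] at hM
  rw [isHom_iff]
  refine ⟨fun i p => ?_, fun p hp => ?_, fun p hp => ?_⟩ <;>
    obtain ⟨x, y, rfl⟩ := mk2_surj W p
  · fin_cases i
    change ind1 W M f ((F1 W).θ 0 _) = M.θ 0 _
    rw [F1_θ, ind1_apply, ind1_apply]
    simp [hM]
  · obtain ⟨h1, h2⟩ := (F1_ev W).1 hp
    rw [ind1_apply]
    exact add_mem (hf.1 _ h1) (M.θ_od 0 _ (hf.2 _ h2))
  · obtain ⟨h1, h2⟩ := (F1_od W).1 hp
    rw [ind1_apply]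
    exact add_mem (hf.2 _ h1) (M.θ_ev 0 _ (hf.1 _ h2))

def inc2 (W : GSupMod k ι) : W.carrier →ₗ[k] (F1 W).carrier where
  toFun x := mk2 W x 0
  map_add' x y := by rw [mk2_add, mk2_eq]; simp
  map_smul' c x := by rw [RingHom.id_apply, mk2_smul, mk2_eq]; simp

lemma inc2_apply (W : GSupMod k ι) (x) : inc2 W x = mk2 W x 0 := rfl

lemma inc2_ev (W : GSupMod k ι) : IsEv W (F1 W) (inc2 W) :=
  ⟨fun x hx => by rw [inc2_apply, F1_ev]; exact ⟨hx, zero_mem _⟩,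
   fun x hx => by rw [inc2_apply, F1_od]; exact ⟨hx, zero_mem _⟩⟩

lemma F1_gen (W : GSupMod k ι) (x y) : mk2 W x y = inc2 W x + (F1 W).θ 0 (inc2 W y) := by
  simp only [inc2_apply, F1_θ, mk2_add, mk2_eq]
  simp

lemma F1_proj [CharZero k] (W : GSupMod k ι) : IsProjective (VCat k 1) (F1 W) := by
  refine ⟨F1_cat W, ?_⟩
  intro M N π f hM hN hπ surj hf
  have hπ' := isHom_iff.1 hπ
  have hf' := isHom_iff.1 hf
  obtain ⟨s, hs, hs'⟩ := exists_even_section hπ'.2 surj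
  refine ⟨ind1 W M (s ∘ₗ f ∘ₗ inc2 W), ind1_hom hM (hs.comp (hf'.2.comp (inc2_ev W))), ?_⟩
  ext p
  obtain ⟨x, y, rfl⟩ := mk2_surj W p
  rw [LinearMap.comp_apply, ind1_apply, F1_gen]
  simp only [map_add, hπ'.1, hf'.1, LinearMap.comp_apply, hs']

lemma proj1_exact [CharZero k] {P : GSupMod k (Fin 1)} (hP : IsProjective (VCat k 1) P) (x)
    (hx : P.θ 0 x = 0) : ∃ y, P.θ 0 y = x := by
  have hid : IsEv P P LinearMap.id := ⟨fun _ h => h, fun _ h => h⟩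
  have hr := ind1_hom hP.1 hid
  obtain ⟨s, hs, h⟩ := hP.2 (F1 P) P _ LinearMap.id (F1_cat P) hP.1 hr
    (fun x => ⟨mk2 P x 0, by rw [ind1_apply]; simp⟩) (isHom_id P)
  have h' : ∀ x, ind1 P P LinearMap.id (s x) = x := fun x => LinearMap.congr_fun h x
  have hs' := (isHom_iff.1 hs).1
  have h0 : (F1 P).θ 0 (s x) = 0 := by rw [← hs', hx, map_zero]
  obtain ⟨u, v, huv⟩ := mk2_surj P (s x)
  rw [huv, F1_θ, ← mk2_zero, mk2_eq] at h0
  have := h' x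
  rw [huv, ind1_apply, h0.2] at this
  exact ⟨v, by simpa using this⟩

lemma syzygy1 [CharZero k] {p : Bool} {K T : GSupMod k (Fin 1)} (hK : IsTrivial p K)
    (h : IsSyzygy (VCat k 1) K T) : Module.finrank k T.carrier = 1 ∧ ∀ x, T.θ 0 x = 0 := by
  obtain ⟨hT, P, π, i, ⟨hP, hπ, hsurj, hmin⟩, hi, hinj, hrange⟩ := h
  obtain ⟨hK1, hK2, -⟩ := hK
  have hπ' := isHom_iff.1 hπ
  obtain ⟨s, hs, hs'⟩ := exists_even_section hπ'.2 hsurj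
  have hg := hmin (F1 K) (ind1 K P s) (F1_cat K) (ind1_hom hP.1 hs) (by
    intro x
    refine ⟨mk2 K x 0, ?_⟩
    rw [LinearMap.comp_apply, ind1_apply]
    simp [hs'])
  have h1 : Module.finrank k P.carrier ≤ 2 := by
    have := LinearMap.finrank_le_finrank_of_surjective hg
    rw [F1_finrank, hK1] at this
    exact this
  have h2 : LinearMap.ker (P.θ 0) = LinearMap.range (P.θ 0) := by
    apply le_antisymm
    · intro x hx
      obtain ⟨y, hy⟩ := proj1_exact hP x hx
      exact ⟨y, hy⟩
    · rintro _ ⟨x, rfl⟩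
      exact (rel1_iff P).1 hP.1 x
  have h3 := LinearMap.finrank_range_add_finrank_ker (P.θ 0)
  rw [h2] at h3
  have h4 := LinearMap.finrank_range_add_finrank_ker π
  rw [LinearMap.range_eq_top.2 hsurj, finrank_top, hK1, ← hrange,
    LinearMap.finrank_range_of_inj hinj] at h4
  have h5 : Module.finrank k T.carrier = 1 := by omega
  refine ⟨h5, ?_⟩
  obtain ⟨v, hv, hv'⟩ := finrank_eq_one_iff'.1 h5
  obtain ⟨c, hc⟩ := hv' (T.θ 0 v)
  have hsq := (rel1_iff T).1 hT v
  rw [← hc, map_smul, ← hc, smul_smul] at hsq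
  have hc0 : c = 0 := mul_self_eq_zero.1 ((smul_eq_zero.1 hsq).resolve_right hv)
  intro x
  obtain ⟨d, rfl⟩ := hv' x
  rw [map_smul, ← hc, hc0, zero_smul, smul_zero]

lemma act_ev {M : GSupMod k (Fin 2)} (a : Fin 2 → k) : ∀ m ∈ M.ev, actOf M a m ∈ M.od :=
  fun m hm => by
    rw [act2]
    exact add_mem (M.od.smul_mem _ (M.θ_ev 0 m hm)) (M.od.smul_mem _ (M.θ_ev 1 m hm))

lemma act_od {M : GSupMod k (Fin 2)} (a : Fin 2 → k) : ∀ m ∈ M.od, actOf M a m ∈ M.ev :=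
  fun m hm => by
    rw [act2]
    exact add_mem (M.ev.smul_mem _ (M.θ_od 0 m hm)) (M.ev.smul_mem _ (M.θ_od 1 m hm))

lemma act_sq {M : GSupMod k (Fin 2)} (hM : Rel M) (a : Fin 2 → k) (x) :
    actOf M a (actOf M a x) = 0 := by
  rw [act2, act2]
  simp only [map_add, map_smul, hM.h00, hM.h11, hM.h10, smul_zero, zero_add, add_zero, smul_neg]
  rw [smul_comm (a 0) (a 1)]
  exact add_neg_cancel _

/-- extraction from condition (2) -/
lemma cond2_extract [CharZero k] {M : GSupMod k (Fin 2)} (h : Cond2 M) (a : Fin 2 → k)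
    (ha : a ≠ 0) : ∃ v, IsOmegaComponentGen M a v := by
  obtain ⟨p, t, K, T, P, R, hK, hT, hP, ⟨ψ, hψe, hψo, hψ⟩, ⟨φ, hφe, hφo, hφ⟩⟩ := h a ha
  have hT' : Module.finrank k T.carrier = 1 ∧ ∀ x, T.θ 0 x = 0 := by
    rcases hT with ⟨-, e, he⟩ | ⟨-, hT⟩
    · refine ⟨by rw [← e.finrank_eq, hK.1], fun x => ?_⟩
      obtain ⟨y, rfl⟩ := e.surjective x
      have := (isHom_iff.1 he).1 0 y
      rw [hK.2.1 0] at this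
      simpa using this.symm
    · exact syzygy1 hK hT
  obtain ⟨t0, ht0, ht0'⟩ := finrank_eq_one_iff'.1 hT'.1
  let e : M.carrier ≃ₗ[k] T.carrier × P.carrier := ψ.symm.trans φ
  have heθ : ∀ x, e (actOf M a x) = (0, P.θ 0 (e x).2) := by
    intro x
    obtain ⟨r, rfl⟩ := ψ.surjective x
    have h1 := hψ 0 r
    simp only [Matrix.cons_val_fin_one] at h1
    change φ (ψ.symm (actOf M a (ψ r))) = (0, P.θ 0 (φ (ψ.symm (ψ r))).2)
    rw [← h1, ψ.symm_apply_apply, ψ.symm_apply_apply, hφ 0 r]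
    ext
    · simp [hT'.2]
    · simp
  have hev : ∀ x ∈ M.ev, (e x).1 ∈ T.ev ∧ (e x).2 ∈ P.ev := by
    intro x hx
    obtain ⟨r, rfl⟩ := ψ.surjective x
    change (φ (ψ.symm (ψ r))).1 ∈ _ ∧ (φ (ψ.symm (ψ r))).2 ∈ _
    rw [ψ.symm_apply_apply, ← hφe, hψe]; exact hx
  have hod : ∀ x ∈ M.od, (e x).1 ∈ T.od ∧ (e x).2 ∈ P.od := by
    intro x hx
    obtain ⟨r, rfl⟩ := ψ.surjective x
    change (φ (ψ.symm (ψ r))).1 ∈ _ ∧ (φ (ψ.symm (ψ r))).2 ∈ _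
    rw [ψ.symm_apply_apply, ← hφo, hψo]; exact hx
  have hE1 : IsEv M T (LinearMap.fst k _ _ ∘ₗ (e : M.carrier →ₗ[k] T.carrier × P.carrier)) :=
    ⟨fun m hm => (hev m hm).1, fun m hm => (hod m hm).1⟩
  have hE2 : IsEv M P (LinearMap.snd k _ _ ∘ₗ (e : M.carrier →ₗ[k] T.carrier × P.carrier)) :=
    ⟨fun m hm => (hev m hm).2, fun m hm => (hod m hm).2⟩
  have hp1 : ∀ x, (e (pe M x)).1 = pe T (e x).1 := fun x => hE1.pe x
  have hp2 : ∀ x, (e (pe M x)).2 = pe P (e x).2 := fun x => hE2.pe x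
  let v := e.symm (t0, 0)
  have hv : e v = (t0, 0) := e.apply_symm_apply _
  have hL : ∀ x, x ∈ Submodule.span k {v} ↔ (e x).2 = 0 := by
    intro x
    rw [Submodule.mem_span_singleton]
    constructor
    · rintro ⟨c, rfl⟩
      simp [hv]
    · intro hx
      obtain ⟨c, hc⟩ := ht0' (e x).1
      refine ⟨c, e.injective ?_⟩
      rw [map_smul, hv]
      ext
      · simpa using hc
      · simpa using hx.symm
  have hPm : ∀ x, x ∈ LinearMap.ker (LinearMap.fst k _ _ ∘ₗ
      (e : M.carrier →ₗ[k] T.carrier × P.carrier)) ↔ (e x).1 = 0 := fun x => Iff.rfl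
  refine ⟨v, ?_, Submodule.span k {v}, LinearMap.ker (LinearMap.fst k _ _ ∘ₗ
      (e : M.carrier →ₗ[k] T.carrier × P.carrier)), ?_, rfl, ?_, (gr_ker_ev hE1).eq, ?_, ?_⟩
  · intro h0
    rw [h0, map_zero] at hv
    exact ht0 (congrArg Prod.fst hv).symm
  · constructor
    · rw [Submodule.disjoint_def]
      intro x hx hy
      rw [hL] at hx
      rw [hPm] at hy
      exact e.map_eq_zero_iff.1 (Prod.ext hy hx)
    · rw [codisjoint_iff, eq_top_iff]
      intro x _
      rw [← add_sub_cancel (e.symm ((e x).1, 0)) x]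
      refine Submodule.add_mem_sup ?_ ?_
      · rw [hL, e.apply_symm_apply]
      · rw [hPm, map_sub, e.apply_symm_apply, Prod.fst_sub, sub_self]
  · refine Gr.eq (fun x hx => ?_)
    rw [hL] at *
    rw [hp2, hx, map_zero]
  · apply e.injective
    rw [heθ, hv, map_zero, map_zero]; rfl
  · ext x
    rw [Submodule.mem_inf, Submodule.mem_map, hPm, LinearMap.mem_ker]
    constructor
    · rintro ⟨h1, h2⟩
      have := heθ x
      rw [h2, map_zero] at this
      obtain ⟨y, hy⟩ := proj1_exact hP (e x).2 (congrArg Prod.snd this).symm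
      refine ⟨e.symm (0, y), ?_, e.injective ?_⟩
      · rw [hPm, e.apply_symm_apply]
      · rw [heθ, e.apply_symm_apply]
        exact Prod.ext h1.symm hy
    · rintro ⟨y, hy, rfl⟩
      refine ⟨by rw [heθ], e.injective ?_⟩
      rw [heθ, heθ, map_zero, (rel1_iff P).1 hP.1]; rfl

/-- restriction -/
def res (M : GSupMod k (Fin 2)) (a : Fin 2 → k) : GSupMod k (Fin 1) where
  carrier := M.carrier
  ev := M.ev
  od := M.od
  isCompl := M.isCompl
  θ _ := actOf M a
  θ_ev _ := act_ev a
  θ_od _ := act_od a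

/-- trivial module -/
def triv (k : Type) [Field k] (p : Bool) : GSupMod k (Fin 1) where
  carrier := k
  ev := if p then ⊥ else ⊤
  od := if p then ⊤ else ⊥
  isCompl := by cases p <;> simp [isCompl_top_bot, isCompl_bot_top]
  θ _ := 0
  θ_ev _ _ _ := zero_mem _
  θ_od _ _ _ := zero_mem _

lemma triv_trivial (p : Bool) : IsTrivial p (triv k p) := by
  refine ⟨Module.finrank_self k, fun _ => rfl, ?_⟩
  cases p <;> rfl

/-- the map from the trivial module to a module given by a vector -/
def trivMap (p : Bool) (M : GSupMod k (Fin 1)) (v : M.carrier) :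
    (triv k p).carrier →ₗ[k] M.carrier := LinearMap.toSpanSingleton k M.carrier v

lemma trivMap_apply (p : Bool) (M : GSupMod k (Fin 1)) (v : M.carrier) (c : k) :
    trivMap p M v c = c • v := rfl

lemma trivMap_hom (p : Bool) (M : GSupMod k (Fin 1)) (v : M.carrier) (hv : M.θ 0 v = 0)
    (hp : v ∈ if p then M.od else M.ev) : IsHom (triv k p) M (trivMap p M v) := by
  rw [isHom_iff]
  refine ⟨fun i (x : k) => ?_, fun (x : k) hx => ?_, fun (x : k) hx => ?_⟩
  · fin_cases i
    change trivMap p M v 0 = M.θ 0 (trivMap p M v x)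
    rw [map_zero, trivMap_apply, map_smul, hv, smul_zero]
  · rw [trivMap_apply]
    cases p
    · exact M.ev.smul_mem _ hp
    · have : x = 0 := hx
      rw [this, zero_smul]; exact zero_mem _
  · rw [trivMap_apply]
    cases p
    · have : x = 0 := hx
      rw [this, zero_smul]; exact zero_mem _
    · exact M.od.smul_mem _ hp

lemma finrank_sup_span {V : Type} [AddCommGroup V] [Module k V] [FiniteDimensional k V]
    (S : Submodule k V) {v : V} (hv : v ∉ S) :
    Module.finrank k (S ⊔ Submodule.span k {v} : Submodule k V) = Module.finrank k S + 1 := by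
  have hv0 : v ≠ 0 := fun h => hv (h ▸ zero_mem _)
  have h1 : S ⊓ Submodule.span k {v} = ⊥ :=
    disjoint_iff.1 ((Submodule.disjoint_span_singleton' hv0).2 hv)
  have h2 := Submodule.finrank_sup_add_finrank_inf_eq S (Submodule.span k {v})
  rw [h1, finrank_bot, finrank_span_singleton hv0] at h2
  exact h2

lemma lin_inj {V : Type} [AddCommGroup V] [Module k V] {f : V →ₗ[k] V}
    (hsq : ∀ x, f (f x) = 0) {C : Submodule k V} (hC : IsCompl (LinearMap.ker f) C)
    {v : V} (hv : f v = 0) (hvr : v ∉ LinearMap.range f) {c : k} {y z : V} (hy : y ∈ C)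
    (hz : z ∈ C) (h : c • v + (y + f z) = 0) : c = 0 ∧ y = 0 ∧ z = 0 := by
  have hdisj := Submodule.disjoint_def.1 hC.disjoint
  have h1 := congrArg f h
  rw [map_add, map_add, map_smul, hv, hsq, smul_zero, zero_add, add_zero, map_zero] at h1
  have h2 := hdisj _ h1 hy
  rw [h2, zero_add] at h
  have hc : c = 0 := by
    by_contra hc
    apply hvr
    have h3 : c • v ∈ LinearMap.range f := ⟨-z, by
      rw [map_neg]; exact (eq_neg_of_add_eq_zero_left h).symm⟩
    exact (Submodule.smul_mem_iff _ hc).1 h3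
  rw [hc, zero_smul, zero_add] at h
  exact ⟨hc, h2, hdisj _ h hz⟩

lemma lin_surj {V : Type} [AddCommGroup V] [Module k V] [FiniteDimensional k V] {f : V →ₗ[k] V}
    (hsq : ∀ x, f (f x) = 0) {C : Submodule k V} (hC : IsCompl (LinearMap.ker f) C)
    {v : V} (hv : f v = 0) (hvr : v ∉ LinearMap.range f)
    (hd : Module.finrank k V = 2 * Module.finrank k (LinearMap.range f) + 1) (s : V) :
    ∃ c : k, ∃ y ∈ C, ∃ z ∈ C, c • v + (y + f z) = s := by
  have hrn := LinearMap.finrank_range_add_finrank_ker f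
  have hle : LinearMap.range f ⊔ Submodule.span k {v} ≤ LinearMap.ker f := by
    refine sup_le ?_ ?_
    · rintro _ ⟨x, rfl⟩; exact hsq x
    · rw [Submodule.span_singleton_le_iff_mem]; exact hv
  have heq := Submodule.eq_of_le_of_finrank_eq hle (by rw [finrank_sup_span _ hvr]; omega)
  have htop : ∀ s : V, ∃ κ, f κ = 0 ∧ ∃ y ∈ C, κ + y = s := fun s => by
    obtain ⟨κ, h1, y, h2, h3⟩ := Submodule.mem_sup.1
      (show s ∈ LinearMap.ker f ⊔ C by rw [hC.sup_eq_top]; trivial)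
    exact ⟨κ, h1, y, h2, h3⟩
  obtain ⟨κ, hκ, y, hy, rfl⟩ := htop s
  have hκ' : κ ∈ LinearMap.range f ⊔ Submodule.span k {v} := by rw [heq]; exact hκ
  obtain ⟨_, ⟨u, rfl⟩, w, hw, rfl⟩ := Submodule.mem_sup.1 hκ'
  obtain ⟨c, rfl⟩ := Submodule.mem_span_singleton.1 hw
  obtain ⟨κ', h1, z, hz, rfl⟩ := htop u
  exact ⟨c, y, hy, z, hz, by rw [map_add, h1]; abel⟩

/-- construction of condition (2) -/
lemma cond2_of [CharZero k] {M : GSupMod k (Fin 2)} (hM : Rel M)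
    (h : ∀ a : Fin 2 → k, a ≠ 0 → Module.finrank k M.carrier
      = 2 * Module.finrank k (LinearMap.range (actOf M a)) + 1) : Cond2 M := by
  intro a ha
  have hd := h a ha
  have hrn := LinearMap.finrank_range_add_finrank_ker (actOf M a)
  have hle : LinearMap.range (actOf M a) ≤ LinearMap.ker (actOf M a) := by
    rintro _ ⟨x, rfl⟩; exact act_sq hM a x
  have hgr : Gr M (LinearMap.range (actOf M a)) := gr_range_od (act_ev a) (act_od a)
  have hgk : Gr M (LinearMap.ker (actOf M a)) := gr_ker_od (act_ev a) (act_od a)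
  obtain ⟨v, p, hv, hvr, hp⟩ : ∃ (v : M.carrier) (p : Bool), actOf M a v = 0 ∧
      v ∉ LinearMap.range (actOf M a) ∧ v ∈ if p then M.od else M.ev := by
    obtain ⟨v, hv, hvr⟩ : ∃ v ∈ LinearMap.ker (actOf M a), v ∉ LinearMap.range (actOf M a) := by
      by_contra hc
      push Not at hc
      have : LinearMap.ker (actOf M a) = LinearMap.range (actOf M a) :=
        le_antisymm hc hle
      rw [this] at hrn
      omega
    by_cases h1 : pe M v ∈ LinearMap.range (actOf M a)
    · refine ⟨v - pe M v, true, Submodule.sub_mem _ hv (hgk v hv), fun h2 => hvr ?_,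
        pe_sub_mem M v⟩
      have := Submodule.add_mem _ h1 h2
      rwa [add_sub_cancel] at this
    · exact ⟨pe M v, false, hgk v hv, h1, pe_mem M v⟩
  obtain ⟨C, hC, hcompl⟩ := exists_gr_compl hgk
  have hcat : VCat k 1 (res M a) := (rel1_iff _).2 (fun x => act_sq hM a x)
  have hι : IsEv (gsp M C hC) (res M a) (gspι M C hC) := gspι_ev M C hC
  have hres : IsRestriction ![a] M (res M a) :=
    ⟨LinearEquiv.refl k M.carrier, fun _ => Iff.rfl, fun _ => Iff.rfl, fun j m => by
      fin_cases j; rfl⟩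
  have hf := trivMap_hom p (res M a) v hv hp
  have hg := ind1_hom hcat hι
  refine ⟨p, 0, triv k p, triv k p, F1 (gsp M C hC), res M a, triv_trivial p,
    Or.inl ⟨rfl, LinearEquiv.refl k _, isHom_id _⟩, F1_proj _, hres, dsum_of hf hg ?_ ?_⟩
  · intro (c : k) y hxy
    obtain ⟨y, z, rfl⟩ := mk2_surj _ y
    obtain ⟨h1, h2, h3⟩ := lin_inj (act_sq hM a) hcompl hv hvr (gspι_mem M C hC y)
      (gspι_mem M C hC z) (c := c) hxy
    rw [(map_eq_zero_iff _ (gspι_inj M C hC)).1 h2, (map_eq_zero_iff _ (gspι_inj M C hC)).1 h3]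
    exact ⟨h1, rfl⟩
  · intro s
    obtain ⟨c, y, hy, z, hz, h⟩ := lin_surj (act_sq hM a) hcompl hv hvr hd s
    obtain ⟨y, rfl⟩ := gspι_surj M C hC hy
    obtain ⟨z, rfl⟩ := gspι_surj M C hC hz
    exact ⟨c, mk2 _ y z, h⟩

end SupCat.Aux
namespace SupCat.Aux

open SupCat SupCat.GSupMod

variable {k : Type} [Field k] {ι ι' : Type}

lemma mem_rad {M : GSupMod k (Fin 2)} {x : M.carrier} :
    x ∈ radical M ↔ ∃ y z, x = M.θ 0 y + M.θ 1 z := by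
  have : radical M = LinearMap.range (M.θ 0) ⊔ LinearMap.range (M.θ 1) := by
    unfold radical
    apply le_antisymm
    · refine iSup_le fun i => ?_
      fin_cases i
      · exact le_sup_left
      · exact le_sup_right
    · exact sup_le (le_iSup (fun i => LinearMap.range (M.θ i)) 0)
        (le_iSup (fun i => LinearMap.range (M.θ i)) 1)
  rw [this, Submodule.mem_sup]
  constructor
  · rintro ⟨_, ⟨y, rfl⟩, _, ⟨z, rfl⟩, h⟩
    exact ⟨y, z, h.symm⟩
  · rintro ⟨y, z, h⟩
    exact ⟨_, ⟨y, rfl⟩, _, ⟨z, rfl⟩, h.symm⟩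

lemma θ_mem_rad {ι : Type} (M : GSupMod k ι) (i : ι) (x) : M.θ i x ∈ radical M :=
  Submodule.mem_iSup_of_mem i ⟨x, rfl⟩

lemma act_mem_rad (M : GSupMod k (Fin 2)) (a x) : actOf M a x ∈ radical M := by
  rw [act2]
  exact add_mem (Submodule.smul_mem _ _ (θ_mem_rad M 0 x)) (Submodule.smul_mem _ _ (θ_mem_rad M 1 x))

/-- the structural property -/
structure Str (M : GSupMod k (Fin 2)) : Prop where
  rel : Rel M
  nil : ∀ x, M.θ 0 (M.θ 1 x) = 0
  rng : ∀ a : Fin 2 → k, a ≠ 0 → ∀ x ∈ radical M, ∃ y, actOf M a y = x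
  dim : Module.finrank k M.carrier = 2 * Module.finrank k (radical M) + 1
  soc : ∀ x, M.θ 0 x = 0 → M.θ 1 x = 0 → x ∈ radical M

lemma Str.range_eq {M : GSupMod k (Fin 2)} (h : Str M) {a : Fin 2 → k} (ha : a ≠ 0) :
    LinearMap.range (actOf M a) = radical M := by
  apply le_antisymm
  · rintro _ ⟨x, rfl⟩; exact act_mem_rad M a x
  · intro x hx; exact h.rng a ha x hx

lemma Str.cond2 [CharZero k] {M : GSupMod k (Fin 2)} (h : Str M) : Cond2 M :=
  cond2_of h.rel fun a ha => by rw [h.range_eq ha, h.dim]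

lemma indep_zero {M : GSupMod k (Fin 2)} {a b : Fin 2 → k} (ha : a ≠ 0)
    (hb : b ∉ Submodule.span k {a}) {m : M.carrier} (h1 : actOf M a m = 0) (h2 : actOf M b m = 0) :
    M.θ 0 m = 0 ∧ M.θ 1 m = 0 := by
  rw [act2] at h1 h2
  have hD : a 0 * b 1 - a 1 * b 0 ≠ 0 := by
    intro hD
    apply hb
    rw [Submodule.mem_span_singleton]
    by_cases h0 : a 0 = 0
    · have h1' : a 1 ≠ 0 := fun h1' => ha (by ext i; fin_cases i; exacts [h0, h1'])
      refine ⟨b 1 / a 1, ?_⟩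
      ext i
      fin_cases i
      · have : b 0 = 0 := by
          rw [h0] at hD
          have : a 1 * b 0 = 0 := by linear_combination -hD
          exact (mul_eq_zero.1 this).resolve_left h1'
        simp [h0, this]
      · simp [h1']
    · refine ⟨b 0 / a 0, ?_⟩
      ext i
      fin_cases i
      · simp [h0]
      · simp only [Pi.smul_apply, smul_eq_mul, Fin.mk_one]
        field_simp
        linear_combination -hD
  constructor
  · have : (a 0 * b 1 - a 1 * b 0) • M.θ 0 m = 0 := by
      have e : (a 0 * b 1 - a 1 * b 0) • M.θ 0 m
          = b 1 • (a 0 • M.θ 0 m + a 1 • M.θ 1 m) - a 1 • (b 0 • M.θ 0 m + b 1 • M.θ 1 m) := by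
        module
      rw [e, h1, h2, smul_zero, smul_zero, sub_zero]
    exact (smul_eq_zero.1 this).resolve_left hD
  · have : (a 0 * b 1 - a 1 * b 0) • M.θ 1 m = 0 := by
      have e : (a 0 * b 1 - a 1 * b 0) • M.θ 1 m
          = a 0 • (b 0 • M.θ 0 m + b 1 • M.θ 1 m) - b 0 • (a 0 • M.θ 0 m + a 1 • M.θ 1 m) := by
        module
      rw [e, h1, h2, smul_zero, smul_zero, sub_zero]
    exact (smul_eq_zero.1 this).resolve_left hD

lemma Str.cond3 [CharZero k] {M : GSupMod k (Fin 2)} (h : Str M) : Cond3 M := by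
  refine ⟨h.cond2, fun a ha => ⟨?_, ?_⟩⟩
  · rintro v ⟨hv, L, P, hc, hL, -, -, hav, hP⟩ hr
    obtain ⟨y, hy⟩ := h.rng a ha v hr
    obtain ⟨l, hl, p, hp, rfl⟩ := Submodule.mem_sup.1
      (show y ∈ L ⊔ P by rw [hc.sup_eq_top]; trivial)
    rw [hL] at hl
    obtain ⟨c, rfl⟩ := Submodule.mem_span_singleton.1 hl
    rw [map_add, map_smul, hav, smul_zero, zero_add] at hy
    have h1 : v ∈ P ⊓ LinearMap.ker (actOf M a) := by rw [hP]; exact ⟨p, hp, hy⟩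
    exact hv (Submodule.disjoint_def.1 hc.disjoint v
      (by rw [hL]; exact Submodule.mem_span_singleton_self v) h1.1)
  · intro b hb m hm
    by_contra hcon
    push Not at hcon
    obtain ⟨h0, h1⟩ := indep_zero ha hb hcon.1 hcon.2
    exact hm (h.soc m h0 h1)

lemma rk_add (M : GSupMod k ι) :
    rk M + Module.finrank k (radical M) = Module.finrank k M.carrier :=
  Submodule.finrank_quotient_add_finrank _

lemma rk_le_of_surj {A B : GSupMod k ι} {f : A.carrier →ₗ[k] B.carrier} (hf : IsHom A B f)
    (hs : Function.Surjective f) : rk B ≤ rk A := by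
  have hle : radical A ≤ (radical B).comap f := by
    refine iSup_le fun i => ?_
    rintro _ ⟨x, rfl⟩
    rw [Submodule.mem_comap, (isHom_iff.1 hf).1]
    exact θ_mem_rad B i _
  refine LinearMap.finrank_le_finrank_of_surjective (f := Submodule.mapQ _ _ f hle) ?_
  intro q
  obtain ⟨b, rfl⟩ := Submodule.mkQ_surjective _ q
  obtain ⟨a, rfl⟩ := hs b
  exact ⟨Submodule.Quotient.mk a, by simp⟩

lemma rk_FM_le (W : GSupMod k ι) : rk (FM W) ≤ Module.finrank k W.carrier := by
  refine LinearMap.finrank_le_finrank_of_surjective (f := (radical (FM W)).mkQ ∘ₗ inc1 W) ?_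
  intro q
  obtain ⟨b, rfl⟩ := Submodule.mkQ_surjective _ q
  obtain ⟨x, y, z, w, rfl⟩ := mk4_surj W b
  refine ⟨x, ?_⟩
  rw [LinearMap.comp_apply, Submodule.mkQ_apply, Submodule.mkQ_apply, Submodule.Quotient.eq,
    FM_gen W x y z w]
  have h1 := θ_mem_rad (FM W) 0 (inc1 W y)
  have h2 := θ_mem_rad (FM W) 1 (inc1 W z)
  have h3 := θ_mem_rad (FM W) 0 ((FM W).θ 1 (inc1 W w))
  have h4 := neg_mem (add_mem (add_mem h1 h2) h3)
  convert h4 using 1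
  abel

lemma Str.cond1 [CharZero k] {M : GSupMod k (Fin 2)} (h : Str M) : Cond1 M := by
  rintro N ⟨hN, I, j, p, ⟨hI, hj, hinj, hmin⟩, hp, hsurj, hker⟩
  have hM : VCat k 2 M := (rel_iff M).2 h.rel
  have hgr := gr_radical M
  obtain ⟨r, hr, hr'⟩ := exists_even_retraction (gspι_ev M _ hgr) (gspι_inj M _ hgr)
  have hr0 : ∀ x ∈ radical M, r x = 0 → x = 0 := by
    intro x hx h0
    obtain ⟨y, rfl⟩ := gspι_surj M _ hgr hx
    rw [hr'] at h0
    rw [h0, map_zero]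
  have hF := FM_inj (gsp M (radical M) hgr)
  have hι := coHom_hom h.rel hr
  have hιinj : Function.Injective (coHom (gsp M (radical M) hgr) M r) := by
    rw [injective_iff_map_eq_zero]
    intro x hx
    rw [coHom_apply, ← mk4_zero, mk4_eq] at hx
    obtain ⟨-, h1, h2, h3⟩ := hx
    exact hr0 x (h.soc x (hr0 _ (θ_mem_rad M 0 x) h2)
      (hr0 _ (θ_mem_rad M 1 x) (neg_eq_zero.1 h1))) h3
  obtain ⟨g, hg, hgj⟩ := hF.2 M I j _ hM hI.1 hj hinj hι
  have hginj : Function.Injective g := hmin _ g hF.1 hg (by rw [hgj]; exact hιinj)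
  obtain ⟨s, hs, hsg⟩ := hI.2 I _ g LinearMap.id hI.1 hF.1 hg hginj (isHom_id I)
  have hs_surj : Function.Surjective s := fun x => ⟨g x, LinearMap.congr_fun hsg x⟩
  have e1 := rk_le_of_surj hp hsurj
  have e2 := rk_le_of_surj hs hs_surj
  have e3 := rk_FM_le (gsp M (radical M) hgr)
  rw [finrank_gsp] at e3
  have e4 := rk_add M
  have e5 := h.dim
  omega

/-- no projective summands implies Loewy length two -/
lemma nil_of_noProj [CharZero k] {M : GSupMod k (Fin 2)} (hM : VCat k 2 M)
    (hnp : NoProjSummands (VCat k 2) M) (x : M.carrier) : M.θ 0 (M.θ 1 x) = 0 := by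
  have hR := (rel_iff M).1 hM
  have hev : IsEv M M (M.θ 0 ∘ₗ M.θ 1) :=
    ⟨fun m hm => M.θ_od 0 _ (M.θ_ev 1 _ hm), fun m hm => M.θ_ev 0 _ (M.θ_od 1 _ hm)⟩
  obtain ⟨C, hC, hcompl⟩ := exists_gr_compl (gr_ker_ev hev)
  have hdisj := Submodule.disjoint_def.1 hcompl.disjoint
  have hz : ∀ c : (gsp M C hC).carrier, M.θ 0 (M.θ 1 (gspι M C hC c)) = 0 → c = 0 := by
    intro c hc
    exact (map_eq_zero_iff _ (gspι_inj M C hC)).1 (hdisj _ hc (gspι_mem M C hC c))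
  have hF := FM_inj (gsp M C hC)
  have hj := indHom_hom hR (gspι_ev M C hC)
  have hinj : Function.Injective (indHom (gsp M C hC) M (gspι M C hC)) := by
    rw [injective_iff_map_eq_zero]
    intro p hp
    obtain ⟨x, y, z, w, rfl⟩ := mk4_surj _ p
    rw [indHom_apply] at hp
    have h0 : M.θ 0 (M.θ 1 (gspι M C hC x)) = 0 := by
      have := congrArg (fun t => M.θ 0 (M.θ 1 t)) hp
      simpa [hR.h00, hR.h11, hR.h10] using this
    have hx := hz x h0
    subst hx
    have h1 : M.θ 0 (M.θ 1 (gspι M C hC y)) = 0 := by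
      have := congrArg (fun t => M.θ 1 t) hp
      simpa [hR.h00, hR.h11, hR.h10] using this
    have hy := hz y h1
    subst hy
    have h2 : M.θ 0 (M.θ 1 (gspι M C hC z)) = 0 := by
      have := congrArg (fun t => M.θ 0 t) hp
      simpa [hR.h00, hR.h11, hR.h10] using this
    have hz' := hz z h2
    subst hz'
    have hw := hz w (by simpa using hp)
    subst hw
    rfl
  obtain ⟨r, hr, hrj⟩ := hF.2 _ M _ LinearMap.id hF.1 hM hj hinj (isHom_id _)
  obtain ⟨B, hB⟩ := dsum_of_retract hj hr (fun x => LinearMap.congr_fun hrj x)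
  have h0 := hnp _ B (FM_proj _) hB
  have hC0 : ∀ c ∈ C, c = 0 := by
    intro c hc
    obtain ⟨c, rfl⟩ := gspι_surj M C hC hc
    have := h0 (mk4 _ c 0 0 0)
    rw [← mk4_zero, mk4_eq] at this
    rw [this.1, map_zero]
  obtain ⟨a, ha, b, hb, rfl⟩ := Submodule.mem_sup.1
    (show x ∈ LinearMap.ker (M.θ 0 ∘ₗ M.θ 1) ⊔ C by rw [hcompl.sup_eq_top]; trivial)
  rw [hC0 b hb, add_zero]
  exact ha

lemma rad_act_zero {M : GSupMod k (Fin 2)} (hR : Rel M) (hnil : ∀ x, M.θ 0 (M.θ 1 x) = 0)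
    {x : M.carrier} (hx : x ∈ radical M) (a) : actOf M a x = 0 := by
  obtain ⟨y, z, rfl⟩ := mem_rad.1 hx
  rw [act2]
  simp [hR.h00, hR.h11, hR.h10, hnil]

lemma str_of_cond [CharZero k] {M : GSupMod k (Fin 2)} (hM : VCat k 2 M)
    (hnp : NoProjSummands (VCat k 2) M) (h3 : Cond3 M) : Str M := by
  have hR := (rel_iff M).1 hM
  have hnil := nil_of_noProj hM hnp
  have key : ∀ a : Fin 2 → k, a ≠ 0 → ∃ v, v ∉ radical M ∧ actOf M a v = 0 ∧
      ∀ x, actOf M a x = 0 → ∃ (c : k) (y : M.carrier), x = c • v + actOf M a y := by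
    intro a ha
    obtain ⟨v, hv⟩ := cond2_extract h3.1 a ha
    refine ⟨v, (h3.2 a ha).1 v hv, ?_⟩
    obtain ⟨hv0, L, P, hc, hL, -, -, hav, hP⟩ := hv
    refine ⟨hav, fun x hx => ?_⟩
    obtain ⟨l, hl, p, hp, rfl⟩ := Submodule.mem_sup.1
      (show x ∈ L ⊔ P by rw [hc.sup_eq_top]; trivial)
    rw [hL] at hl
    obtain ⟨c, rfl⟩ := Submodule.mem_span_singleton.1 hl
    rw [map_add, map_smul, hav, smul_zero, zero_add] at hx
    have h1 : p ∈ Submodule.map (actOf M a) P := by rw [← hP]; exact ⟨hp, hx⟩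
    obtain ⟨y, -, rfl⟩ := h1
    exact ⟨c, y, rfl⟩
  have hrng : ∀ a : Fin 2 → k, a ≠ 0 → ∀ x ∈ radical M, ∃ y, actOf M a y = x := by
    intro a ha x hx
    obtain ⟨v, hv, hav, hk⟩ := key a ha
    obtain ⟨c, y, rfl⟩ := hk x (rad_act_zero hR hnil hx a)
    have h1 := sub_mem hx (act_mem_rad M a y)
    rw [add_sub_cancel_right] at h1
    have hc : c = 0 := by
      by_contra hc
      exact hv ((Submodule.smul_mem_iff _ hc).1 h1)
    exact ⟨y, by rw [hc, zero_smul, zero_add]⟩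
  have h10 : (![1, 0] : Fin 2 → k) ≠ 0 := fun h => one_ne_zero (congrFun h 0)
  refine ⟨hR, hnil, hrng, ?_, ?_⟩
  · obtain ⟨v, hv, hav, hk⟩ := key _ h10
    have hr : LinearMap.range (actOf M ![1, 0]) = radical M := by
      apply le_antisymm
      · rintro _ ⟨x, rfl⟩; exact act_mem_rad M _ x
      · intro x hx; exact hrng _ h10 x hx
    have hker : LinearMap.ker (actOf M ![1, 0]) = radical M ⊔ Submodule.span k {v} := by
      apply le_antisymm
      · intro x hx
        obtain ⟨c, y, rfl⟩ := hk x hx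
        rw [add_comm]
        exact Submodule.add_mem_sup (act_mem_rad M _ y)
          (Submodule.smul_mem _ _ (Submodule.mem_span_singleton_self v))
      · refine sup_le (fun x hx => rad_act_zero hR hnil hx _) ?_
        rw [Submodule.span_singleton_le_iff_mem]; exact hav
    have h1 := LinearMap.finrank_range_add_finrank_ker (actOf M ![1, 0])
    rw [hker, hr, finrank_sup_span _ hv] at h1
    omega
  · intro x h0 h1
    by_contra hx
    have hb : (![0, 1] : Fin 2 → k) ∉ Submodule.span k {(![1, 0] : Fin 2 → k)} := by
      rw [Submodule.mem_span_singleton]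
      rintro ⟨c, hc⟩
      have := congrFun hc 1
      simp at this
    rcases (h3.2 _ h10).2 _ hb x hx with h | h
    · apply h; rw [act2]; simp [h0]
    · apply h; rw [act2]; simp [h1]

/-- the inductive step -/
lemma Str.syzygy [CharZero k] {L N : GSupMod k (Fin 2)} (h : Str L)
    (hN : IsSyzygy (VCat k 2) L N) : Str N := by
  obtain ⟨hNV, P, π, i, ⟨hP, hπ, hsurj, hmin⟩, hi, hinj, hrange⟩ := hN
  have hRN := (rel_iff N).1 hNV
  have hRP := (rel_iff P).1 hP.1
  have hE := exact_of_proj hP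
  have hπ' := isHom_iff.1 hπ
  have hi' := isHom_iff.1 hi
  have hmem : ∀ x, π x = 0 → ∃ n, i n = x := fun x hx => by
    have : x ∈ LinearMap.range i := by rw [hrange]; exact hx
    exact this
  have hker : ∀ n, π (i n) = 0 := fun n => by
    have : i n ∈ LinearMap.ker π := by rw [← hrange]; exact ⟨n, rfl⟩
    exact this
  -- `ker π ⊆ rad P`
  have hrad : ∀ x, π x = 0 → x ∈ radical P := by
    obtain ⟨C, hC, hcompl⟩ := exists_gr_compl ((gr_ker_ev hπ'.2).sup (gr_radical P))
    have hst : ∀ i, ∀ x ∈ C ⊔ radical P, P.θ i x ∈ C ⊔ radical P := fun i x _ =>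
      Submodule.mem_sup_right (θ_mem_rad P i x)
    have hsV : VCat k 2 (sub P (C ⊔ radical P) (hC.sup (gr_radical P)) hst) := by
      intro a b
      refine LinearMap.ext fun x => Subtype.ext ?_
      exact LinearMap.congr_fun (hP.1 a b) x.1
    have hs := hmin _ (subι P (C ⊔ radical P) (hC.sup (gr_radical P)) hst) hsV
      (subι_hom _ _ _ _) (by
        intro l
        obtain ⟨x, rfl⟩ := hsurj l
        obtain ⟨s, hs, c, hc, rfl⟩ := Submodule.mem_sup.1
          (show x ∈ (LinearMap.ker π ⊔ radical P) ⊔ C by rw [hcompl.sup_eq_top]; trivial)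
        obtain ⟨κ, hκ, r, hr, rfl⟩ := Submodule.mem_sup.1 hs
        obtain ⟨y, hy⟩ := subι_surj P _ (hC.sup (gr_radical P)) hst
          (Submodule.add_mem_sup hc hr)
        refine ⟨y, ?_⟩
        rw [LinearMap.comp_apply, hy, map_add, map_add, map_add, LinearMap.mem_ker.1 hκ]
        abel)
    intro x hx
    obtain ⟨y, hy⟩ := hs x
    have hy' := subι_mem P _ (hC.sup (gr_radical P)) hst y
    rw [hy] at hy'
    obtain ⟨c, hc, r, hr, rfl⟩ := Submodule.mem_sup.1 hy'
    have hcS : c ∈ LinearMap.ker π ⊔ radical P := by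
      have := Submodule.add_mem_sup (show c + r ∈ LinearMap.ker π from hx) (neg_mem hr)
      rwa [add_neg_cancel_right] at this
    rw [Submodule.disjoint_def.1 hcompl.disjoint c hcS hc, zero_add]
    exact hr
  have hnil : ∀ x, N.θ 0 (N.θ 1 x) = 0 := by
    intro x
    apply hinj
    rw [hi'.1, hi'.1, map_zero]
    obtain ⟨y, z, e⟩ := mem_rad.1 (hrad _ (hker x))
    rw [e]
    simp [hRP.h00, hRP.h11, hRP.h10]
  -- socle elements are hit by every `a`
  have hhit : ∀ a : Fin 2 → k, a ≠ 0 → ∀ n y, i n = P.θ 0 (P.θ 1 y) →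
      ∃ m, actOf N a m = n := by
    intro a ha n y hn
    obtain ⟨u, hu, hu'⟩ : ∃ u, u ∈ radical P ∧ actOf P a u = P.θ 0 (P.θ 1 y) := by
      by_cases h0 : a 0 = 0
      · have h1' : a 1 ≠ 0 := fun h1' => ha (by ext i; fin_cases i; exacts [h0, h1'])
        refine ⟨-(a 1)⁻¹ • P.θ 0 y, Submodule.smul_mem _ _ (θ_mem_rad P 0 y), ?_⟩
        rw [map_smul, act2, h0, hRP.h10]
        simp [smul_smul, h1']
      · refine ⟨(a 0)⁻¹ • P.θ 1 y, Submodule.smul_mem _ _ (θ_mem_rad P 1 y), ?_⟩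
        rw [map_smul, act2, hRP.h11]
        simp [smul_smul, h0]
    have hπu : π u ∈ radical L := by
      obtain ⟨s, t, rfl⟩ := mem_rad.1 hu
      rw [map_add, hπ'.1, hπ'.1]
      exact mem_rad.2 ⟨_, _, rfl⟩
    obtain ⟨l, hl⟩ := h.rng a ha _ hπu
    obtain ⟨z, rfl⟩ := hsurj l
    obtain ⟨m, hm⟩ := hmem (u - actOf P a z) (by rw [map_sub, hom_act hπ, hl, sub_self])
    refine ⟨m, hinj ?_⟩
    rw [hom_act hi, hm, map_sub, act_sq hRP, sub_zero, hu', hn]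
  have hsocN : ∀ n, N.θ 0 n = 0 → N.θ 1 n = 0 → ∃ y, i n = P.θ 0 (P.θ 1 y) := by
    intro n h0 h1
    exact hE.soc _ (by rw [← hi'.1, h0, map_zero]) (by rw [← hi'.1, h1, map_zero])
  have hradN : ∀ n ∈ radical N, ∃ y, i n = P.θ 0 (P.θ 1 y) := by
    intro n hn
    obtain ⟨y, z, rfl⟩ := mem_rad.1 hn
    apply hsocN <;> simp [hRN.h00, hRN.h11, hRN.h10, hnil]
  have h10 : (![1, 0] : Fin 2 → k) ≠ 0 := fun h => one_ne_zero (congrFun h 0)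
  have h01 : (![0, 1] : Fin 2 → k) ≠ 0 := fun h => one_ne_zero (congrFun h 1)
  refine ⟨hRN, hnil, ?_, ?_, ?_⟩
  · intro a ha x hx
    obtain ⟨y, hy⟩ := hradN x hx
    exact hhit a ha x y hy
  · -- dimension count
    let D := LinearMap.range (P.θ 0 ∘ₗ P.θ 1)
    have hmap : Submodule.map i (radical N) = D := by
      apply le_antisymm
      · rintro _ ⟨n, hn, rfl⟩
        obtain ⟨y, hy⟩ := hradN n hn
        exact ⟨y, hy.symm⟩
      · rintro _ ⟨y, rfl⟩
        have h0 : π (P.θ 0 (P.θ 1 y)) = 0 := by rw [hπ'.1, hπ'.1, h.nil]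
        obtain ⟨n, hn⟩ := hmem _ h0
        obtain ⟨m, hm⟩ := hhit _ h10 n y hn
        exact ⟨n, hm ▸ act_mem_rad N _ m, hn⟩
    have d1 : Module.finrank k (radical N) = Module.finrank k D := by
      rw [← hmap]
      exact (Submodule.equivMapOfInjective _ hinj (radical N)).finrank_eq
    have hkerD : LinearMap.ker (P.θ 0 ∘ₗ P.θ 1) = radical P := by
      apply le_antisymm
      · intro x hx
        obtain ⟨y, z, e⟩ := hE.top x hx
        exact mem_rad.2 ⟨y, z, e⟩
      · intro x hx
        obtain ⟨y, z, rfl⟩ := mem_rad.1 hx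
        simp [hRP.h00, hRP.h11, hRP.h10]
    have d2 := LinearMap.finrank_range_add_finrank_ker (P.θ 0 ∘ₗ P.θ 1)
    rw [hkerD] at d2
    -- `rad P = π⁻¹(rad L)`
    have hmapr : Submodule.map π (radical P) = radical L := by
      apply le_antisymm
      · rintro _ ⟨x, hx, rfl⟩
        obtain ⟨y, z, rfl⟩ := mem_rad.1 hx
        rw [map_add, hπ'.1, hπ'.1]
        exact mem_rad.2 ⟨_, _, rfl⟩
      · intro x hx
        obtain ⟨y, z, rfl⟩ := mem_rad.1 hx
        obtain ⟨y, rfl⟩ := hsurj y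
        obtain ⟨z, rfl⟩ := hsurj z
        exact ⟨_, mem_rad.2 ⟨y, z, rfl⟩, by rw [map_add, hπ'.1, hπ'.1]⟩
    have d3 : Module.finrank k (radical L) + Module.finrank k N.carrier
        = Module.finrank k (radical P) := by
      have := LinearMap.finrank_range_add_finrank_ker (π.domRestrict (radical P))
      rw [LinearMap.range_domRestrict, hmapr] at this
      rw [← this]
      congr 1
      rw [← LinearMap.finrank_range_of_inj hinj, hrange]
      have e : LinearMap.ker (π.domRestrict (radical P))
          = (LinearMap.ker π).comap (radical P).subtype := rfl
      rw [e]
      exact (Submodule.comapSubtypeEquivOfLe (fun x hx => hrad x hx)).finrank_eq.symm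
    have d4 := LinearMap.finrank_range_add_finrank_ker π
    rw [LinearMap.range_eq_top.2 hsurj, finrank_top, ← hrange,
      LinearMap.finrank_range_of_inj hinj] at d4
    have d5 := h.dim
    -- `dim P = 4 dim D`
    have d6 := LinearMap.finrank_range_add_finrank_ker (P.θ 0)
    have e6 : LinearMap.ker (P.θ 0) = LinearMap.range (P.θ 0) := by
      apply le_antisymm
      · intro x hx
        obtain ⟨y, hy⟩ := hE.ker _ h10 x (by rw [act2]; simp [LinearMap.mem_ker.1 hx])
        rw [act2] at hy
        exact ⟨y, by simpa using hy⟩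
      · rintro _ ⟨x, rfl⟩; exact hRP.h00 x
    rw [e6] at d6
    have d7 := LinearMap.finrank_range_add_finrank_ker ((P.θ 1).domRestrict (LinearMap.range (P.θ 0)))
    have e7 : Submodule.map (P.θ 1) (LinearMap.range (P.θ 0)) = D := by
      ext x
      constructor
      · rintro ⟨_, ⟨y, rfl⟩, rfl⟩
        exact ⟨-y, by simp [hRP.h10]⟩
      · rintro ⟨y, rfl⟩
        exact ⟨_, ⟨-y, rfl⟩, by simp [hRP.h10]⟩
    have e8 : LinearMap.ker ((P.θ 1).domRestrict (LinearMap.range (P.θ 0)))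
        = D.comap (LinearMap.range (P.θ 0)).subtype := by
      ext ⟨x, hx⟩
      constructor
      · intro h1
        obtain ⟨u, rfl⟩ := hx
        obtain ⟨y, hy⟩ := hE.soc _ (hRP.h00 u) h1
        exact ⟨y, hy.symm⟩
      · rintro ⟨y, hy⟩
        change P.θ 0 (P.θ 1 y) = x at hy
        change P.θ 1 x = 0
        rw [← hy, hRP.h10, hRP.h11]; simp
    have hDle : D ≤ LinearMap.range (P.θ 0) := by
      rintro _ ⟨y, rfl⟩; exact ⟨_, rfl⟩
    rw [LinearMap.range_domRestrict, e7, e8,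
      (Submodule.comapSubtypeEquivOfLe hDle).finrank_eq] at d7
    change Module.finrank k D + _ = _ at d2
    omega
  · intro n h0 h1
    obtain ⟨y, hy⟩ := hsocN n h0 h1
    obtain ⟨m, hm⟩ := hhit _ h10 n y hy
    exact hm ▸ act_mem_rad N _ m

lemma Str.of_iso {M N : GSupMod k (Fin 2)} (h : Str M) (e : M.carrier ≃ₗ[k] N.carrier)
    (he : ∀ i x, e (M.θ i x) = N.θ i (e x)) : Str N := by
  have hact : ∀ a x, e (actOf M a x) = actOf N a (e x) := by
    intro a x
    rw [act2, act2, map_add, map_smul, map_smul, he, he]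
  have hr : ∀ x, e x ∈ radical N ↔ x ∈ radical M := by
    intro x
    rw [mem_rad, mem_rad]
    constructor
    · rintro ⟨y, z, hyz⟩
      obtain ⟨y, rfl⟩ := e.surjective y
      obtain ⟨z, rfl⟩ := e.surjective z
      rw [← he, ← he, ← map_add] at hyz
      exact ⟨y, z, e.injective hyz⟩
    · rintro ⟨y, z, rfl⟩
      exact ⟨e y, e z, by rw [map_add, he, he]⟩
  have hrm : Submodule.map (e : M.carrier →ₗ[k] N.carrier) (radical M) = radical N := by
    ext x
    obtain ⟨x, rfl⟩ := e.surjective x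
    rw [hr]
    constructor
    · rintro ⟨y, hy, hxy⟩
      rwa [← e.injective hxy]
    · intro hx
      exact ⟨x, hx, rfl⟩
  refine ⟨⟨?_, ?_, ?_⟩, ?_, ?_, ?_, ?_⟩
  · intro x
    obtain ⟨x, rfl⟩ := e.surjective x
    rw [← he, ← he, h.rel.h00, map_zero]
  · intro x
    obtain ⟨x, rfl⟩ := e.surjective x
    rw [← he, ← he, h.rel.h11, map_zero]
  · intro x
    obtain ⟨x, rfl⟩ := e.surjective x
    rw [← he, ← he, ← he, ← he, h.rel.h10, map_neg]
  · intro x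
    obtain ⟨x, rfl⟩ := e.surjective x
    rw [← he, ← he, h.nil, map_zero]
  · intro a ha x hx
    obtain ⟨x, rfl⟩ := e.surjective x
    obtain ⟨y, rfl⟩ := h.rng a ha x ((hr x).1 hx)
    exact ⟨e y, (hact a y).symm⟩
  · rw [← hrm, ← (Submodule.equivMapOfInjective _ e.injective _).finrank_eq, ← e.finrank_eq, h.dim]
  · intro x h0 h1
    obtain ⟨x, rfl⟩ := e.surjective x
    rw [← he, e.map_eq_zero_iff] at h0 h1
    exact (hr x).2 (h.soc x h0 h1)

lemma Str.omegaZero {M N : GSupMod k (Fin 2)} (h : Str M) (hnp : NoProjSummands (VCat k 2) M)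
    (hN : IsOmegaZero (VCat k 2) M N) : Str N := by
  obtain ⟨Q, hQ, -, φ, hφe, hφo, hφ⟩ := hN
  have hQ0 := hnp Q N hQ ⟨φ.trans (LinearEquiv.prodComm k _ _),
    fun s => by rw [hφe, and_comm]; rfl, fun s => by rw [hφo, and_comm]; rfl,
    fun i s => by
      rw [LinearEquiv.trans_apply, hφ]; rfl⟩
  refine h.of_iso (LinearEquiv.ofBijective
    (LinearMap.fst k _ _ ∘ₗ (φ : M.carrier →ₗ[k] N.carrier × Q.carrier)) ⟨?_, ?_⟩) ?_
  · intro x y hxy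
    exact φ.injective (Prod.ext hxy ((hQ0 _).trans (hQ0 _).symm))
  · intro n
    exact ⟨φ.symm (n, 0), by simp⟩
  · intro i x
    change (φ (M.θ i x)).1 = N.θ i (φ x).1
    rw [hφ]; rfl

end SupCat.Aux

open SupCat SupCat.GSupMod in
/-- Let `M` be a `V(a₂)`-supermodule with no projective
submodules satisfying conditions (1), (2) and (3).  Then `Ωⁿ(M)` satisfies
conditions (1), (2) and (3) for all `n ≥ 0`. -/
theorem conditions_stable_under_syzygies
    (k : Type) [Field k] [IsAlgClosed k] [CharZero k]
    (M : GSupMod k (Fin 2)) (hM : VCat k 2 M)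
    (hnp : NoProjSummands (VCat k 2) M)
    (h1 : Cond1 M) (h2 : Cond2 M) (h3 : Cond3 M) :
    ∀ (n : ℕ) (N : GSupMod k (Fin 2)), IsOmegaPow (VCat k 2) n M N →
      Cond1 N ∧ Cond2 N ∧ Cond3 N := by

  have hS : SupCat.Aux.Str M := SupCat.Aux.str_of_cond hM hnp h3
  have key : ∀ (n : ℕ) (N : GSupMod k (Fin 2)), IsOmegaPow (VCat k 2) n M N →
      SupCat.Aux.Str N := by
    intro n
    induction n with
    | zero => exact fun N hN => hS.omegaZero hnp hN
    | succ n ih =>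
      rintro N ⟨L, hL, hN⟩
      exact (ih L hL).syzygy hN
  intro n N hN
  have h := key n N hN
  exact ⟨h.cond1, h.cond2, h.cond3⟩
end
end

section
/- Let M be a V(a_2)-supermodule with no projective submodules satisfying conditions (1), (2), and (3). Then either Ω^{-1}(M) satisfies all three conditions, or Ω^{-1}(M) has a direct summand isomorphic to the trivial module k (of either parity). -/
/-!
A concrete model of the supermodule categories of the paper "On Endotrivial
Modules for Lie Superalgebras" attached to the detecting subalgebras
`e_r = q(1)^{×r}`, `f_n = sl(1|1)^{×n}`, to rank-one subalgebras `⟨z⟩` of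
`sl(1|1)`, and to the exterior superalgebras `V(a_r) = Λ((a_r)₁)`.

A `GSupMod k ι` is a finite-dimensional `ℤ₂`-graded `k`-vector space together
with a family of odd operators `θ i` (the actions of the distinguished odd
basis elements of the superalgebra: the `e_i` for `e_r`, the `x_i, y_i` for
`f_n`, the `a_i` for `V(a_r)`).  The even parts of all these superalgebras are
generated by the brackets of the odd generators, so the relations defining
each particular category, as well as complete reducibility over the even part,
are imposed by a predicate `𝒞 : GSupMod k ι → Prop`, defined separately for
each case.  All categorical notions (homomorphisms, isomorphisms, direct sums,
tensor products, duals, internal Hom, trivial modules, projectivity,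
projective covers and injective hulls, syzygies `Ωⁿ` for `n : ℤ`, endotrivial
modules, and the group `T` of stable classes of endotrivial modules) are
defined relative to such a predicate.
-/

noncomputable section

namespace CZ

open SupCat SupCat.GSupMod

section basics

variable {k : Type} [Field k] {ι : Type}

/-- projection to the even part -/
def pe (M : GSupMod k ι) : M.carrier →ₗ[k] M.carrier :=
  M.ev.subtype ∘ₗ Submodule.projectionOnto M.ev M.od M.isCompl

/-- projection to the odd part -/
def po (M : GSupMod k ι) : M.carrier →ₗ[k] M.carrier :=
  M.od.subtype ∘ₗ Submodule.projectionOnto M.od M.ev M.isCompl.symm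

lemma pe_mem (M : GSupMod k ι) (x : M.carrier) : pe M x ∈ M.ev := by
  simp [pe]

lemma po_mem (M : GSupMod k ι) (x : M.carrier) : po M x ∈ M.od := by
  simp [po]

lemma pe_of_ev (M : GSupMod k ι) {x : M.carrier} (hx : x ∈ M.ev) : pe M x = x := by
  have := Submodule.projectionOnto_apply_left M.isCompl ⟨x, hx⟩
  simp only [pe, LinearMap.comp_apply]
  simpa using congrArg Subtype.val this

lemma pe_of_od (M : GSupMod k ι) {x : M.carrier} (hx : x ∈ M.od) : pe M x = 0 := by
  have := (Submodule.projectionOnto_apply_eq_zero_iff M.isCompl (x := x)).2 hx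
  simp [pe, this]

lemma po_of_od (M : GSupMod k ι) {x : M.carrier} (hx : x ∈ M.od) : po M x = x := by
  have := Submodule.projectionOnto_apply_left M.isCompl.symm ⟨x, hx⟩
  simp only [po, LinearMap.comp_apply]
  simpa using congrArg Subtype.val this

lemma po_of_ev (M : GSupMod k ι) {x : M.carrier} (hx : x ∈ M.ev) : po M x = 0 := by
  have := (Submodule.projectionOnto_apply_eq_zero_iff M.isCompl.symm (x := x)).2 hx
  simp [po, this]

lemma exists_dec (M : GSupMod k ι) (x : M.carrier) :
    ∃ e ∈ M.ev, ∃ o ∈ M.od, e + o = x := by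
  have : x ∈ M.ev ⊔ M.od := by rw [M.isCompl.sup_eq_top]; trivial
  exact Submodule.mem_sup.1 this

lemma pe_add_po (M : GSupMod k ι) (x : M.carrier) : pe M x + po M x = x := by
  obtain ⟨e, he, o, ho, rfl⟩ := exists_dec M x
  simp [pe_of_ev M he, pe_of_od M ho, po_of_ev M he, po_of_od M ho]

lemma pe_eq (M : GSupMod k ι) {e o : M.carrier} (he : e ∈ M.ev) (ho : o ∈ M.od) :
    pe M (e + o) = e := by
  simp [pe_of_ev M he, pe_of_od M ho]

lemma po_eq (M : GSupMod k ι) {e o : M.carrier} (he : e ∈ M.ev) (ho : o ∈ M.od) :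
    po M (e + o) = o := by
  simp [po_of_ev M he, po_of_od M ho]

/-- an odd map exchanges the projections -/
lemma odd_pe (M : GSupMod k ι) (f : M.carrier →ₗ[k] M.carrier)
    (h0 : ∀ m ∈ M.ev, f m ∈ M.od) (h1 : ∀ m ∈ M.od, f m ∈ M.ev) (x : M.carrier) :
    f (pe M x) = po M (f x) := by
  conv_rhs => rw [← pe_add_po M x, map_add, add_comm,
    po_eq M (h1 _ (po_mem M x)) (h0 _ (pe_mem M x))]

lemma odd_po (M : GSupMod k ι) (f : M.carrier →ₗ[k] M.carrier)
    (h0 : ∀ m ∈ M.ev, f m ∈ M.od) (h1 : ∀ m ∈ M.od, f m ∈ M.ev) (x : M.carrier) :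
    f (po M x) = pe M (f x) := by
  conv_rhs => rw [← pe_add_po M x, map_add, add_comm,
    pe_eq M (h1 _ (po_mem M x)) (h0 _ (pe_mem M x))]

lemma even_pe (M : GSupMod k ι) {ι' : Type} (N : GSupMod k ι') (f : M.carrier →ₗ[k] N.carrier)
    (h0 : ∀ m ∈ M.ev, f m ∈ N.ev) (h1 : ∀ m ∈ M.od, f m ∈ N.od) (x : M.carrier) :
    f (pe M x) = pe N (f x) := by
  conv_rhs => rw [← pe_add_po M x, map_add,
    pe_eq N (h0 _ (pe_mem M x)) (h1 _ (po_mem M x))]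

lemma even_po (M : GSupMod k ι) {ι' : Type} (N : GSupMod k ι') (f : M.carrier →ₗ[k] N.carrier)
    (h0 : ∀ m ∈ M.ev, f m ∈ N.ev) (h1 : ∀ m ∈ M.od, f m ∈ N.od) (x : M.carrier) :
    f (po M x) = po N (f x) := by
  conv_rhs => rw [← pe_add_po M x, map_add,
    po_eq N (h0 _ (pe_mem M x)) (h1 _ (po_mem M x))]

lemma hom_θ {M N : GSupMod k ι} {f : M.carrier →ₗ[k] N.carrier} (hf : IsHom M N f) (i : ι)
    (x : M.carrier) : f (M.θ i x) = N.θ i (f x) :=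
  LinearMap.congr_fun (hf.1 i) x

lemma mem_ev_iff (M : GSupMod k ι) (x : M.carrier) : x ∈ M.ev ↔ po M x = 0 := by
  constructor
  · exact po_of_ev M
  · intro h
    rw [← pe_add_po M x, h, add_zero]; exact pe_mem M x

lemma mem_od_iff (M : GSupMod k ι) (x : M.carrier) : x ∈ M.od ↔ pe M x = 0 := by
  constructor
  · exact pe_of_od M
  · intro h
    rw [← pe_add_po M x, h, zero_add]; exact po_mem M x

/-- graded invariant submodule as a supermodule -/
def sub (M : GSupMod k ι) (W : Submodule k M.carrier)
    (hθ : ∀ i, ∀ x ∈ W, M.θ i x ∈ W) (hg : ∀ x ∈ W, pe M x ∈ W) : GSupMod k ι where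
  carrier := W
  ev := M.ev.comap W.subtype
  od := M.od.comap W.subtype
  isCompl := by
    constructor
    · rw [Submodule.disjoint_def]
      intro x h0 h1
      have := (Submodule.disjoint_def.1 M.isCompl.disjoint) x.1 h0 h1
      exact Subtype.ext this
    · rw [codisjoint_iff, eq_top_iff]
      intro x _
      rw [Submodule.mem_sup]
      refine ⟨⟨pe M x.1, hg _ x.2⟩, pe_mem M _, ⟨po M x.1, ?_⟩, po_mem M _, ?_⟩
      · have : po M x.1 = x.1 - pe M x.1 := by
          rw [eq_sub_iff_add_eq, add_comm, pe_add_po]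
        rw [this]; exact W.sub_mem x.2 (hg _ x.2)
      · exact Subtype.ext (pe_add_po M x.1)
  θ := fun i => (M.θ i).restrict (hθ i)
  θ_ev := fun i m hm => M.θ_ev i _ hm
  θ_od := fun i m hm => M.θ_od i _ hm

lemma sub_hom (M : GSupMod k ι) (W : Submodule k M.carrier)
    (hθ : ∀ i, ∀ x ∈ W, M.θ i x ∈ W) (hg : ∀ x ∈ W, pe M x ∈ W) :
    IsHom (sub M W hθ hg) M W.subtype :=
  ⟨fun _ => rfl, fun _ h => h, fun _ h => h⟩

lemma sub_dsum (M : GSupMod k ι) (L P : Submodule k M.carrier) (h : IsCompl L P)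
    (hθ : ∀ i, ∀ x ∈ L, M.θ i x ∈ L) (hg : ∀ x ∈ L, pe M x ∈ L)
    (hθ' : ∀ i, ∀ x ∈ P, M.θ i x ∈ P) (hg' : ∀ x ∈ P, pe M x ∈ P) :
    IsDsum (sub M L hθ hg) (sub M P hθ' hg') M := by
  have key : ∀ x : L × P, (Submodule.prodEquivOfIsCompl L P h).symm (x.1.1 + x.2.1) = x := by
    intro x
    rw [LinearEquiv.symm_apply_eq]
    simp
  have dec : ∀ s : M.carrier, ∃ x : L × P, s = x.1.1 + x.2.1 := by
    intro s
    refine ⟨(Submodule.prodEquivOfIsCompl L P h).symm s, ?_⟩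
    have := (Submodule.prodEquivOfIsCompl L P h).apply_symm_apply s
    rw [Submodule.coe_prodEquivOfIsCompl'] at this
    exact this.symm
  have z : ∀ x ∈ L, ∀ y ∈ P, x + y = 0 → x = 0 ∧ y = 0 := by
    intro x hx y hy hxy
    have hx' : x = 0 := (Submodule.disjoint_def.1 h.disjoint) x hx (by
      rw [eq_neg_of_add_eq_zero_left hxy]; exact P.neg_mem hy)
    subst hx'
    simpa using hxy
  have hpo : ∀ W : Submodule k M.carrier, (∀ x ∈ W, pe M x ∈ W) → ∀ x ∈ W, po M x ∈ W := by
    intro W hW x hx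
    have : po M x = x - pe M x := by
      rw [eq_sub_iff_add_eq, add_comm, pe_add_po]
    rw [this]; exact W.sub_mem hx (hW _ hx)
  refine ⟨(Submodule.prodEquivOfIsCompl L P h).symm, ?_, ?_, ?_⟩
  · intro s
    obtain ⟨x, rfl⟩ := dec s
    change _ ↔ ((Submodule.prodEquivOfIsCompl L P h).symm (x.1.1 + x.2.1)).1.1 ∈ M.ev ∧
      ((Submodule.prodEquivOfIsCompl L P h).symm (x.1.1 + x.2.1)).2.1 ∈ M.ev
    rw [key]
    refine ⟨fun hs => ?_, fun hs => M.ev.add_mem hs.1 hs.2⟩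
    rw [mem_ev_iff] at hs ⊢
    rw [mem_ev_iff]
    rw [map_add] at hs
    exact z _ (hpo L hg _ x.1.2) _ (hpo P hg' _ x.2.2) hs
  · intro s
    obtain ⟨x, rfl⟩ := dec s
    change _ ↔ ((Submodule.prodEquivOfIsCompl L P h).symm (x.1.1 + x.2.1)).1.1 ∈ M.od ∧
      ((Submodule.prodEquivOfIsCompl L P h).symm (x.1.1 + x.2.1)).2.1 ∈ M.od
    rw [key]
    refine ⟨fun hs => ?_, fun hs => M.od.add_mem hs.1 hs.2⟩
    rw [mem_od_iff] at hs ⊢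
    rw [mem_od_iff]
    rw [map_add] at hs
    exact z _ (hg _ x.1.2) _ (hg' _ x.2.2) hs
  · intro i s
    obtain ⟨x, rfl⟩ := dec s
    change _ = ((M.θ i).restrict (hθ i)).prodMap ((M.θ i).restrict (hθ' i))
      ((Submodule.prodEquivOfIsCompl L P h).symm (x.1.1 + x.2.1))
    rw [key, map_add]
    exact key (⟨M.θ i x.1, hθ i _ x.1.2⟩, ⟨M.θ i x.2, hθ' i _ x.2.2⟩)

/-- quotient by a graded invariant submodule -/
def quo (M : GSupMod k ι) (W : Submodule k M.carrier)
    (hθ : ∀ i, ∀ x ∈ W, M.θ i x ∈ W) (hg : ∀ x ∈ W, pe M x ∈ W) : GSupMod k ι where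
  carrier := M.carrier ⧸ W
  ev := M.ev.map W.mkQ
  od := M.od.map W.mkQ
  isCompl := by
    constructor
    · rw [Submodule.disjoint_def]
      rintro _ ⟨e, he, rfl⟩ ⟨o, ho, h⟩
      have h' : e - o ∈ W := by
        rw [← Submodule.Quotient.mk_eq_zero W, Submodule.Quotient.mk_sub, sub_eq_zero]
        exact h.symm
      have := hg _ h'
      rw [sub_eq_add_neg, pe_eq M he (M.od.neg_mem ho)] at this
      simpa using this
    · rw [codisjoint_iff, ← Submodule.map_sup, M.isCompl.sup_eq_top, Submodule.map_top,
        Submodule.range_mkQ]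
  θ := fun i => W.mapQ W (M.θ i) (fun x hx => hθ i x hx)
  θ_ev := by
    rintro i _ ⟨e, he, rfl⟩
    exact ⟨M.θ i e, M.θ_ev i _ he, by simp⟩
  θ_od := by
    rintro i _ ⟨e, he, rfl⟩
    exact ⟨M.θ i e, M.θ_od i _ he, by simp⟩

lemma quo_hom (M : GSupMod k ι) (W : Submodule k M.carrier)
    (hθ : ∀ i, ∀ x ∈ W, M.θ i x ∈ W) (hg : ∀ x ∈ W, pe M x ∈ W) :
    IsHom M (quo M W hθ hg) W.mkQ :=
  ⟨fun _ => rfl, fun m h => ⟨m, h, rfl⟩, fun m h => ⟨m, h, rfl⟩⟩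

/-- a graded section of a surjective hom -/
lemma graded_section {M N : GSupMod k ι} {π : M.carrier →ₗ[k] N.carrier} (h : IsHom M N π)
    (hs : Function.Surjective π) : ∃ σ : N.carrier →ₗ[k] M.carrier,
      (∀ x, π (σ x) = x) ∧ (∀ x ∈ N.ev, σ x ∈ M.ev) ∧ (∀ x ∈ N.od, σ x ∈ M.od) := by
  obtain ⟨τ, hτ⟩ := π.exists_rightInverse_of_surjective (LinearMap.range_eq_top.2 hs)
  have hτ' : ∀ x, π (τ x) = x := fun x => LinearMap.congr_fun hτ x
  refine ⟨pe M ∘ₗ τ ∘ₗ pe N + po M ∘ₗ τ ∘ₗ po N, ?_, ?_, ?_⟩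
  · intro x
    simp only [LinearMap.add_apply, LinearMap.comp_apply, map_add]
    rw [even_pe M N π h.2.1 h.2.2, even_po M N π h.2.1 h.2.2, hτ', hτ',
      pe_of_ev N (pe_mem N x), po_of_od N (po_mem N x), pe_add_po]
  · intro x hx
    simp only [LinearMap.add_apply, LinearMap.comp_apply]
    rw [po_of_ev N hx]; simp [pe_mem]
  · intro x hx
    simp only [LinearMap.add_apply, LinearMap.comp_apply]
    rw [pe_of_od N hx]; simp [po_mem]

lemma exists_functional {V : Type} [AddCommGroup V] [Module k V] (E O W : Submodule k V)
    (h : IsCompl E O) (hW : ∀ e ∈ E, ∀ o ∈ O, e + o ∈ W → e ∈ W)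
    (v : V) (hv : v ∈ E) (hvW : v ∉ W) :
    ∃ φ : V →ₗ[k] k, φ v = 1 ∧ (∀ x ∈ W, φ x = 0) ∧ ∀ x ∈ O, φ x = 0 := by
  have : v ∉ W ⊔ O := by
    intro hm
    obtain ⟨w, hw, o, ho, rfl⟩ := Submodule.mem_sup.1 hm
    exact hvW (hW _ hv (-o) (O.neg_mem ho) (by simpa using hw))
  obtain ⟨f, hf, hle⟩ := Submodule.exists_le_ker_of_notMem this
  refine ⟨(f v)⁻¹ • f, by simp [hf], ?_, ?_⟩
  · intro x hx
    have : f x = 0 := hle (Submodule.mem_sup_left hx)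
    simp [this]
  · intro x hx
    have : f x = 0 := hle (Submodule.mem_sup_right hx)
    simp [this]

/-- graded complement of a homogeneous line, containing a prescribed graded subspace -/
lemma exists_graded_compl (M : GSupMod k ι) (W : Submodule k M.carrier)
    (hW : ∀ x ∈ W, pe M x ∈ W) (v : M.carrier) (hv : v ∈ M.ev ∨ v ∈ M.od) (hvW : v ∉ W) :
    ∃ P : Submodule k M.carrier, IsCompl (Submodule.span k {v}) P ∧ W ≤ P ∧
      ∀ x ∈ P, pe M x ∈ P := by
  have main : ∀ φ : M.carrier →ₗ[k] k, φ v = 1 → IsCompl (Submodule.span k {v}) (LinearMap.ker φ) := by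
    intro φ hφ
    constructor
    · rw [Submodule.disjoint_def]
      intro x hx hx'
      obtain ⟨c, rfl⟩ := Submodule.mem_span_singleton.1 hx
      have : c = 0 := by simpa [hφ] using hx'
      simp [this]
    · rw [codisjoint_iff, eq_top_iff]
      intro x _
      rw [Submodule.mem_sup]
      exact ⟨φ x • v, Submodule.mem_span_singleton.2 ⟨_, rfl⟩, x - φ x • v, by simp [hφ], by simp⟩
  rcases hv with hv | hv
  · obtain ⟨φ, h1, h2, h3⟩ := exists_functional M.ev M.od W M.isCompl
      (fun e he o ho h => by simpa [pe_eq M he ho] using hW _ h) v hv hvW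
    refine ⟨_, main φ h1, h2, fun x hx => ?_⟩
    have : φ (pe M x + po M x) = 0 := by rw [pe_add_po]; exact hx
    rw [map_add, h3 _ (po_mem M x), add_zero] at this
    exact this
  · obtain ⟨φ, h1, h2, h3⟩ := exists_functional M.od M.ev W M.isCompl.symm
      (fun o ho e he h => by
        rw [add_comm] at h
        have := hW _ h
        rw [pe_eq M he ho] at this
        simpa using W.sub_mem h this) v hv hvW
    exact ⟨_, main φ h1, h2, fun x hx => h3 _ (pe_mem M x)⟩

lemma span_graded (M : GSupMod k ι) (v : M.carrier) (hv : v ∈ M.ev ∨ v ∈ M.od) :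
    ∀ x ∈ Submodule.span k {v}, pe M x ∈ Submodule.span k {v} := by
  intro x hx
  obtain ⟨c, rfl⟩ := Submodule.mem_span_singleton.1 hx
  rcases hv with hv | hv
  · rw [map_smul, pe_of_ev M hv]; exact hx
  · rw [map_smul, pe_of_od M hv]; simp

lemma actOf_ev [Fintype ι] (M : GSupMod k ι) (a : ι → k) : ∀ m ∈ M.ev, actOf M a m ∈ M.od := by
  intro m hm
  simp only [actOf, LinearMap.sum_apply, LinearMap.smul_apply]
  exact Submodule.sum_mem _ fun i _ => Submodule.smul_mem _ _ (M.θ_ev i m hm)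

lemma actOf_od [Fintype ι] (M : GSupMod k ι) (a : ι → k) : ∀ m ∈ M.od, actOf M a m ∈ M.ev := by
  intro m hm
  simp only [actOf, LinearMap.sum_apply, LinearMap.smul_apply]
  exact Submodule.sum_mem _ fun i _ => Submodule.smul_mem _ _ (M.θ_od i m hm)

lemma range_graded (M : GSupMod k ι) (f : M.carrier →ₗ[k] M.carrier)
    (h0 : ∀ m ∈ M.ev, f m ∈ M.od) (h1 : ∀ m ∈ M.od, f m ∈ M.ev) :
    ∀ x ∈ LinearMap.range f, pe M x ∈ LinearMap.range f := by
  rintro _ ⟨x, rfl⟩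
  exact ⟨po M x, odd_po M f h0 h1 x⟩

end basics

end CZ

namespace CZ

open SupCat SupCat.GSupMod

section rankone

variable {k : Type} [Field k]

lemma prod_isCompl {V W : Type} [AddCommGroup V] [Module k V] [AddCommGroup W] [Module k W]
    {A B : Submodule k V} {C D : Submodule k W} (h : IsCompl A B) (h' : IsCompl C D) :
    IsCompl (A.prod C) (B.prod D) := by
  constructor
  · rw [disjoint_iff, Submodule.prod_inf_prod, h.inf_eq_bot, h'.inf_eq_bot, Submodule.prod_bot]
  · rw [codisjoint_iff, Submodule.prod_sup_prod, h.sup_eq_top, h'.sup_eq_top, Submodule.prod_top]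

/-- the free module of rank `V` over the exterior algebra in one variable -/
def free1 (V : GSupMod k (Fin 1)) : GSupMod k (Fin 1) where
  carrier := V.carrier × V.carrier
  ev := V.ev.prod V.od
  od := V.od.prod V.ev
  isCompl := prod_isCompl V.isCompl V.isCompl.symm
  θ := fun _ => (LinearMap.inr k V.carrier V.carrier) ∘ₗ (LinearMap.fst k V.carrier V.carrier)
  θ_ev := fun _ _ hm => ⟨V.od.zero_mem, hm.1⟩
  θ_od := fun _ _ hm => ⟨V.ev.zero_mem, hm.1⟩

lemma free1_cat (V : GSupMod k (Fin 1)) : VCat k 1 (free1 V) := by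
  intro i j
  apply LinearMap.ext
  intro x
  change ((0 : V.carrier), (0 : V.carrier)) + (0, 0) = 0
  simp

lemma vcat_sq {r : ℕ} [CharZero k] {M : GSupMod k (Fin r)} (hM : VCat k r M) (i : Fin r)
    (x : M.carrier) :
    M.θ i (M.θ i x) = 0 := by
  have := LinearMap.congr_fun (hM i i) x
  simp only [LinearMap.add_apply, LinearMap.comp_apply, LinearMap.zero_apply] at this
  rw [← two_smul k] at this
  simpa using this

lemma proj1_exact [CharZero k] {P : GSupMod k (Fin 1)} (hP : IsProjective (VCat k 1) P) :
    LinearMap.ker (P.θ 0) ≤ LinearMap.range (P.θ 0) := by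
  let π : (free1 P).carrier →ₗ[k] P.carrier :=
    LinearMap.fst k P.carrier P.carrier + P.θ 0 ∘ₗ LinearMap.snd k P.carrier P.carrier
  have hπ : IsHom (free1 P) P π := by
    refine ⟨fun i => ?_, fun m hm => ?_, fun m hm => ?_⟩
    · apply LinearMap.ext
      rintro ⟨x, y⟩
      rw [Subsingleton.elim i 0]
      change (0 : P.carrier) + P.θ 0 x = P.θ 0 (x + P.θ 0 y)
      rw [map_add, vcat_sq hP.1]; simp
    · exact P.ev.add_mem hm.1 (P.θ_od 0 _ hm.2)
    · exact P.od.add_mem hm.1 (P.θ_ev 0 _ hm.2)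
  have hs : Function.Surjective π := fun x => ⟨((x, 0) : P.carrier × P.carrier), by
    change x + P.θ 0 0 = x
    simp⟩
  obtain ⟨h, hh, hc⟩ := hP.2 (free1 P) P π LinearMap.id (free1_cat P) hP.1 hπ hs
    ⟨fun _ => rfl, fun _ h => h, fun _ h => h⟩
  intro x hx
  have h1 : (free1 P).θ 0 (h x) = 0 := by
    rw [← hom_θ hh, LinearMap.mem_ker.1 hx, map_zero]
  have h2 : (h x).1 = 0 := congrArg Prod.snd h1
  have h3 : π (h x) = x := LinearMap.congr_fun hc x
  refine ⟨(h x).2, ?_⟩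
  rw [← h3]
  change _ = (h x).1 + P.θ 0 (h x).2
  rw [h2, zero_add, h3]

/-- exact modules are projective in rank one -/
lemma exact_proj1 [CharZero k] {P : GSupMod k (Fin 1)} (hP : VCat k 1 P)
    (he : LinearMap.ker (P.θ 0) ≤ LinearMap.range (P.θ 0)) : IsProjective (VCat k 1) P := by
  refine ⟨hP, ?_⟩
  intro M N π f hM hN hπ hs hf
  obtain ⟨σ, hσ, hσ0, hσ1⟩ := graded_section hπ hs
  have ht : ∃ t : P.carrier →ₗ[k] P.carrier, (∀ x, P.θ 0 (t (P.θ 0 x)) = P.θ 0 x) ∧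
      (∀ x ∈ P.ev, t x ∈ P.od) ∧ (∀ x ∈ P.od, t x ∈ P.ev) := by
    obtain ⟨g, hg⟩ := (P.θ 0).rangeRestrict.exists_rightInverse_of_surjective
      (LinearMap.range_rangeRestrict _)
    obtain ⟨t, ht⟩ := LinearMap.exists_extend g
    have ht' : ∀ x, P.θ 0 (t (P.θ 0 x)) = P.θ 0 x := by
      intro x
      have h1 : t (P.θ 0 x) = g ⟨P.θ 0 x, ⟨x, rfl⟩⟩ := LinearMap.congr_fun ht ⟨P.θ 0 x, ⟨x, rfl⟩⟩
      have h2 := LinearMap.congr_fun hg ⟨P.θ 0 x, ⟨x, rfl⟩⟩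
      rw [h1]
      exact congrArg Subtype.val h2
    refine ⟨pe P ∘ₗ t ∘ₗ po P + po P ∘ₗ t ∘ₗ pe P, ?_, ?_, ?_⟩
    · intro x
      simp only [LinearMap.add_apply, LinearMap.comp_apply, map_add]
      rw [odd_pe P _ (P.θ_ev 0) (P.θ_od 0), odd_po P _ (P.θ_ev 0) (P.θ_od 0),
        ← odd_pe P _ (P.θ_ev 0) (P.θ_od 0) x, ← odd_po P _ (P.θ_ev 0) (P.θ_od 0) x, ht', ht',
        odd_pe P _ (P.θ_ev 0) (P.θ_od 0), odd_po P _ (P.θ_ev 0) (P.θ_od 0),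
        po_of_od P (po_mem P _), pe_of_ev P (pe_mem P _), add_comm, pe_add_po]
    · intro x hx
      simp only [LinearMap.add_apply, LinearMap.comp_apply]
      rw [po_of_ev P hx]; simp [po_mem]
    · intro x hx
      simp only [LinearMap.add_apply, LinearMap.comp_apply]
      rw [pe_of_od P hx]; simp [pe_mem]
  obtain ⟨t, ht, ht0, ht1⟩ := ht
  let e : P.carrier →ₗ[k] P.carrier := t ∘ₗ P.θ 0
  let s : P.carrier →ₗ[k] P.carrier := t ∘ₗ (LinearMap.id - e)
  let h0 : P.carrier →ₗ[k] M.carrier := σ ∘ₗ f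
  have hsa : ∀ x, s (P.θ 0 x) = e x := by
    intro x; simp [s, e, vcat_sq hP]
  have has : ∀ x, P.θ 0 (s x) = x - e x := by
    intro x
    have : x - e x ∈ LinearMap.range (P.θ 0) := he (by simp [e, ht])
    obtain ⟨z, hz⟩ := this
    have : s x = t (x - e x) := by simp [s]
    rw [this, ← hz, ht]
  have he0 : ∀ x ∈ P.ev, e x ∈ P.ev := fun x hx => ht1 _ (P.θ_ev 0 _ hx)
  have he1 : ∀ x ∈ P.od, e x ∈ P.od := fun x hx => ht0 _ (P.θ_od 0 _ hx)
  have hs0 : ∀ x ∈ P.ev, s x ∈ P.od := fun x hx => ht0 _ (P.ev.sub_mem hx (he0 x hx))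
  have hs1 : ∀ x ∈ P.od, s x ∈ P.ev := fun x hx => ht1 _ (P.od.sub_mem hx (he1 x hx))
  have h00 : ∀ x ∈ P.ev, h0 x ∈ M.ev := fun x hx => hσ0 _ (hf.2.1 _ hx)
  have h01 : ∀ x ∈ P.od, h0 x ∈ M.od := fun x hx => hσ1 _ (hf.2.2 _ hx)
  refine ⟨h0 ∘ₗ e + M.θ 0 ∘ₗ h0 ∘ₗ s, ⟨?_, ?_, ?_⟩, ?_⟩
  · intro i
    rw [Subsingleton.elim i 0]
    ext x
    have : e (P.θ 0 x) = 0 := by simp [e, vcat_sq hP]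
    simp only [LinearMap.comp_apply, LinearMap.add_apply, map_add]
    rw [this, hsa, vcat_sq hM]
    simp
  · intro x hx
    exact M.ev.add_mem (h00 _ (he0 _ hx)) (M.θ_od _ _ (h01 _ (hs0 _ hx)))
  · intro x hx
    exact M.od.add_mem (h01 _ (he1 _ hx)) (M.θ_ev _ _ (h00 _ (hs1 _ hx)))
  · ext x
    simp only [LinearMap.comp_apply, LinearMap.add_apply, map_add, h0]
    rw [hom_θ hπ, hσ, hσ, ← hom_θ hf, has]
    simp

lemma exact_finrank {V : Type} [AddCommGroup V] [Module k V] [FiniteDimensional k V]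
    (f : V →ₗ[k] V) (hsq : ∀ x, f (f x) = 0) (he : LinearMap.ker f ≤ LinearMap.range f) :
    Module.finrank k V = 2 * Module.finrank k (LinearMap.range f) := by
  have h : LinearMap.range f = LinearMap.ker f := by
    apply le_antisymm _ he
    rintro _ ⟨x, rfl⟩
    exact hsq x
  have := f.finrank_range_add_finrank_ker
  rw [← h] at this
  omega

lemma span_le_one {V : Type} [AddCommGroup V] [Module k V] (x : V) :
    Module.finrank k (Submodule.span k {x}) ≤ 1 := by
  simpa using finrank_span_le_card (R := k) ({x} : Set V)

lemma finrank_map_inj {V W : Type} [AddCommGroup V] [Module k V] [AddCommGroup W] [Module k W]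
    (f : V →ₗ[k] W) (hf : Function.Injective f) (S : Submodule k V) :
    Module.finrank k (S.map f) = Module.finrank k S :=
  (Submodule.equivMapOfInjective f hf S).finrank_eq.symm

/-- a syzygy of a trivial module in rank one has dimension at most one -/
lemma syz_le [CharZero k] {p : Bool} {K T : GSupMod k (Fin 1)} (hK : IsTrivial p K)
    (hT : IsSyzygy (VCat k 1) K T) : Module.finrank k T.carrier ≤ 1 := by
  obtain ⟨hT, P, π, i, ⟨hP, hπ, hs, hmin⟩, hi, hinj, hr⟩ := hT
  have hdim : Module.finrank k P.carrier ≤ 2 := by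
    have : ∃ x, (x ∈ P.ev ∨ x ∈ P.od) ∧ π x ≠ 0 := by
      have hk : 0 < Module.finrank k K.carrier := by rw [hK.1]; norm_num
      have := Module.finrank_pos_iff.1 hk
      obtain ⟨z, hz⟩ := exists_ne (0 : K.carrier)
      obtain ⟨y, rfl⟩ := hs z
      by_contra hcon
      push Not at hcon
      apply hz
      rw [← pe_add_po P y, map_add, hcon _ (Or.inl (pe_mem P y)), hcon _ (Or.inr (po_mem P y)),
        add_zero]
    obtain ⟨x, hx, hxπ⟩ := this
    let W : Submodule k P.carrier := Submodule.span k {x} ⊔ Submodule.span k {P.θ 0 x}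
    have hx' : P.θ 0 x ∈ P.ev ∨ P.θ 0 x ∈ P.od :=
      hx.elim (fun h => Or.inr (P.θ_ev 0 _ h)) (fun h => Or.inl (P.θ_od 0 _ h))
    have hθ : ∀ i, ∀ y ∈ W, P.θ i y ∈ W := by
      intro i y hy
      rw [Subsingleton.elim i 0]
      obtain ⟨u, hu, v, hv, rfl⟩ := Submodule.mem_sup.1 hy
      obtain ⟨c, rfl⟩ := Submodule.mem_span_singleton.1 hu
      obtain ⟨d, rfl⟩ := Submodule.mem_span_singleton.1 hv
      rw [map_add, map_smul, map_smul, vcat_sq hP.1, smul_zero, add_zero]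
      exact Submodule.mem_sup_right (Submodule.mem_span_singleton.2 ⟨c, rfl⟩)
    have hg : ∀ y ∈ W, pe P y ∈ W := by
      intro y hy
      obtain ⟨u, hu, v, hv, rfl⟩ := Submodule.mem_sup.1 hy
      rw [map_add]
      exact W.add_mem (Submodule.mem_sup_left (span_graded P x hx u hu))
        (Submodule.mem_sup_right (span_graded P _ hx' v hv))
    have hxW : x ∈ W := Submodule.mem_sup_left (Submodule.mem_span_singleton_self x)
    have hsur := hmin (sub P W hθ hg) W.subtype ?_ (sub_hom P W hθ hg) ?_
    · have hW : W = ⊤ := by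
        rw [← Submodule.range_subtype W]; exact LinearMap.range_eq_top.2 hsur
      have h1 := Submodule.finrank_add_le_finrank_add_finrank (Submodule.span k {x})
        (Submodule.span k {P.θ 0 x})
      have h2 := span_le_one (k := k) x
      have h3 := span_le_one (k := k) (P.θ 0 x)
      change Module.finrank k W ≤ _ at h1
      rw [hW, finrank_top] at h1
      omega
    · intro i j
      apply LinearMap.ext
      intro y
      apply Subtype.ext
      exact LinearMap.congr_fun (hP.1 i j) y.1
    · intro z
      obtain ⟨c, hc⟩ := exists_smul_eq_of_finrank_eq_one hK.1 hxπ z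
      exact ⟨⟨c • x, W.smul_mem c hxW⟩, (map_smul π c x).trans hc⟩
  have h1 := π.finrank_range_add_finrank_ker
  rw [LinearMap.range_eq_top.2 hs, finrank_top, hK.1, ← hr,
    LinearMap.finrank_range_of_inj hinj] at h1
  omega

lemma cond2_le [CharZero k] {M : GSupMod k (Fin 2)} (h : Cond2 M) (a : Fin 2 → k) (ha : a ≠ 0) :
    Module.finrank k M.carrier ≤ 1 + 2 * Module.finrank k (LinearMap.range (actOf M a)) := by
  obtain ⟨p, t, K, T, P, R, hK, hT, hP, ⟨φ, -, -, hφ⟩, ⟨ψ, -, -, hψ⟩⟩ := h a ha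
  have hT1 : Module.finrank k T.carrier ≤ 1 := by
    rcases hT with ⟨-, ⟨e, -⟩⟩ | ⟨-, hT⟩
    · rw [← e.finrank_eq, hK.1]
    · exact syz_le hK hT
  have hP1 := exact_finrank (P.θ 0) (vcat_sq hP.1 0) (proj1_exact hP)
  have hd : Module.finrank k M.carrier = Module.finrank k T.carrier + Module.finrank k P.carrier := by
    rw [← φ.finrank_eq, ψ.finrank_eq, Module.finrank_prod]
  let i : P.carrier →ₗ[k] M.carrier :=
    φ.toLinearMap ∘ₗ ψ.symm.toLinearMap ∘ₗ LinearMap.inr k T.carrier P.carrier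
  have hi : Function.Injective i := by
    intro x y hxy
    simp only [i, LinearMap.comp_apply, LinearEquiv.coe_coe] at hxy
    exact congrArg Prod.snd (ψ.symm.injective (φ.injective hxy))
  have hiθ : ∀ x, i (P.θ 0 x) = actOf M a (i x) := by
    intro x
    have h1 := hφ 0 (ψ.symm (0, x))
    have h2 := hψ 0 (ψ.symm (0, x))
    rw [LinearEquiv.apply_symm_apply] at h2
    have h3 : R.θ 0 (ψ.symm (0, x)) = ψ.symm (0, P.θ 0 x) := by
      rw [LinearEquiv.eq_symm_apply, h2]; simp
    rw [h3] at h1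
    exact h1
  have hle : Submodule.map i (LinearMap.range (P.θ 0)) ≤ LinearMap.range (actOf M a) := by
    rintro _ ⟨_, ⟨x, rfl⟩, rfl⟩
    exact ⟨i x, (hiθ x).symm⟩
  have h4 := Submodule.finrank_mono hle
  rw [finrank_map_inj i hi] at h4
  omega

end rankone

end CZ

namespace CZ

open SupCat SupCat.GSupMod

section ranktwo

variable {k : Type} [Field k]

lemma act_eq {M : GSupMod k (Fin 2)} (a : Fin 2 → k) (x : M.carrier) :
    actOf M a x = a 0 • M.θ 0 x + a 1 • M.θ 1 x := by
  simp [actOf, Fin.sum_univ_two]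

lemma anti {M : GSupMod k (Fin 2)} (hM : VCat k 2 M) (x : M.carrier) :
    M.θ 1 (M.θ 0 x) = - M.θ 0 (M.θ 1 x) := by
  have := LinearMap.congr_fun (hM 1 0) x
  simp only [LinearMap.add_apply, LinearMap.comp_apply, LinearMap.zero_apply] at this
  exact eq_neg_of_add_eq_zero_left this

/-- the first operator of the (co)free module -/
def c0 (V : Type) [AddCommGroup V] [Module k V] : (V × V × V × V) →ₗ[k] (V × V × V × V) where
  toFun x := (x.2.1, 0, -x.2.2.2, 0)
  map_add' x y := by simp [add_comm]
  map_smul' c x := by simp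

/-- the second operator of the (co)free module -/
def c1 (V : Type) [AddCommGroup V] [Module k V] : (V × V × V × V) →ₗ[k] (V × V × V × V) where
  toFun x := (x.2.2.1, x.2.2.2, 0, 0)
  map_add' x y := by simp
  map_smul' c x := by simp

/-- the (co)free module of rank `V` over the exterior algebra in two variables -/
def free2 {ι : Type} (V : GSupMod k ι) : GSupMod k (Fin 2) where
  carrier := V.carrier × V.carrier × V.carrier × V.carrier
  ev := V.ev.prod (V.od.prod (V.od.prod V.ev))
  od := V.od.prod (V.ev.prod (V.ev.prod V.od))
  isCompl := prod_isCompl V.isCompl (prod_isCompl V.isCompl.symm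
    (prod_isCompl V.isCompl.symm V.isCompl))
  θ := ![c0 V.carrier, c1 V.carrier]
  θ_ev := by
    intro i m hm
    obtain ⟨h1, h2, h3, h4⟩ := hm
    fin_cases i
    · exact ⟨h2, V.ev.zero_mem, V.ev.neg_mem h4, V.od.zero_mem⟩
    · exact ⟨h3, h4, V.ev.zero_mem, V.od.zero_mem⟩
  θ_od := by
    intro i m hm
    obtain ⟨h1, h2, h3, h4⟩ := hm
    fin_cases i
    · exact ⟨h2, V.od.zero_mem, V.od.neg_mem h4, V.ev.zero_mem⟩
    · exact ⟨h3, h4, V.od.zero_mem, V.ev.zero_mem⟩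

lemma free2_θ0 {ι : Type} (V : GSupMod k ι) (x y z w : V.carrier) :
    (free2 V).θ 0 (x, y, z, w) = (y, 0, -w, 0) := rfl

lemma free2_θ1 {ι : Type} (V : GSupMod k ι) (x y z w : V.carrier) :
    (free2 V).θ 1 (x, y, z, w) = (z, w, 0, 0) := rfl

lemma free2_cat {ι : Type} (V : GSupMod k ι) : VCat k 2 (free2 V) := by
  have key : ∀ u : V.carrier × V.carrier × V.carrier × V.carrier,
      c0 (k := k) V.carrier (c0 (k := k) V.carrier u) = 0 ∧
      c1 (k := k) V.carrier (c1 (k := k) V.carrier u) = 0 ∧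
      c0 (k := k) V.carrier (c1 (k := k) V.carrier u) +
      c1 (k := k) V.carrier (c0 (k := k) V.carrier u) = 0 := by
    rintro ⟨x, y, z, w⟩
    simp [c0, c1]
  intro i j
  apply LinearMap.ext
  intro u
  obtain ⟨h0, h1, h2⟩ := key u
  fin_cases i <;> fin_cases j
  · change c0 (k := k) V.carrier (c0 (k := k) V.carrier u) + c0 (k := k) V.carrier (c0 (k := k) V.carrier u) = 0
    rw [h0, add_zero]
  · exact h2
  · exact (add_comm _ _).trans h2
  · change c1 (k := k) V.carrier (c1 (k := k) V.carrier u) + c1 (k := k) V.carrier (c1 (k := k) V.carrier u) = 0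
    rw [h1, add_zero]

/-- the universal map to the cofree module -/
def cof (M : GSupMod k (Fin 2)) {V : Type} [AddCommGroup V] [Module k V]
    (f : M.carrier →ₗ[k] V) : M.carrier →ₗ[k] V × V × V × V :=
  f.prod ((f ∘ₗ M.θ 0).prod ((f ∘ₗ M.θ 1).prod (f ∘ₗ M.θ 0 ∘ₗ M.θ 1)))

lemma cof_hom [CharZero k] {ι : Type} {M : GSupMod k (Fin 2)} (hM : VCat k 2 M) (V : GSupMod k ι)
    (f : M.carrier →ₗ[k] V.carrier) (h0 : ∀ x ∈ M.ev, f x ∈ V.ev) (h1 : ∀ x ∈ M.od, f x ∈ V.od) :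
    IsHom M (free2 V) (cof M f) := by
  refine ⟨?_, ?_, ?_⟩
  · intro i
    apply LinearMap.ext
    intro x
    fin_cases i
    · change (f (M.θ 0 x), f (M.θ 0 (M.θ 0 x)), f (M.θ 1 (M.θ 0 x)), f (M.θ 0 (M.θ 1 (M.θ 0 x)))) =
        (f (M.θ 0 x), 0, -f (M.θ 0 (M.θ 1 x)), 0)
      simp [vcat_sq hM, anti hM]
    · change (f (M.θ 1 x), f (M.θ 0 (M.θ 1 x)), f (M.θ 1 (M.θ 1 x)), f (M.θ 0 (M.θ 1 (M.θ 1 x)))) =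
        (f (M.θ 1 x), f (M.θ 0 (M.θ 1 x)), 0, 0)
      simp [vcat_sq hM]
  · intro x hx
    exact ⟨h0 _ hx, h1 _ (M.θ_ev _ _ hx), h1 _ (M.θ_ev _ _ hx),
      h0 _ (M.θ_od _ _ (M.θ_ev _ _ hx))⟩
  · intro x hx
    exact ⟨h1 _ hx, h0 _ (M.θ_od _ _ hx), h0 _ (M.θ_od _ _ hx),
      h1 _ (M.θ_ev _ _ (M.θ_od _ _ hx))⟩

lemma free2_proj [CharZero k] {ι : Type} (V : GSupMod k ι) : IsProjective (VCat k 2) (free2 V) := by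
  refine ⟨free2_cat V, ?_⟩
  intro M N π f hM hN hπ hs hf
  obtain ⟨σ, hσ, hσ0, hσ1⟩ := graded_section hπ hs
  let u : V.carrier →ₗ[k] (free2 V).carrier :=
    LinearMap.inr k V.carrier (V.carrier × V.carrier × V.carrier) ∘ₗ
    LinearMap.inr k V.carrier (V.carrier × V.carrier) ∘ₗ LinearMap.inr k V.carrier V.carrier
  have hu : ∀ v, u v = (0, 0, 0, v) := fun v => rfl
  let g : V.carrier →ₗ[k] M.carrier := σ ∘ₗ f ∘ₗ u
  have hg : ∀ v, π (g v) = f (0, 0, 0, v) := fun v => by simp only [g, LinearMap.comp_apply, hσ, hu]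
  have g0 : ∀ v ∈ V.ev, g v ∈ M.ev := fun v hv =>
    hσ0 _ (hf.2.1 _ ⟨V.ev.zero_mem, V.od.zero_mem, V.od.zero_mem, hv⟩)
  have g1 : ∀ v ∈ V.od, g v ∈ M.od := fun v hv =>
    hσ1 _ (hf.2.2 _ ⟨V.od.zero_mem, V.ev.zero_mem, V.ev.zero_mem, hv⟩)
  let h : V.carrier × V.carrier × V.carrier × V.carrier →ₗ[k] M.carrier :=
    (M.θ 0 ∘ₗ M.θ 1 ∘ₗ g).coprod ((M.θ 1 ∘ₗ g).coprod ((-(M.θ 0 ∘ₗ g)).coprod g))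
  have hh : ∀ x y z w, h (x, y, z, w) =
      M.θ 0 (M.θ 1 (g x)) + (M.θ 1 (g y) + (-(M.θ 0 (g z)) + g w)) := by
    intro x y z w; simp [h]
  refine ⟨h, ⟨?_, ?_, ?_⟩, ?_⟩
  · intro i
    apply LinearMap.ext
    rintro ⟨x, y, z, w⟩
    fin_cases i
    · change h (y, 0, -w, 0) = M.θ 0 (h (x, y, z, w))
      rw [hh, hh]
      simp [vcat_sq hM]
    · change h (z, w, 0, 0) = M.θ 1 (h (x, y, z, w))
      rw [hh, hh]
      simp [vcat_sq hM, anti hM]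
  · rintro ⟨x, y, z, w⟩ ⟨h1, h2, h3, h4⟩
    change h ((x, y, z, w) : V.carrier × V.carrier × V.carrier × V.carrier) ∈ M.ev
    rw [hh]
    exact M.ev.add_mem (M.θ_od _ _ (M.θ_ev _ _ (g0 _ h1))) (M.ev.add_mem (M.θ_od _ _ (g1 _ h2))
      (M.ev.add_mem (M.ev.neg_mem (M.θ_od _ _ (g1 _ h3))) (g0 _ h4)))
  · rintro ⟨x, y, z, w⟩ ⟨h1, h2, h3, h4⟩
    change h ((x, y, z, w) : V.carrier × V.carrier × V.carrier × V.carrier) ∈ M.od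
    rw [hh]
    exact M.od.add_mem (M.θ_ev _ _ (M.θ_od _ _ (g1 _ h1))) (M.od.add_mem (M.θ_ev _ _ (g0 _ h2))
      (M.od.add_mem (M.od.neg_mem (M.θ_ev _ _ (g0 _ h3))) (g1 _ h4)))
  · apply LinearMap.ext
    rintro ⟨x, y, z, w⟩
    let F : V.carrier × V.carrier × V.carrier × V.carrier →ₗ[k] N.carrier := f
    have hgF : ∀ v, π (g v) = F (0, 0, 0, v) := hg
    have f1 : ∀ v, N.θ 1 (F (0, 0, 0, v)) = F (0, v, 0, 0) :=
      fun v => (hom_θ hf 1 (0, 0, 0, v)).symm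
    have f0 : ∀ v, N.θ 0 (F (0, 0, 0, v)) = F (0, 0, -v, 0) :=
      fun v => (hom_θ hf 0 (0, 0, 0, v)).symm
    have f01 : ∀ v, N.θ 0 (F (0, v, 0, 0)) = F (v, 0, -0, 0) :=
      fun v => (hom_θ hf 0 (0, v, 0, 0)).symm
    change π (h (x, y, z, w)) = F (x, y, z, w)
    rw [hh]
    simp only [map_add, map_neg, hom_θ hπ, hgF, f1, f0, f01]
    rw [← map_neg, ← map_add, ← map_add, ← map_add]
    congr 1
    simp

lemma split_dsum {ι : Type} {P M : GSupMod k ι} (g : M.carrier →ₗ[k] P.carrier)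
    (h : P.carrier →ₗ[k] M.carrier) (hg : IsHom M P g) (hh : IsHom P M h)
    (hgh : ∀ x, g (h x) = x) : ∃ B, IsDsum P B M := by
  have hθ : ∀ i, ∀ x ∈ LinearMap.ker g, M.θ i x ∈ LinearMap.ker g := by
    intro i x hx
    rw [LinearMap.mem_ker] at hx ⊢
    rw [hom_θ hg, hx, map_zero]
  have hp : ∀ x ∈ LinearMap.ker g, pe M x ∈ LinearMap.ker g := by
    intro x hx
    rw [LinearMap.mem_ker] at hx ⊢
    rw [even_pe M P g hg.2.1 hg.2.2, hx, map_zero]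
  let q : M.carrier →ₗ[k] LinearMap.ker g :=
    LinearMap.codRestrict _ (LinearMap.id - h ∘ₗ g) (by intro x; simp [hgh])
  have hq : ∀ x, (q x : M.carrier) = x - h (g x) := fun x => rfl
  let φ : M.carrier ≃ₗ[k] P.carrier × LinearMap.ker g :=
    { g.prod q with
      invFun := fun y => h y.1 + y.2.1
      left_inv := fun x => by
        change h (g x) + (q x : M.carrier) = x
        rw [hq]; abel
      right_inv := fun y => by
        have hy : g y.2.1 = 0 := y.2.2
        change (g (h y.1 + y.2.1), q (h y.1 + y.2.1)) = y
        refine Prod.ext ?_ (Subtype.ext ?_)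
        · simp [hgh]
        · rw [hq]; simp [hgh] }
  refine ⟨sub M (LinearMap.ker g) hθ hp, φ, ?_, ?_, ?_⟩
  · intro s
    change _ ↔ g s ∈ P.ev ∧ s - h (g s) ∈ M.ev
    refine ⟨fun hs => ⟨hg.2.1 _ hs, M.ev.sub_mem hs (hh.2.1 _ (hg.2.1 _ hs))⟩, fun hs => ?_⟩
    simpa using M.ev.add_mem hs.2 (hh.2.1 _ hs.1)
  · intro s
    change _ ↔ g s ∈ P.od ∧ s - h (g s) ∈ M.od
    refine ⟨fun hs => ⟨hg.2.2 _ hs, M.od.sub_mem hs (hh.2.2 _ (hg.2.2 _ hs))⟩, fun hs => ?_⟩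
    simpa using M.od.add_mem hs.2 (hh.2.2 _ hs.1)
  · intro i s
    refine Prod.ext (hom_θ hg i s) (Subtype.ext ?_)
    change M.θ i s - h (g (M.θ i s)) = M.θ i (s - h (g s))
    rw [map_sub, hom_θ hg, hom_θ hh]

/-- the one-dimensional graded space -/
def line (k : Type) [Field k] (E O : Submodule k k) (h : IsCompl E O) : GSupMod k (Fin 0) where
  carrier := k
  ev := E
  od := O
  isCompl := h
  θ := fun i => i.elim0
  θ_ev := fun i => i.elim0
  θ_od := fun i => i.elim0

lemma noproj [CharZero k] {M : GSupMod k (Fin 2)} (hM : VCat k 2 M)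
    (hnp : NoProjSummands (VCat k 2) M) (x : M.carrier) : M.θ 0 (M.θ 1 x) = 0 := by
  have main : ∀ (E O : Submodule k k) (hc : IsCompl E O) (φ : M.carrier →ₗ[k] k) (m : M.carrier),
      (∀ x ∈ M.ev, φ x ∈ E) → (∀ x ∈ M.od, φ x ∈ O) → φ (M.θ 0 (M.θ 1 m)) = 1 → False := by
    intro E O hc φ m h0 h1 hφ
    have hhom := cof_hom hM (line k E O hc) φ h0 h1
    have hsur : Function.Surjective (cof M φ) := by
      rintro ⟨x, y, z, w⟩
      have ev : ∀ u, cof M φ u = (φ u, φ (M.θ 0 u), φ (M.θ 1 u), φ (M.θ 0 (M.θ 1 u))) :=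
        fun u => rfl
      let y' := y - w * φ (M.θ 0 m)
      let z' := z - w * φ (M.θ 1 m)
      let u := w • m + y' • M.θ 1 m - z' • M.θ 0 m
      refine ⟨u + (x - φ u) • M.θ 0 (M.θ 1 m), ?_⟩
      rw [ev]
      refine Prod.ext ?_ (Prod.ext ?_ (Prod.ext ?_ ?_))
      · simp [hφ]
      · simp [u, hφ, vcat_sq hM, y']
      · simp [u, hφ, vcat_sq hM, anti hM, z']
      · simp [u, hφ, vcat_sq hM, anti hM]
    have hP := free2_proj (line k E O hc)
    obtain ⟨h, hh, hc'⟩ := hP.2 M (free2 (line k E O hc)) (cof M φ) LinearMap.id hM hP.1 hhom hsur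
      ⟨fun _ => rfl, fun _ h => h, fun _ h => h⟩
    obtain ⟨B, hB⟩ := split_dsum (P := free2 (line k E O hc)) (cof M φ) h hhom hh
      (fun x => LinearMap.congr_fun hc' x)
    have := hnp _ B hP hB (((1 : k), (0 : k), (0 : k), (0 : k)) : k × k × k × k)
    have h10 : (1 : k) = 0 := congrArg (fun u : k × k × k × k => u.1) this
    exact one_ne_zero h10
  have hev : ∀ m ∈ M.ev, M.θ 0 (M.θ 1 m) = 0 := by
    intro m hm
    by_contra hne
    obtain ⟨φ, h1, -, h3⟩ := exists_functional M.ev M.od ⊥ M.isCompl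
      (fun e he o ho h => by
        have := pe_eq M he ho
        rw [(Submodule.mem_bot k).1 h] at this
        simp [← this]) _ (M.θ_od 0 _ (M.θ_ev 1 _ hm)) (by simpa using hne)
    exact main ⊤ ⊥ isCompl_top_bot φ m (fun _ _ => trivial) (fun x hx => by simp [h3 x hx]) h1
  have hod : ∀ m ∈ M.od, M.θ 0 (M.θ 1 m) = 0 := by
    intro m hm
    by_contra hne
    obtain ⟨φ, h1, -, h3⟩ := exists_functional M.od M.ev ⊥ M.isCompl.symm
      (fun o ho e he h => by
        have := po_eq M he ho
        rw [add_comm, (Submodule.mem_bot k).1 h] at this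
        simp [← this]) _ (M.θ_ev 0 _ (M.θ_od 1 _ hm)) (by simpa using hne)
    exact main ⊥ ⊤ isCompl_bot_top φ m (fun x hx => by simp [h3 x hx]) (fun _ _ => trivial) h1
  rw [← pe_add_po M x, map_add, map_add, hev _ (pe_mem M x), hod _ (po_mem M x), add_zero]

end ranktwo

end CZ

namespace CZ

open SupCat SupCat.GSupMod

section main

variable {k : Type} [Field k]

/-- the socle -/
def soc (M : GSupMod k (Fin 2)) : Submodule k M.carrier :=
  LinearMap.ker (M.θ 0) ⊓ LinearMap.ker (M.θ 1)

lemma mem_soc {M : GSupMod k (Fin 2)} {x : M.carrier} :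
    x ∈ soc M ↔ M.θ 0 x = 0 ∧ M.θ 1 x = 0 := Iff.rfl

lemma mem_rad {M : GSupMod k (Fin 2)} {x : M.carrier} :
    x ∈ radical M ↔ ∃ y z, M.θ 0 y + M.θ 1 z = x := by
  have : radical M = LinearMap.range (M.θ 0) ⊔ LinearMap.range (M.θ 1) := by
    apply le_antisymm
    · refine iSup_le fun i => ?_
      fin_cases i
      · exact le_sup_left
      · exact le_sup_right
    · exact sup_le (le_iSup (fun i => LinearMap.range (M.θ i)) 0)
        (le_iSup (fun i => LinearMap.range (M.θ i)) 1)
  rw [this, Submodule.mem_sup]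
  constructor
  · rintro ⟨_, ⟨y, rfl⟩, _, ⟨z, rfl⟩, h⟩
    exact ⟨y, z, h⟩
  · rintro ⟨y, z, h⟩
    exact ⟨_, ⟨y, rfl⟩, _, ⟨z, rfl⟩, h⟩

lemma act_range_le {M : GSupMod k (Fin 2)} (a : Fin 2 → k) :
    LinearMap.range (actOf M a) ≤ radical M := by
  rintro _ ⟨x, rfl⟩
  rw [mem_rad]
  exact ⟨a 0 • x, a 1 • x, by simp [act_eq]⟩

lemma act_sq [CharZero k] {M : GSupMod k (Fin 2)} (hM : VCat k 2 M) (a : Fin 2 → k)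
    (x : M.carrier) : actOf M a (actOf M a x) = 0 := by
  simp only [act_eq, map_add, map_smul, vcat_sq hM, anti hM, smul_zero, zero_add, add_zero,
    smul_neg]
  rw [smul_comm (a 0) (a 1)]
  simp

lemma inj_retract [CharZero k] {I : GSupMod k (Fin 2)} (hI : IsInjective (VCat k 2) I) :
    ∃ R : I.carrier × I.carrier × I.carrier × I.carrier →ₗ[k] I.carrier,
      (∀ x, R (x, I.θ 0 x, I.θ 1 x, I.θ 0 (I.θ 1 x)) = x) ∧
      (∀ x y z w, I.θ 0 (R (x, y, z, w)) = R (y, 0, -w, 0)) ∧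
      (∀ x y z w, I.θ 1 (R (x, y, z, w)) = R (z, w, 0, 0)) := by
  obtain ⟨h, hh, hc⟩ := hI.2 I (free2 I) (cof I LinearMap.id) LinearMap.id hI.1 (free2_cat I)
    (cof_hom hI.1 I LinearMap.id (fun _ h => h) (fun _ h => h))
    (fun x y hxy => congrArg (fun u : I.carrier × I.carrier × I.carrier × I.carrier => u.1) hxy)
    ⟨fun _ => rfl, fun _ h => h, fun _ h => h⟩
  refine ⟨h, fun x => LinearMap.congr_fun hc x, ?_, ?_⟩
  · intro x y z w
    exact (hom_θ hh 0 (x, y, z, w)).symm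
  · intro x y z w
    exact (hom_θ hh 1 (x, y, z, w)).symm

lemma inj_exact [CharZero k] {I : GSupMod k (Fin 2)} (hI : IsInjective (VCat k 2) I)
    (a : Fin 2 → k) (ha : a ≠ 0) (x : I.carrier) (hx : actOf I a x = 0) :
    x ∈ LinearMap.range (actOf I a) := by
  obtain ⟨R, h, h0, h1⟩ := inj_retract hI
  rw [act_eq] at hx
  have e0 : a 1 • I.θ 0 (I.θ 1 x) = 0 := by
    have := congrArg (I.θ 0) hx
    simpa only [map_add, map_smul, vcat_sq hI.1, smul_zero, zero_add, map_zero] using this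
  have e1 : a 0 • I.θ 0 (I.θ 1 x) = 0 := by
    have := congrArg (I.θ 1) hx
    simpa only [map_add, map_smul, vcat_sq hI.1, smul_zero, add_zero, map_zero, anti hI.1,
      smul_neg, neg_eq_zero] using this
  by_cases ha0 : a 0 = 0
  · have ha1 : a 1 ≠ 0 := by
      intro ha1
      apply ha
      ext i
      fin_cases i
      · exact ha0
      · exact ha1
    have w0 : I.θ 0 (I.θ 1 x) = 0 := (smul_eq_zero.1 e0).resolve_left ha1
    have z0 : I.θ 1 x = 0 := by
      rw [ha0, zero_smul, zero_add] at hx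
      exact (smul_eq_zero.1 hx).resolve_left ha1
    refine ⟨R (0, 0, (a 1)⁻¹ • x, (a 1)⁻¹ • I.θ 0 x), ?_⟩
    rw [act_eq, h1, ha0, zero_smul, zero_add, ← map_smul]
    have := h x
    rw [w0, z0] at this
    rw [← this]
    congr 1
    simp [ha1, this]
  · have w0 : I.θ 0 (I.θ 1 x) = 0 := (smul_eq_zero.1 e1).resolve_left ha0
    refine ⟨R (0, (a 0)⁻¹ • x, 0, -((a 0)⁻¹ • I.θ 1 x)), ?_⟩
    rw [act_eq, h0, h1, ← R.map_smul, ← R.map_smul, ← R.map_add]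
    have := h x
    rw [w0] at this
    have y0 : I.θ 0 x = -((a 0)⁻¹ • a 1 • I.θ 1 x) := by
      have h2 : a 0 • I.θ 0 x = -(a 1 • I.θ 1 x) := eq_neg_of_add_eq_zero_left hx
      rw [← smul_neg, ← h2, smul_smul, inv_mul_cancel₀ ha0, one_smul]
    conv_rhs => rw [← this]
    congr 1
    simp [ha0, y0, smul_comm (a 1)]

lemma inj_rad [CharZero k] {I : GSupMod k (Fin 2)} (hI : IsInjective (VCat k 2) I)
    (x : I.carrier) (hx : I.θ 0 (I.θ 1 x) = 0) : x ∈ radical I := by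
  obtain ⟨R, h, h0, h1⟩ := inj_retract hI
  rw [mem_rad]
  refine ⟨R (0, x, 0, -I.θ 1 x), R (0, 0, 0, I.θ 0 x), ?_⟩
  rw [h0, h1, ← map_add]
  conv_rhs => rw [← h x, hx]
  congr 1
  simp

lemma inj_soc [CharZero k] {I : GSupMod k (Fin 2)} (hI : IsInjective (VCat k 2) I)
    (x : I.carrier) (hx : x ∈ soc I) : ∃ u, I.θ 0 (I.θ 1 u) = x := by
  obtain ⟨R, h, h0, h1⟩ := inj_retract hI
  obtain ⟨hx0, hx1⟩ := mem_soc.1 hx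
  refine ⟨R (0, 0, 0, x), ?_⟩
  rw [h1, h0]
  conv_rhs => rw [← h x, hx1, hx0, map_zero]
  congr 1
  simp

lemma prod_mem_soc [CharZero k] {M : GSupMod k (Fin 2)} (hM : VCat k 2 M) (x : M.carrier) :
    M.θ 0 (M.θ 1 x) ∈ soc M := by
  rw [mem_soc]
  simp [vcat_sq hM, anti hM]

lemma inj_rk [CharZero k] {I : GSupMod k (Fin 2)} (hI : IsInjective (VCat k 2) I) :
    rk I = Module.finrank k (soc I) := by
  have hk : LinearMap.ker (I.θ 0 ∘ₗ I.θ 1) = radical I := by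
    apply le_antisymm
    · intro x hx; exact inj_rad hI x hx
    · intro x hx
      obtain ⟨y, z, rfl⟩ := mem_rad.1 hx
      simp [vcat_sq hI.1, anti hI.1]
  have hr : LinearMap.range (I.θ 0 ∘ₗ I.θ 1) = soc I := by
    apply le_antisymm
    · rintro _ ⟨x, rfl⟩; exact prod_mem_soc hI.1 x
    · intro x hx; exact inj_soc hI x hx
  have h1 := (I.θ 0 ∘ₗ I.θ 1).finrank_range_add_finrank_ker
  have h2 := (radical I).finrank_quotient_add_finrank
  rw [hk, hr] at h1
  change rk I + _ = _ at h2
  omega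

lemma inj_dim [CharZero k] {I : GSupMod k (Fin 2)} (hI : IsInjective (VCat k 2) I) :
    Module.finrank k I.carrier = 4 * Module.finrank k (soc I) := by
  have hex : LinearMap.ker (I.θ 0) ≤ LinearMap.range (I.θ 0) := by
    have e : actOf I ![1, 0] = I.θ 0 := by
      apply LinearMap.ext; intro x; simp [act_eq]
    intro x hx
    have := inj_exact hI ![1, 0] (fun h => one_ne_zero (congrFun h 0)) x (by rw [e]; exact hx)
    rwa [e] at this
  have h1 := exact_finrank (I.θ 0) (vcat_sq hI.1 0) hex
  have hst : ∀ x ∈ LinearMap.range (I.θ 0), I.θ 1 x ∈ LinearMap.range (I.θ 0) := by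
    rintro _ ⟨x, rfl⟩
    exact ⟨-I.θ 1 x, by rw [anti hI.1, map_neg]⟩
  let f := (I.θ 1).restrict hst
  have hf : ∀ x, (f x).1 = I.θ 1 x.1 := fun x => rfl
  have h2 := exact_finrank f (fun x => Subtype.ext (by
      rw [hf, hf]; exact vcat_sq hI.1 1 x.1)) (by
    intro x hx
    have hx1 : I.θ 1 x.1 = 0 := congrArg Subtype.val hx
    have hx0 : I.θ 0 x.1 = 0 := by
      obtain ⟨y, hy⟩ := x.2
      rw [← hy, vcat_sq hI.1]
    obtain ⟨u, hu⟩ := inj_soc hI x.1 ⟨hx0, hx1⟩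
    refine ⟨⟨I.θ 0 (-u), ⟨_, rfl⟩⟩, Subtype.ext ?_⟩
    rw [hf]
    change I.θ 1 (I.θ 0 (-u)) = x.1
    rw [anti hI.1, map_neg, map_neg, neg_neg, hu])
  have h3 : Submodule.map (LinearMap.range (I.θ 0)).subtype (LinearMap.range f) = soc I := by
    apply le_antisymm
    · rintro _ ⟨_, ⟨⟨_, ⟨x, rfl⟩⟩, rfl⟩, rfl⟩
      change I.θ 1 (I.θ 0 x) ∈ _
      rw [anti hI.1]
      exact (soc I).neg_mem (prod_mem_soc hI.1 x)
    · intro x hx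
      obtain ⟨u, hu⟩ := inj_soc hI x hx
      refine ⟨f ⟨I.θ 0 (-u), ⟨_, rfl⟩⟩, ⟨_, rfl⟩, ?_⟩
      change I.θ 1 (I.θ 0 (-u)) = x
      rw [anti hI.1, map_neg, map_neg, neg_neg, hu]
  have h4 := finrank_map_inj _ (LinearMap.range (I.θ 0)).injective_subtype (LinearMap.range f)
  rw [h3] at h4
  omega

lemma hull_soc {M I : GSupMod k (Fin 2)} {j : M.carrier →ₗ[k] I.carrier}
    (h : IsInjHull (VCat k 2) M I j) : Submodule.map j (soc M) = soc I := by
  obtain ⟨hI, hj, hinj, hmin⟩ := h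
  have hom : ∀ x, (x ∈ I.ev ∨ x ∈ I.od) → x ∈ soc I → x ∈ LinearMap.range j := by
    intro x hx hxs
    by_contra hxr
    have hθ : ∀ i, ∀ y ∈ Submodule.span k {x}, I.θ i y ∈ Submodule.span k {x} := by
      intro i y hy
      obtain ⟨c, rfl⟩ := Submodule.mem_span_singleton.1 hy
      have : I.θ i x = 0 := by
        fin_cases i
        · exact hxs.1
        · exact hxs.2
      rw [map_smul, this, smul_zero]
      exact Submodule.zero_mem _
    have hinj' := hmin (quo I _ hθ (span_graded I x hx)) (Submodule.span k {x}).mkQ ?_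
      (quo_hom I _ hθ (span_graded I x hx)) ?_
    · have : x = 0 := by
        apply hinj'
        exact ((Submodule.Quotient.mk_eq_zero _).2 (Submodule.mem_span_singleton_self x)).trans
          (map_zero (Submodule.span k {x}).mkQ).symm
      exact hxr (this ▸ Submodule.zero_mem _)
    · intro a b
      apply LinearMap.ext
      intro y
      obtain ⟨y, rfl⟩ := Submodule.mkQ_surjective _ y
      exact congrArg (Submodule.span k {x}).mkQ (LinearMap.congr_fun (hI.1 a b) y)
    · rw [← LinearMap.ker_eq_bot, LinearMap.ker_eq_bot']
      intro m hm
      have hm' : j m ∈ Submodule.span k {x} := (Submodule.Quotient.mk_eq_zero _).1 hm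
      obtain ⟨c, hc⟩ := Submodule.mem_span_singleton.1 hm'
      by_cases hc0 : c = 0
      · apply hinj
        rw [← hc, hc0, zero_smul, map_zero]
      · exact absurd ⟨c⁻¹ • m, by rw [map_smul, ← hc, smul_smul, inv_mul_cancel₀ hc0, one_smul]⟩ hxr
  apply le_antisymm
  · rintro _ ⟨x, hx, rfl⟩
    rw [mem_soc, ← hom_θ hj, ← hom_θ hj]
    obtain ⟨h0, h1⟩ := mem_soc.1 hx
    rw [h0, h1]; simp
  · intro x hx
    obtain ⟨h0, h1⟩ := mem_soc.1 hx
    have hp : pe I x ∈ soc I := by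
      rw [mem_soc, odd_pe I _ (I.θ_ev 0) (I.θ_od 0), odd_pe I _ (I.θ_ev 1) (I.θ_od 1), h0, h1]
      simp
    have ho : po I x ∈ soc I := by
      rw [mem_soc, odd_po I _ (I.θ_ev 0) (I.θ_od 0), odd_po I _ (I.θ_ev 1) (I.θ_od 1), h0, h1]
      simp
    have : x ∈ LinearMap.range j := by
      rw [← pe_add_po I x]
      exact Submodule.add_mem _ (hom _ (Or.inl (pe_mem I x)) hp) (hom _ (Or.inr (po_mem I x)) ho)
    obtain ⟨m, rfl⟩ := this
    refine ⟨m, ?_, rfl⟩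
    rw [← hom_θ hj] at h0 h1
    exact mem_soc.2 ⟨hinj (by rw [h0, map_zero]), hinj (by rw [h1, map_zero])⟩

lemma hull_soc_dim {M I : GSupMod k (Fin 2)} {j : M.carrier →ₗ[k] I.carrier}
    (h : IsInjHull (VCat k 2) M I j) :
    Module.finrank k (soc I) = Module.finrank k (soc M) := by
  rw [← hull_soc h, finrank_map_inj j h.2.2.1]

lemma rad_map {I N : GSupMod k (Fin 2)} {p : I.carrier →ₗ[k] N.carrier} (hp : IsHom I N p)
    (hs : Function.Surjective p) : radical N = (radical I).map p := by
  ext x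
  rw [mem_rad, Submodule.mem_map]
  constructor
  · rintro ⟨y, z, rfl⟩
    obtain ⟨y, rfl⟩ := hs y
    obtain ⟨z, rfl⟩ := hs z
    exact ⟨I.θ 0 y + I.θ 1 z, mem_rad.2 ⟨y, z, rfl⟩, by rw [map_add, hom_θ hp, hom_θ hp]⟩
  · rintro ⟨w, hw, rfl⟩
    obtain ⟨y, z, rfl⟩ := mem_rad.1 hw
    exact ⟨p y, p z, by rw [map_add, hom_θ hp, hom_θ hp]⟩

lemma rk_le {I N : GSupMod k (Fin 2)} {p : I.carrier →ₗ[k] N.carrier} (hp : IsHom I N p)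
    (hs : Function.Surjective p) : rk N ≤ rk I := by
  have hle : radical I ≤ (radical N).comap p := by
    rw [rad_map hp hs]; exact Submodule.le_comap_map _ _
  apply LinearMap.finrank_le_finrank_of_surjective (f := (radical I).mapQ (radical N) p hle)
  intro x
  obtain ⟨x, rfl⟩ := Submodule.mkQ_surjective _ x
  obtain ⟨x, rfl⟩ := hs x
  exact ⟨(radical I).mkQ x, rfl⟩

lemma triv_line {ι : Type} (M : GSupMod k ι) (v : M.carrier) (hv : v ∈ M.ev ∨ v ∈ M.od)
    (hv0 : v ≠ 0) (hθ : ∀ i, M.θ i v = 0) :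
    ∃ (p : Bool) (h : ∀ i, ∀ x ∈ Submodule.span k {v}, M.θ i x ∈ Submodule.span k {v}),
      IsTrivial p (sub M (Submodule.span k {v}) h (span_graded M v hv)) := by
  have hz : ∀ i, ∀ x ∈ Submodule.span k {v}, M.θ i x = 0 := by
    intro i x hx
    obtain ⟨c, rfl⟩ := Submodule.mem_span_singleton.1 hx
    rw [map_smul, hθ, smul_zero]
  have h : ∀ i, ∀ x ∈ Submodule.span k {v}, M.θ i x ∈ Submodule.span k {v} := by
    intro i x hx
    rw [hz i x hx]; exact Submodule.zero_mem _
  have h1 : Module.finrank k (Submodule.span k {v}) = 1 := finrank_span_singleton hv0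
  have h2 : ∀ i, (sub M (Submodule.span k {v}) h (span_graded M v hv)).θ i = 0 := by
    intro i
    apply LinearMap.ext
    intro x
    exact Subtype.ext (hz i x.1 x.2)
  rcases hv with hv | hv
  · refine ⟨false, h, h1, h2, ?_⟩
    simp only [Bool.false_eq_true, if_false]
    rw [eq_top_iff]
    intro x _
    obtain ⟨c, hc⟩ := Submodule.mem_span_singleton.1 x.2
    change x.1 ∈ M.ev
    rw [← hc]; exact M.ev.smul_mem c hv
  · refine ⟨true, h, h1, h2, ?_⟩
    simp only [if_true]
    rw [eq_top_iff]
    intro x _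
    obtain ⟨c, hc⟩ := Submodule.mem_span_singleton.1 x.2
    change x.1 ∈ M.od
    rw [← hc]; exact M.od.smul_mem c hv

lemma triv_summand {N : GSupMod k (Fin 2)} (m : N.carrier) (hm : m ∉ radical N)
    (hms : m ∈ soc N) :
    ∃ (p : Bool) (K B : GSupMod k (Fin 2)), IsTrivial p K ∧ IsDsum K B N := by
  obtain ⟨h0, h1⟩ := mem_soc.1 hms
  have hg : ∀ x ∈ radical N, pe N x ∈ radical N := by
    intro x hx
    obtain ⟨y, z, rfl⟩ := mem_rad.1 hx
    rw [map_add, ← odd_po N _ (N.θ_ev 0) (N.θ_od 0), ← odd_po N _ (N.θ_ev 1) (N.θ_od 1)]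
    exact mem_rad.2 ⟨_, _, rfl⟩
  have : ∃ v, (v ∈ N.ev ∨ v ∈ N.od) ∧ v ∉ radical N ∧ ∀ i, N.θ i v = 0 := by
    by_cases hc : pe N m ∈ radical N
    · refine ⟨po N m, Or.inr (po_mem N m), fun hc' => hm ?_, ?_⟩
      · rw [← pe_add_po N m]; exact Submodule.add_mem _ hc hc'
      · intro i
        rw [odd_po N _ (N.θ_ev i) (N.θ_od i)]
        fin_cases i
        · simp [h0]
        · simp [h1]
    · refine ⟨pe N m, Or.inl (pe_mem N m), hc, ?_⟩
      intro i
      rw [odd_pe N _ (N.θ_ev i) (N.θ_od i)]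
      fin_cases i
      · simp [h0]
      · simp [h1]
  obtain ⟨v, hv, hvr, hvθ⟩ := this
  obtain ⟨p, h, ht⟩ := triv_line N v hv (fun h => hvr (h ▸ Submodule.zero_mem _)) hvθ
  obtain ⟨P, hP, hle, hPg⟩ := exists_graded_compl N (radical N) hg v hv hvr
  refine ⟨p, _, _, ht, sub_dsum N _ P hP h _ (fun i x _ => hle ?_) hPg⟩
  exact (le_iSup (fun i => LinearMap.range (N.θ i)) i) ⟨x, rfl⟩

lemma cond2_of [CharZero k] {N : GSupMod k (Fin 2)} (hN : VCat k 2 N)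
    (h : ∀ a : Fin 2 → k, a ≠ 0 →
      Module.finrank k N.carrier = 2 * Module.finrank k (LinearMap.range (actOf N a)) + 1) :
    Cond2 N := by
  intro a ha
  have hd := h a ha
  have hsq := act_sq hN a
  let A : N.carrier →ₗ[k] N.carrier := actOf N a
  let R : GSupMod k (Fin 1) :=
    { carrier := N.carrier
      ev := N.ev
      od := N.od
      isCompl := N.isCompl
      θ := fun _ => A
      θ_ev := fun _ => actOf_ev N a
      θ_od := fun _ => actOf_od N a }
  have hnot : ¬ LinearMap.ker A ≤ LinearMap.range A := by
    intro hle
    have := exact_finrank A hsq hle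
    change _ = 2 * Module.finrank k (LinearMap.range (actOf N a)) at this
    omega
  obtain ⟨m, hm, hmr⟩ := Set.not_subset.1 hnot
  have hm0 : A m = 0 := hm
  have : ∃ v, (v ∈ N.ev ∨ v ∈ N.od) ∧ v ∉ LinearMap.range A ∧ A v = 0 := by
    by_cases hc : pe N m ∈ LinearMap.range A
    · refine ⟨po N m, Or.inr (po_mem N m), fun hc' => hmr ?_, ?_⟩
      · rw [← pe_add_po N m]; exact Submodule.add_mem _ hc hc'
      · rw [odd_po N A (actOf_ev N a) (actOf_od N a), hm0, map_zero]
    · refine ⟨pe N m, Or.inl (pe_mem N m), hc, ?_⟩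
      rw [odd_pe N A (actOf_ev N a) (actOf_od N a), hm0, map_zero]
  obtain ⟨v, hv, hvr, hvA⟩ := this
  have hv0 : v ≠ 0 := fun h => hvr (h ▸ Submodule.zero_mem _)
  obtain ⟨p, hL, ht⟩ := triv_line R v hv hv0 (fun _ => hvA)
  obtain ⟨P, hP, hle, hPg⟩ := exists_graded_compl R (LinearMap.range A)
    (range_graded N A (actOf_ev N a) (actOf_od N a)) v hv hvr
  have hst : ∀ i, ∀ x ∈ P, R.θ i x ∈ P := fun i x _ => hle ⟨x, rfl⟩
  refine ⟨p, 0, _, _, sub R P hst hPg, R, ht, Or.inl ⟨rfl, LinearEquiv.refl k _,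
    fun _ => rfl, fun _ h => h, fun _ h => h⟩, ?_, ?_, sub_dsum R _ P hP hL _ hst hPg⟩
  · apply exact_proj1
    · intro i j
      apply LinearMap.ext
      intro x
      apply Subtype.ext
      change A (A x.1) + A (A x.1) = 0
      rw [hsq, add_zero]
    · let f : P →ₗ[k] P := A.restrict (hst 0)
      change LinearMap.ker f ≤ LinearMap.range f
      have hff : ∀ x, f (f x) = 0 := fun x => Subtype.ext (hsq x.1)
      have h1 : Module.finrank k (Submodule.span k {v}) = 1 := finrank_span_singleton hv0
      have h2 : _ = Module.finrank k N.carrier := Submodule.finrank_add_eq_of_isCompl hP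
      have h3 : Submodule.map P.subtype (LinearMap.range f) = LinearMap.range A := by
        apply le_antisymm
        · rintro _ ⟨_, ⟨x, rfl⟩, rfl⟩
          exact ⟨x.1, rfl⟩
        · rintro _ ⟨x, rfl⟩
          have : x ∈ Submodule.span k {v} ⊔ P := by rw [hP.sup_eq_top]; trivial
          obtain ⟨u, hu, q, hq, rfl⟩ := Submodule.mem_sup.1 this
          obtain ⟨c, rfl⟩ := Submodule.mem_span_singleton.1 hu
          refine ⟨f ⟨q, hq⟩, ⟨_, rfl⟩, ?_⟩
          rw [map_add, map_smul, hvA, smul_zero, zero_add]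
          rfl
      have h4 := finrank_map_inj P.subtype P.injective_subtype (LinearMap.range f)
      rw [h3] at h4
      have h5 := f.finrank_range_add_finrank_ker
      have hrk : LinearMap.range f ≤ LinearMap.ker f := by
        rintro _ ⟨x, rfl⟩; exact hff x
      have : LinearMap.range f = LinearMap.ker f := by
        apply Submodule.eq_of_le_of_finrank_eq hrk
        change Module.finrank k (LinearMap.range (actOf N a)) = _ at h4
        change _ + Module.finrank k P = _ at h2
        omega
      exact this.ge
  · refine ⟨LinearEquiv.refl k _, fun _ => Iff.rfl, fun _ => Iff.rfl, ?_⟩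
    intro i x
    have : i = 0 := Subsingleton.elim (α := Fin 1) i 0
    subst this
    rfl

end main

end CZ

namespace CZ

open SupCat SupCat.GSupMod

section final

variable {k : Type} [Field k]

lemma rk_add {M : GSupMod k (Fin 2)} :
    rk M + Module.finrank k (radical M) = Module.finrank k M.carrier :=
  Submodule.finrank_quotient_add_finrank _

lemma hom_act {M N : GSupMod k (Fin 2)} {f : M.carrier →ₗ[k] N.carrier} (hf : IsHom M N f)
    (a : Fin 2 → k) (x : M.carrier) : f (actOf M a x) = actOf N a (f x) := by
  simp only [act_eq, map_add, map_smul, hom_θ hf]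

lemma finrank_map_ker {V W : Type} [AddCommGroup V] [Module k V] [FiniteDimensional k V]
    [AddCommGroup W] [Module k W] (f : V →ₗ[k] W) (S : Submodule k V)
    (hS : LinearMap.ker f ≤ S) :
    Module.finrank k (S.map f) + Module.finrank k (LinearMap.ker f) = Module.finrank k S := by
  have h := LinearMap.finrank_range_add_finrank_ker (f.domRestrict S)
  rw [LinearMap.range_domRestrict] at h
  have e : Module.finrank k (LinearMap.ker (f.domRestrict S))
      = Module.finrank k (LinearMap.ker f) := by
    rw [LinearMap.ker_domRestrict]
    exact (Submodule.comapSubtypeEquivOfLe hS).finrank_eq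
  omega

lemma two_act {N : GSupMod k (Fin 2)} (a b : Fin 2 → k) (ha : a ≠ 0)
    (hb : b ∉ Submodule.span k {a}) (m : N.carrier) (h1 : actOf N a m = 0)
    (h2 : actOf N b m = 0) : m ∈ soc N := by
  have hd : a 0 * b 1 - a 1 * b 0 ≠ 0 := by
    intro hd
    apply hb
    rw [Submodule.mem_span_singleton]
    by_cases h0 : a 0 = 0
    · have h1 : a 1 ≠ 0 := by
        intro h1
        apply ha
        funext i
        fin_cases i
        · exact h0
        · exact h1
      have hb0 : b 0 = 0 := by
        have : a 1 * b 0 = 0 := by rw [h0] at hd; linear_combination -hd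
        exact (mul_eq_zero.1 this).resolve_left h1
      refine ⟨b 1 / a 1, ?_⟩
      funext i
      fin_cases i
      · simp [h0, hb0]
      · simp [h1]
    · refine ⟨b 0 / a 0, ?_⟩
      funext i
      fin_cases i
      · simp [h0]
      · simp only [Pi.smul_apply, smul_eq_mul, Fin.mk_one]
        field_simp
        linear_combination -hd
  rw [act_eq] at h1 h2
  rw [mem_soc]
  constructor
  · have : (a 0 * b 1 - a 1 * b 0) • N.θ 0 m
        = b 1 • (a 0 • N.θ 0 m + a 1 • N.θ 1 m) - a 1 • (b 0 • N.θ 0 m + b 1 • N.θ 1 m) := by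
      module
    rw [h1, h2, smul_zero, smul_zero, sub_zero] at this
    exact (smul_eq_zero.1 this).resolve_left hd
  · have : (a 0 * b 1 - a 1 * b 0) • N.θ 1 m
        = a 0 • (b 0 • N.θ 0 m + b 1 • N.θ 1 m) - b 0 • (a 0 • N.θ 0 m + a 1 • N.θ 1 m) := by
      module
    rw [h1, h2, smul_zero, smul_zero, sub_zero] at this
    exact (smul_eq_zero.1 this).resolve_left hd

lemma gen_not_range {N : GSupMod k (Fin 2)} (a : Fin 2 → k) (v : N.carrier)
    (hv : IsOmegaComponentGen N a v) : v ∉ LinearMap.range (actOf N a) := by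
  rintro ⟨w, hw⟩
  obtain ⟨hv0, L, P, hLP, hL, -, -, hav, hP⟩ := hv
  have hwt : w ∈ L ⊔ P := by rw [hLP.sup_eq_top]; trivial
  obtain ⟨l, hl, q, hq, rfl⟩ := Submodule.mem_sup.1 hwt
  rw [hL] at hl
  obtain ⟨c, rfl⟩ := Submodule.mem_span_singleton.1 hl
  rw [map_add, map_smul, hav, smul_zero, zero_add] at hw
  have h1 : v ∈ P := by
    have : v ∈ Submodule.map (actOf N a) P := ⟨q, hq, hw⟩
    rw [← hP] at this
    exact this.1
  have h2 : v ∈ L := by rw [hL]; exact Submodule.mem_span_singleton_self v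
  exact hv0 (Submodule.disjoint_def.1 hLP.disjoint v h2 h1)

lemma main_thm [CharZero k]
    (M : GSupMod k (Fin 2)) (hM : VCat k 2 M)
    (hnp : NoProjSummands (VCat k 2) M)
    (h1 : Cond1 M) (h2 : Cond2 M) (h3 : Cond3 M)
    (N : GSupMod k (Fin 2)) (hc : IsCosyzygy (VCat k 2) M N) :
      (Cond1 N ∧ Cond2 N ∧ Cond3 N) ∨
      ∃ (p : Bool) (K B : GSupMod k (Fin 2)),
        IsTrivial p K ∧ IsDsum K B N := by
  have hlt := h1 N hc
  obtain ⟨hN, I, j, p, hull, hp, hsurj, hker⟩ := hc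
  have hI := hull.1
  have hj := hull.2.1
  have hinj := hull.2.2.1
  have hMM := noproj hM hnp
  have e1 : (![1, 0] : Fin 2 → k) ≠ 0 := fun h => one_ne_zero (congrFun h 0)
  have hsr : soc M = radical M := by
    apply le_antisymm
    · intro x hx
      by_contra hxr
      obtain ⟨hx0, hx1⟩ := mem_soc.1 hx
      have hb : (![0, 1] : Fin 2 → k) ∉ Submodule.span k {(![1, 0] : Fin 2 → k)} := by
        intro h
        obtain ⟨c, hc⟩ := Submodule.mem_span_singleton.1 h
        have := congrFun hc 1
        simp at this
      rcases (h3.2 _ e1).2 _ hb x hxr with h | h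
      · apply h; simp [act_eq, hx0]
      · apply h; simp [act_eq, hx1]
    · intro x hx
      obtain ⟨y, z, rfl⟩ := mem_rad.1 hx
      rw [mem_soc]
      simp [vcat_sq hM, anti hM, hMM]
  have hs1 : Module.finrank k (soc M) = Module.finrank k (radical M) := by rw [hsr]
  have hs2 := hull_soc_dim hull
  have hI4 := inj_dim hI
  have hIr := inj_rk hI
  have hIa := rk_add (M := I)
  have hMa := rk_add (M := M)
  have hNa := rk_add (M := N)
  have hkle : LinearMap.ker p ≤ radical I := by
    rw [hker]
    rintro _ ⟨m, rfl⟩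
    apply inj_rad hI
    rw [← hom_θ hj, ← hom_θ hj, hMM, map_zero]
  have hkd : Module.finrank k (LinearMap.ker p) = Module.finrank k M.carrier := by
    rw [hker]; exact LinearMap.finrank_range_of_inj hinj
  have hrN := finrank_map_ker p _ hkle
  rw [← rad_map hp hsurj] at hrN
  have hNd := LinearMap.finrank_range_add_finrank_ker p
  rw [LinearMap.range_eq_top.2 hsurj, finrank_top] at hNd
  have hle1 : ∀ a : Fin 2 → k, Module.finrank k (LinearMap.range (actOf M a))
      ≤ Module.finrank k (radical M) := fun a => Submodule.finrank_mono (act_range_le a)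
  have hMeq : ∀ a : Fin 2 → k, a ≠ 0 → LinearMap.range (actOf M a) = radical M := by
    intro a ha
    apply Submodule.eq_of_le_of_finrank_eq (act_range_le a)
    have := cond2_le h2 a ha
    have := hle1 a
    omega
  have hd1 := cond2_le h2 _ e1
  have hd2 := hle1 ![1, 0]
  -- the range of each nonzero odd element on N is the radical
  have key : ∀ a : Fin 2 → k, a ≠ 0 → ∀ z : I.carrier, actOf I a z ∈ soc I →
      p z ∈ LinearMap.range (actOf N a) := by
    intro a ha z hz
    rw [← hull_soc hull, hsr, ← hMeq a ha] at hz
    obtain ⟨_, ⟨m, rfl⟩, hm⟩ := hz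
    rw [hom_act hj] at hm
    have h0 : actOf I a (z - j m) = 0 := by rw [map_sub, hm, sub_self]
    obtain ⟨w, hw⟩ := inj_exact hI a ha _ h0
    have hpj : p (j m) = 0 := by
      have : j m ∈ LinearMap.ker p := by rw [hker]; exact ⟨m, rfl⟩
      exact this
    refine ⟨p w, ?_⟩
    rw [← hom_act hp, hw, map_sub, hpj, sub_zero]
  have hNeq : ∀ a : Fin 2 → k, a ≠ 0 → LinearMap.range (actOf N a) = radical N := by
    intro a ha
    apply le_antisymm (act_range_le a)
    rw [rad_map hp hsurj]
    rintro _ ⟨z, hz, rfl⟩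
    apply key a ha
    obtain ⟨y, z, rfl⟩ := mem_rad.1 hz
    rw [mem_soc]
    simp [act_eq, vcat_sq hI.1, anti hI.1]
  have hC2 : Cond2 N := by
    apply cond2_of hN
    intro a ha
    rw [hNeq a ha]
    omega
  by_cases hsN : soc N ≤ radical N
  · left
    refine ⟨?_, hC2, hC2, ?_⟩
    · intro N' hc'
      obtain ⟨-, I', j', p', hull', hp', hsurj', -⟩ := hc'
      have t1 := rk_le hp' hsurj'
      have t2 := inj_rk hull'.1
      have t3 := hull_soc_dim hull'
      have t4 := Submodule.finrank_mono hsN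
      omega
    · intro a ha
      constructor
      · intro v hv
        rw [← hNeq a ha]
        exact gen_not_range a v hv
      · intro b hb m hm
        by_contra hcon
        rw [not_or, not_not, not_not] at hcon
        exact hm (hsN (two_act a b ha hb m hcon.1 hcon.2))
  · right
    obtain ⟨m, hms, hm⟩ := SetLike.not_le_iff_exists.1 hsN
    exact triv_summand m hm hms

end final

end CZ

open SupCat SupCat.GSupMod in
/-- Let `M` be a `V(a₂)`-supermodule with no projective
submodules satisfying conditions (1), (2) and (3).  Then either `Ω⁻¹(M)`
satisfies all three conditions, or `Ω⁻¹(M)` has a direct summand isomorphic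
to the trivial module `k` (of either parity). -/
theorem cosyzygy_conditions_or_trivial_summand
    (k : Type) [Field k] [IsAlgClosed k] [CharZero k]
    (M : GSupMod k (Fin 2)) (hM : VCat k 2 M)
    (hnp : NoProjSummands (VCat k 2) M)
    (h1 : Cond1 M) (h2 : Cond2 M) (h3 : Cond3 M) :
    ∀ N : GSupMod k (Fin 2), IsCosyzygy (VCat k 2) M N →
      (Cond1 N ∧ Cond2 N ∧ Cond3 N) ∨
      ∃ (p : Bool) (K B : GSupMod k (Fin 2)),
        IsTrivial p K ∧ IsDsum K B N := by
  intro N hN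
  exact CZ.main_thm M hM hnp h1 h2 h3 N hN
end
end
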